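/- Let D ⊂ ℂ be a bounded connected smoothly bounded domain, let X ⊆ ℂ^M be a closed complex submanifold, let r ≥ 2 be an integer, and let f : D̄ → ℂ^M be a map with f(D̄) ⊆ X which is of class C^r on D̄ and holomorphic in D. Given finitely many points z₁,…,z_l ∈ D and an integer k ∈ ℕ, there exist a sequence of open sets U_ν ⊆ ℂ containing D̄ and holomorphic maps f_ν : U_ν → ℂ^M with f_ν(U_ν) ⊆ X such that each f_ν agrees with f to order k at each of the points z_j, and f_ν → f in C^r(D̄): the derivatives of f_ν of all orders ≤ r converge uniformly on D̄ to the corresponding (continuously extended) derivatives of f. -/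

import Mathlib

open Set Filter Complex Metric

noncomputable section

abbrev Cn (N : ℕ) := EuclideanSpace ℂ (Fin N)

/-- A bounded open set `D ⊆ ℂ` is smoothly bounded. -/
def SmoothlyBounded (D : Set ℂ) : Prop :=
  ∃ V : Set ℂ, IsOpen V ∧ frontier D ⊆ V ∧
    ∃ v : ℂ → ℝ, ContDiffOn ℝ (⊤ : ℕ∞) v V ∧
      D ∩ V = {z ∈ V | v z < 0} ∧
      frontier D = {z ∈ V | v z = 0} ∧
      ∀ z ∈ frontier D, fderiv ℝ v z ≠ 0

/-- `f` is of class `C^r` on `D̄` and holomorphic in `D`. -/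
def ClassA {F : Type*} [NormedAddCommGroup F] [NormedSpace ℂ F] (r : ℕ) (D : Set ℂ)
    (f : ℂ → F) : Prop :=
  ContinuousOn f (closure D) ∧ DifferentiableOn ℂ f D ∧
  ∀ k ≤ r, ∃ g : ℂ → F, ContinuousOn g (closure D) ∧ EqOn g (iteratedDeriv k f) D

/-- `X ⊆ ℂ^M` is a closed complex submanifold of dimension `d`. -/
def ClosedComplexSubmanifold (M d : ℕ) (X : Set (Cn M)) : Prop :=
  IsClosed X ∧ ∀ x ∈ X, ∃ U U' : Set (Cn M), IsOpen U ∧ x ∈ U ∧ IsOpen U' ∧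
    ∃ Φ Ψ : Cn M → Cn M,
      DifferentiableOn ℂ Φ U ∧ MapsTo Φ U U' ∧
      DifferentiableOn ℂ Ψ U' ∧ MapsTo Ψ U' U ∧
      (∀ y ∈ U, Ψ (Φ y) = y) ∧ (∀ w ∈ U', Φ (Ψ w) = w) ∧
      Φ '' (X ∩ U) = U' ∩ {w : Cn M | ∀ j : Fin M, d ≤ (j : ℕ) → w j = 0}



namespace Approx
open MeasureTheory Topology
open scoped ContDiff Convolution

/-- The Cauchy-Riemann operator. -/
def dbar {E : Type} [NormedAddCommGroup E] [NormedSpace ℂ E] (φ : ℂ → E) (z : ℂ) : E :=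
  (2⁻¹ : ℂ) • (fderiv ℝ φ z 1 + I • fderiv ℝ φ z I)

section Pompeiu
variable {E : Type} [NormedAddCommGroup E] [NormedSpace ℂ E] [CompleteSpace E]

theorem pompeiu_polar_aux (φ : ℂ → E) (r θ : ℝ) (hr : 0 < r) :
    r • (((r * cexp (θ * I))⁻¹ : ℂ) • dbar φ (r * cexp (θ * I))) =
      (2⁻¹ : ℂ) • (fderiv ℝ φ (r * cexp (θ * I)) (cexp (θ * I)) +
        I • fderiv ℝ φ (r * cexp (θ * I)) (I * cexp (θ * I))) := by
  set w : ℂ := r * cexp (θ * I)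
  set A := fderiv ℝ φ w
  have h1 : cexp (θ * I) = (Real.cos θ) • (1 : ℂ) + (Real.sin θ) • I := by
    rw [Complex.exp_mul_I]; simp
  have h2 : I * cexp (θ * I) = (-Real.sin θ) • (1 : ℂ) + (Real.cos θ) • I := by
    rw [h1]; apply Complex.ext <;> simp
  have h3 : (r : ℂ) * w⁻¹ = cexp (-(θ * I)) := by
    simp only [w]
    rw [Complex.exp_neg, mul_inv, ← mul_assoc, mul_inv_cancel₀, one_mul]
    exact_mod_cast hr.ne'
  have h4 : cexp (-(θ * I)) = (Real.cos θ : ℂ) - (Real.sin θ : ℂ) * I := by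
    rw [← neg_mul, Complex.exp_mul_I, Complex.cos_neg, Complex.sin_neg]; push_cast; ring
  rw [h2, h1]
  simp only [map_add, map_smul]
  have h5 : ∀ (a : ℝ) (x : E), a • x = (a : ℂ) • x := fun a x => (Complex.coe_smul a x).symm
  simp only [h5]
  unfold dbar
  rw [smul_smul, h3, h4]
  have hI : (I : ℂ) * I = -1 := Complex.I_mul_I
  match_scalars
  · push_cast; linear_combination (0:ℂ)
  · push_cast; linear_combination (-(Complex.sin θ) * 2⁻¹ : ℂ) * hI

theorem pompeiu (φ : ℂ → E) (hφ : ContDiff ℝ 1 φ) (hc : HasCompactSupport φ) :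
    ∫ w : ℂ, w⁻¹ • dbar φ w = -((Real.pi : ℂ) • φ 0) := by
  obtain ⟨R, hR0, hR⟩ : ∃ R : ℝ, 0 < R ∧ ∀ w : ℂ, R ≤ ‖w‖ → φ w = 0 ∧ fderiv ℝ φ w = 0 := by
    obtain ⟨R, hR⟩ := hc.isCompact.isBounded.subset_ball 0
    refine ⟨max R 1, by positivity, fun w hw => ?_⟩
    have : w ∉ tsupport φ := fun h => by
      have := hR h
      simp at this
      have := le_max_left R 1
      linarith
    exact ⟨image_eq_zero_of_notMem_tsupport this, by
      by_contra h
      exact this (support_fderiv_subset ℝ h)⟩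
  have hcd : Continuous (fderiv ℝ φ) := hφ.continuous_fderiv one_ne_zero
  let A : ℝ × ℝ → E := fun p => fderiv ℝ φ (p.1 * cexp (p.2 * I)) (cexp (p.2 * I))
  let B : ℝ × ℝ → E := fun p => fderiv ℝ φ (p.1 * cexp (p.2 * I)) (I * cexp (p.2 * I))
  have hA : Continuous A := by fun_prop
  have hB : Continuous B := by fun_prop
  have hmeas : MeasurableSet (Ioi (0:ℝ) ×ˢ Ioo (-Real.pi) Real.pi) :=
    measurableSet_Ioi.prod measurableSet_Ioo
  have hintg : ∀ G : ℝ × ℝ → E, Continuous G → (∀ p, R ≤ |p.1| → G p = 0) →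
      IntegrableOn G (Ioi (0:ℝ) ×ˢ Ioo (-Real.pi) Real.pi) := by
    intro G hG hG0
    have h1 : IntegrableOn G (Icc (-R) R ×ˢ Icc (-Real.pi) Real.pi) :=
      hG.continuousOn.integrableOn_compact (isCompact_Icc.prod isCompact_Icc)
    refine IntegrableOn.of_forall_sdiff_eq_zero h1 hmeas ?_
    rintro ⟨a, b⟩ ⟨⟨ha, hb⟩, h⟩
    apply hG0
    by_contra! h'
    exact h ⟨⟨by have := abs_lt.1 h'; simp at this ⊢; linarith,
      by have := abs_lt.1 h'; simp at this ⊢; linarith⟩, Ioo_subset_Icc_self hb⟩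
  have hnorm : ∀ p : ℝ × ℝ, ‖(p.1 * cexp (p.2 * I) : ℂ)‖ = |p.1| := by
    intro p
    rw [norm_mul, Complex.norm_exp_ofReal_mul_I]; simp
  have hA0 : ∀ p, R ≤ |p.1| → A p = 0 := by
    intro p hp
    simp only [A]
    rw [(hR _ ((hnorm p).symm ▸ hp)).2]; simp
  have hB0 : ∀ p, R ≤ |p.1| → B p = 0 := by
    intro p hp
    simp only [B]
    rw [(hR _ ((hnorm p).symm ▸ hp)).2]; simp
  have hAi := hintg A hA hA0
  have hBi := hintg B hB hB0
  have e1 : ∫ p in Ioi (0:ℝ) ×ˢ Ioo (-Real.pi) Real.pi, A p = -((2 * Real.pi : ℝ) • φ 0) := by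
    have hAi' : IntegrableOn (fun p : ℝ × ℝ => A p.swap)
        (Ioo (-Real.pi) Real.pi ×ˢ Ioi (0:ℝ)) (volume.prod volume) := by
      have := hAi.swap
      exact this
    have := setIntegral_prod_swap (Ioi (0:ℝ)) (Ioo (-Real.pi) Real.pi) (μ := volume) (ν := volume) A
    rw [Measure.volume_eq_prod, ← this, setIntegral_prod _ hAi']
    have inner : ∀ θ : ℝ, ∫ r in Ioi (0:ℝ), A (r, θ) = - φ 0 := by
      intro θ
      have hder : ∀ r : ℝ, HasDerivAt (fun r : ℝ => φ (r * cexp (θ * I))) (A (r, θ)) r := by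
        intro r
        have h1 : HasDerivAt (fun r : ℝ => (r * cexp (θ * I) : ℂ)) (cexp (θ * I)) r := by
          simpa using (Complex.ofRealCLM.hasDerivAt (x := r)).mul_const (cexp (θ * I))
        exact ((hφ.differentiable one_ne_zero _).hasFDerivAt).comp_hasDerivAt r h1
      have h2 : ∫ r in Ioi (0:ℝ), A (r, θ) = ∫ r in Ioc (0:ℝ) R, A (r, θ) := by
        apply setIntegral_eq_of_subset_of_forall_sdiff_eq_zero measurableSet_Ioi
          Ioc_subset_Ioi_self
        rintro r ⟨hr, hr'⟩
        apply hA0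
        simp at hr hr' ⊢
        rw [abs_of_pos hr]
        exact (hr' hr).le
      rw [h2, ← intervalIntegral.integral_of_le hR0.le,
        intervalIntegral.integral_eq_sub_of_hasDerivAt (fun r _ => hder r)]
      · have : φ (R * cexp (θ * I)) = 0 := (hR _ (by rw [hnorm (R, θ)]; exact le_abs_self R)).1
        simp [this]
      · apply Continuous.intervalIntegrable
        exact hA.comp (by fun_prop)
    simp only [Prod.swap_prod_mk, inner]
    simp
    rw [max_eq_left (by linarith [Real.pi_pos]), two_mul]
  have e2 : ∫ p in Ioi (0:ℝ) ×ˢ Ioo (-Real.pi) Real.pi, B p = 0 := by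
    rw [Measure.volume_eq_prod, setIntegral_prod _ hBi]
    rw [setIntegral_eq_zero_of_forall_eq_zero]
    intro r hr
    have hr : 0 < r := hr
    have hder : ∀ θ : ℝ, HasDerivAt (fun θ : ℝ => r⁻¹ • φ (r * cexp (θ * I))) (B (r, θ)) θ := by
      intro θ
      have h0 : HasDerivAt (fun θ : ℝ => ((θ : ℂ) * I)) I θ := by
        simpa using (Complex.ofRealCLM.hasDerivAt (x := θ)).mul_const I
      have h1 : HasDerivAt (fun θ : ℝ => (r * cexp (θ * I) : ℂ)) (r • (I * cexp (θ * I))) θ := by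
        have := (h0.cexp).const_mul (r : ℂ)
        refine this.congr_deriv ?_
        rw [Complex.real_smul]; ring
      have h2 := (((hφ.differentiable one_ne_zero _).hasFDerivAt).comp_hasDerivAt θ h1).const_smul r⁻¹
      refine h2.congr_deriv ?_
      change r⁻¹ • (fderiv ℝ φ (r * cexp (θ * I)) (r • (I * cexp (θ * I)))) = _
      rw [map_smul, smul_smul, inv_mul_cancel₀ hr.ne', one_smul]
    rw [← integral_Ioc_eq_integral_Ioo, ← intervalIntegral.integral_of_le (by linarith [Real.pi_pos]),
        intervalIntegral.integral_eq_sub_of_hasDerivAt (fun θ _ => hder θ)]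
    · have : cexp (((-Real.pi : ℝ) : ℂ) * I) = cexp ((Real.pi : ℂ) * I) := by
        push_cast
        rw [neg_mul, Complex.exp_neg, Complex.exp_pi_mul_I]; norm_num
      rw [this]; simp
    · apply Continuous.intervalIntegrable
      exact hB.comp (by fun_prop)
  rw [← Complex.integral_comp_polarCoord_symm]
  have ht : polarCoord.target = Ioi (0:ℝ) ×ˢ Ioo (-Real.pi) Real.pi := rfl
  rw [ht]
  have : ∫ p in Ioi (0:ℝ) ×ˢ Ioo (-Real.pi) Real.pi,
      p.1 • ((Complex.polarCoord.symm p)⁻¹ • dbar φ (Complex.polarCoord.symm p)) =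
      ∫ p in Ioi (0:ℝ) ×ˢ Ioo (-Real.pi) Real.pi, ((2⁻¹ : ℂ) • A p + (2⁻¹ * I : ℂ) • B p) := by
    apply setIntegral_congr_fun hmeas
    rintro ⟨r, θ⟩ ⟨hr, hθ⟩
    have hs : Complex.polarCoord.symm (r, θ) = r * cexp (θ * I) := by
      rw [Complex.polarCoord_symm_apply, Complex.exp_mul_I]; push_cast; ring
    simp only [hs]
    rw [pompeiu_polar_aux φ r θ hr, smul_add, smul_smul]
  rw [this, integral_add (f := fun p => (2⁻¹ : ℂ) • A p) (g := fun p => (2⁻¹ * I : ℂ) • B p) (hAi.smul (2⁻¹ : ℂ)) (hBi.smul (2⁻¹ * I : ℂ)), integral_smul, integral_smul, e1, e2]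
  have h5 : ∀ (a : ℝ) (x : E), a • x = (a : ℂ) • x := fun a x => (Complex.coe_smul a x).symm
  rw [h5]
  simp only [smul_neg, smul_zero, add_zero, smul_smul]
  congr 2
  push_cast
  ring

end Pompeiu

/-- Cauchy transform. -/
def cauchyT {E : Type} [NormedAddCommGroup E] [NormedSpace ℂ E] (β : ℂ → E) (z : ℂ) : E :=
  ((Real.pi : ℂ)⁻¹) • ((fun w : ℂ => w⁻¹) ⋆[ContinuousLinearMap.lsmul ℝ ℂ, volume] β) z

section CT
variable {E : Type} [NormedAddCommGroup E] [NormedSpace ℂ E] [CompleteSpace E]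

theorem locInt_inv : LocallyIntegrable (fun w : ℂ => w⁻¹) volume := by
  refine locallyIntegrable_of_norm_le_rpow (C := 1) (α := 1) (by simp) (by simp)
    (Eventually.of_forall fun z => ?_) (by fun_prop)
  rw [norm_inv, Real.rpow_neg_one, one_mul]

theorem contDiff_cauchyT {β : ℂ → E} {m : ℕ} (hβ : ContDiff ℝ m β) (hc : HasCompactSupport β) :
    ContDiff ℝ m (cauchyT β) := by
  have := hc.contDiff_convolution_right (ContinuousLinearMap.lsmul ℝ ℂ) (locInt_inv) hβ
  exact contDiff_const.smul this

theorem dbar_cauchyT {β : ℂ → E} (hβ : ContDiff ℝ 1 β) (hc : HasCompactSupport β) (z : ℂ) :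
    dbar (cauchyT β) z = β z := by
  have h1 := hc.hasFDerivAt_convolution_right (ContinuousLinearMap.lsmul ℝ ℂ) (locInt_inv) hβ z
  have h2 := h1.const_smul ((Real.pi : ℂ)⁻¹)
  have h3 : fderiv ℝ (cauchyT β) z = _ := h2.fderiv
  have hap : ∀ x : ℂ, fderiv ℝ (cauchyT β) z x = ((Real.pi : ℂ)⁻¹) • ∫ t : ℂ, t⁻¹ • fderiv ℝ β (z - t) x := by
    intro x
    rw [h3]
    change ((Real.pi : ℂ)⁻¹) • ((((fun w : ℂ => w⁻¹) ⋆[ContinuousLinearMap.precompR ℂ (ContinuousLinearMap.lsmul ℝ ℂ), volume] fderiv ℝ β) z) x) = _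
    rw [convolution_precompR_apply _ locInt_inv (hc.fderiv ℝ) (hβ.continuous_fderiv one_ne_zero)]
    rfl
  have hintg : ∀ x : ℂ, Integrable (fun t : ℂ => t⁻¹ • fderiv ℝ β (z - t) x) := by
    intro x
    have h4 : HasCompactSupport (fun t => fderiv ℝ β t x) := (hc.fderiv ℝ).mono' (by
      intro t ht
      apply subset_tsupport
      intro h; apply ht; simp [h])
    have := h4.convolutionExists_right (L := ContinuousLinearMap.lsmul ℝ ℂ) locInt_inv
      ((hβ.continuous_fderiv one_ne_zero).clm_apply continuous_const) z
    exact this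
  unfold dbar
  rw [hap, hap, smul_comm I, ← smul_add, ← integral_smul, ← integral_add (hintg 1) (g := fun t : ℂ => I • t⁻¹ • fderiv ℝ β (z - t) I) ((hintg I).smul I)]
  have hp := pompeiu (fun t => β (z - t)) (hβ.comp (contDiff_const.sub contDiff_id)) (by
    exact hc.comp_homeomorph (Homeomorph.subLeft z))
  have hfd : ∀ t x : ℂ, fderiv ℝ (fun t => β (z - t)) t x = - fderiv ℝ β (z - t) x := by
    intro t x
    have : HasFDerivAt (fun t : ℂ => z - t) (-(ContinuousLinearMap.id ℝ ℂ)) t := by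
      simpa using (hasFDerivAt_id (𝕜 := ℝ) t).const_sub z
    have := ((hβ.differentiable one_ne_zero (z - t)).hasFDerivAt).comp t this
    have := this.fderiv
    change fderiv ℝ (β ∘ fun t => z - t) t x = _
    rw [this]; simp
  have : ∀ t : ℂ, t⁻¹ • dbar (fun t => β (z - t)) t = (-(2⁻¹ : ℂ)) • (t⁻¹ • fderiv ℝ β (z - t) 1 + I • t⁻¹ • fderiv ℝ β (z - t) I) := by
    intro t
    unfold dbar
    rw [hfd, hfd]
    module
  simp only [this, integral_smul] at hp
  have hpi : (Real.pi : ℂ) ≠ 0 := by exact_mod_cast Real.pi_ne_zero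
  simp only [sub_zero] at hp
  rw [neg_smul] at hp
  have hp := neg_injective hp
  rw [smul_comm, hp, smul_smul, inv_mul_cancel₀ hpi, one_smul]

end CT

end Approx



namespace Approx
open MeasureTheory Topology
open scoped ContDiff Convolution Manifold

/-- global smooth cutoff -/
theorem exists_cutoff {K U : Set ℂ} (hK : IsClosed K) (hU : IsOpen U) (hKU : K ⊆ U) :
    ∃ ψ : ℂ → ℝ, ContDiff ℝ ∞ ψ ∧ tsupport ψ ⊆ U ∧ (∃ W, IsOpen W ∧ K ⊆ W ∧ ∀ z ∈ W, ψ z = 1) ∧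
      ∀ z, ψ z ∈ Icc (0:ℝ) 1 := by
  obtain ⟨T, hTo, hKT, hTU⟩ := normal_exists_closure_subset hK hU hKU
  obtain ⟨f, h1, h0, hI⟩ := exists_contMDiffMap_one_nhds_of_subset_interior (n := (⊤ : ℕ∞)) 𝓘(ℝ, ℂ) (t := T) hK
    (by rwa [hTo.interior_eq])
  obtain ⟨W, hWo, hKW, hW⟩ := eventually_nhdsSet_iff_exists.1 h1
  refine ⟨f, f.contMDiff.contDiff, ?_, ⟨W, hWo, hKW, hW⟩, hI⟩
  refine (closure_mono ?_).trans hTU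
  intro z hz
  by_contra h
  exact hz (h0 z h)

/-- Defining data with a globally smooth defining function. -/
structure Bd (D : Set ℂ) (v : ℂ → ℝ) (V : Set ℂ) : Prop where
  smooth : ContDiff ℝ ∞ v
  isOpen : IsOpen V
  sub : frontier D ⊆ V
  mem_iff : ∀ z ∈ V, (z ∈ D ↔ v z < 0)
  fr_iff : ∀ z ∈ V, (z ∈ frontier D ↔ v z = 0)
  neg : ∀ z ∈ D, v z < 0
  ne : ∀ z ∈ V, fderiv ℝ v z ≠ 0

theorem exists_bd {D : Set ℂ} (h : SmoothlyBounded D) : ∃ v V, Bd D v V := by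
  obtain ⟨V, hVo, hfV, v, hv, h1, h2, h3⟩ := h
  obtain ⟨ψ, hψ, hs, ⟨W, hWo, hW, hW1⟩, hI⟩ := exists_cutoff isClosed_frontier hVo hfV
  let v' : ℂ → ℝ := fun z => ψ z * v z - (1 - ψ z)
  have hsm : ContDiff ℝ ∞ v' := by
    apply ContDiff.sub _ (contDiff_const.sub hψ)
    rw [contDiff_iff_contDiffAt]
    intro z
    by_cases hz : z ∈ tsupport ψ
    · exact hψ.contDiffAt.mul ((hv z (hs hz)).contDiffAt (hVo.mem_nhds (hs hz)))
    · apply contDiffAt_const (c := (0:ℝ)) |>.congr_of_eventuallyEq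
      filter_upwards [(isClosed_tsupport ψ).isOpen_compl.mem_nhds hz] with w hw
      simp [image_eq_zero_of_notMem_tsupport hw]
  have heq : ∀ z ∈ W, v' z = v z := by
    intro z hz
    simp [v', hW1 z hz]
  have hne : IsOpen {z | fderiv ℝ v' z ≠ 0} := by
    have : Continuous (fderiv ℝ v') := hsm.continuous_fderiv (by simp)
    exact isOpen_ne_fun this continuous_const
  refine ⟨v', W ∩ V ∩ {z | fderiv ℝ v' z ≠ 0}, hsm, (hWo.inter hVo).inter hne, ?_, ?_, ?_, ?_, ?_⟩
  · intro z hz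
    refine ⟨⟨hW hz, hfV hz⟩, ?_⟩
    have : v' =ᶠ[𝓝 z] v := by
      filter_upwards [hWo.mem_nhds (hW hz)] with w hw using heq w hw
    change fderiv ℝ v' z ≠ 0
    rw [this.fderiv_eq]
    exact h3 z hz
  · rintro z ⟨⟨hzW, hzV⟩, -⟩
    rw [heq z hzW]
    have := Set.ext_iff.1 h1 z
    simp only [mem_inter_iff, mem_setOf_eq] at this
    tauto
  · rintro z ⟨⟨hzW, hzV⟩, -⟩
    rw [heq z hzW]
    have := Set.ext_iff.1 h2 z
    simp only [mem_setOf_eq] at this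
    tauto
  · intro z hz
    by_cases h0 : ψ z = 0
    · simp [v', h0]
    · have hzV : z ∈ V := hs (subset_tsupport _ h0)
      have h4 : v z < 0 := by
        have := Set.ext_iff.1 h1 z
        simp only [mem_inter_iff, mem_setOf_eq] at this
        tauto
      have h5 := hI z
      have h6 : 0 < ψ z := lt_of_le_of_ne h5.1 (Ne.symm h0)
      have := h5.2
      simp only [v']
      nlinarith
  · rintro z ⟨-, h⟩
    exact h

theorem Bd.closure_le {D : Set ℂ} {v V} (h : Bd D v V) {z : ℂ} (hzV : z ∈ V) (hz : z ∈ closure D) : v z ≤ 0 := by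
  rw [closure_eq_self_union_frontier] at hz
  rcases hz with hz | hz
  · exact (h.neg z hz).le
  · exact ((h.fr_iff z hzV).1 hz).le

/-- Cone lemma. -/
theorem Bd.cone {D : Set ℂ} {v V} (h : Bd D v V) {p : ℂ} (hp : p ∈ frontier D) :
    ∃ (n : ℂ) (ρ κ : ℝ), n ≠ 0 ∧ 0 < ρ ∧ 0 < κ ∧ ball p ρ ⊆ V ∧
      ∀ z ∈ closure D, z ∈ ball p ρ → ∀ t : ℝ, 0 < t → t < ρ → ball (z - t * n) (κ * t) ⊆ D := by
  set A := fderiv ℝ v p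
  obtain ⟨n, hn⟩ : ∃ n : ℂ, A n = 1 := by
    have : A ≠ 0 := h.ne p (h.sub hp)
    obtain ⟨x, hx⟩ : ∃ x, A x ≠ 0 := by
      by_contra! hh
      exact this (by ext <;> simp [hh])
    refine ⟨(A x)⁻¹ • x, ?_⟩
    rw [map_smul, smul_eq_mul, inv_mul_cancel₀ hx]
  have hn0 : n ≠ 0 := by rintro rfl; simp at hn
  obtain ⟨κ, hκ, hκA, hκ1⟩ : ∃ κ : ℝ, 0 < κ ∧ ‖A‖ * κ ≤ 1/4 ∧ κ ≤ 1 := by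
    refine ⟨min 1 (1 / (4 * (‖A‖ + 1))), by positivity, ?_, min_le_left _ _⟩
    have h1 : min 1 (1 / (4 * (‖A‖ + 1))) ≤ 1 / (4 * (‖A‖ + 1)) := min_le_right _ _
    calc ‖A‖ * min 1 (1 / (4 * (‖A‖ + 1))) ≤ (‖A‖ + 1) * (1 / (4 * (‖A‖ + 1))) := by
          gcongr; linarith
      _ = 1/4 := by field_simp
  set c : ℝ := 1 / (4 * (‖n‖ + 1)) with hc
  have hc0 : 0 < c := by positivity
  have hstrict : HasStrictFDerivAt v A p :=
    (h.smooth.contDiffAt).hasStrictFDerivAt (by simp)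
  have hb := hstrict.isLittleO.def hc0
  have hb2 : ∀ᶠ q : ℂ × ℂ in 𝓝 p ×ˢ 𝓝 p, ‖v q.1 - v q.2 - A (q.1 - q.2)‖ ≤ c * ‖q.1 - q.2‖ := by
    rw [← nhds_prod_eq]; exact hb
  obtain ⟨S, hS, hSS⟩ := (eventually_prod_self_iff (r := fun a b : ℂ => ‖v a - v b - A (a - b)‖ ≤ c * ‖a - b‖)).1 hb2
  obtain ⟨η, hη, hηS⟩ := Metric.mem_nhds_iff.1 (Filter.inter_mem hS (h.isOpen.mem_nhds (h.sub hp)))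
  set ρ : ℝ := η / (‖n‖ + 2) with hρ
  have hρ0 : 0 < ρ := by positivity
  have hρη : ρ * (‖n‖ + 2) = η := by rw [hρ]; field_simp
  have hρη' : ρ ≤ η := by nlinarith [norm_nonneg n]
  refine ⟨n, ρ, κ, hn0, hρ0, hκ, fun z hz => (hηS (ball_subset_ball hρη' hz)).2, ?_⟩
  intro z hzc hz t ht htρ w hw
  have hzb : z ∈ ball p η := ball_subset_ball hρη' hz
  rw [mem_ball, dist_eq_norm] at hw hz
  have e1 : ‖w - z‖ ≤ (‖n‖ + κ) * t := by
    have : w - z = (w - (z - t * n)) - t * n := by ring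
    rw [this]
    refine (norm_sub_le _ _).trans ?_
    rw [norm_mul, Complex.norm_real, Real.norm_of_nonneg ht.le]
    nlinarith
  have e2 : w ∈ ball p η := by
    rw [mem_ball, dist_eq_norm]
    have : w - p = (w - z) + (z - p) := by ring
    rw [this]
    refine (norm_add_le _ _).trans_lt ?_
    have : (‖n‖ + κ) * t ≤ (‖n‖ + 1) * ρ := by gcongr
    nlinarith
  have e3 := hSS w (hηS e2).1 z (hηS hzb).1
  have e4 : A (w - z) ≤ -t + ‖A‖ * (κ * t) := by
    have : w - z = (w - (z - t * n)) - t • n := by rw [Complex.real_smul]; ring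
    rw [this, map_sub, map_smul, hn, smul_eq_mul, mul_one]
    have := (Real.le_norm_self _).trans (A.le_opNorm (w - (z - t * n)))
    have : ‖A‖ * ‖w - (z - t * n)‖ ≤ ‖A‖ * (κ * t) := by gcongr
    linarith
  have e5 := h.closure_le (hηS hzb).2 hzc
  rw [h.mem_iff w (hηS e2).2]
  have e6 := (Real.le_norm_self _).trans e3
  have e7 : c * ‖w - z‖ ≤ t / 4 := by
    calc c * ‖w - z‖ ≤ c * ((‖n‖ + 1) * t) := by
          gcongr; exact e1.trans (by gcongr)
      _ = t / 4 := by rw [hc]; field_simp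
  nlinarith

end Approx



namespace Approx
open MeasureTheory Topology
open scoped ContDiff Convolution Manifold

section dbarlemmas
variable {E : Type} [NormedAddCommGroup E] [NormedSpace ℂ E]

theorem dbar_congr {f g : ℂ → E} {z : ℂ} (h : f =ᶠ[𝓝 z] g) : dbar f z = dbar g z := by
  unfold dbar; rw [h.fderiv_eq]

theorem dbar_const (c : E) (z : ℂ) : dbar (fun _ => c) z = 0 := by
  unfold dbar; simp

theorem dbar_add {f g : ℂ → E} {z : ℂ} (hf : DifferentiableAt ℝ f z) (hg : DifferentiableAt ℝ g z) :
    dbar (fun z => f z + g z) z = dbar f z + dbar g z := by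
  unfold dbar
  rw [fderiv_fun_add hf hg]
  simp only [ContinuousLinearMap.add_apply]
  module

theorem dbar_sub {f g : ℂ → E} {z : ℂ} (hf : DifferentiableAt ℝ f z) (hg : DifferentiableAt ℝ g z) :
    dbar (fun z => f z - g z) z = dbar f z - dbar g z := by
  unfold dbar
  rw [fderiv_fun_sub hf hg]
  simp only [ContinuousLinearMap.sub_apply]
  module

theorem dbar_sum {ι : Type} (s : Finset ι) {f : ι → ℂ → E} {z : ℂ}
    (hf : ∀ j ∈ s, DifferentiableAt ℝ (f j) z) :
    dbar (fun z => ∑ j ∈ s, f j z) z = ∑ j ∈ s, dbar (f j) z := by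
  classical
  induction s using Finset.induction_on with
  | empty => simp [dbar_const]
  | insert a s ha ih =>
    simp only [Finset.sum_insert ha]
    rw [dbar_add (hf a (by simp)), ih (fun j hj => hf j (by simp [hj]))]
    apply DifferentiableAt.fun_sum
    intro j hj
    exact hf j (by simp [hj])

theorem dbar_smul {f : ℂ → ℂ} {g : ℂ → E} {z : ℂ} (hf : DifferentiableAt ℝ f z)
    (hg : DifferentiableAt ℝ g z) :
    dbar (fun z => f z • g z) z = f z • dbar g z + dbar f z • g z := by
  unfold dbar
  rw [fderiv_fun_smul hf hg]
  simp only [ContinuousLinearMap.add_apply, ContinuousLinearMap.smul_apply,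
    ContinuousLinearMap.smulRight_apply]
  simp only [smul_eq_mul]
  module

theorem dbar_of_holo {f : ℂ → E} {z : ℂ} (hf : DifferentiableAt ℂ f z) : dbar f z = 0 := by
  unfold dbar
  rw [hf.fderiv_restrictScalars ℝ]
  have : (I : ℂ) = I • (1 : ℂ) := by simp
  simp only [ContinuousLinearMap.coe_restrictScalars']
  conv_lhs => rw [this]
  rw [map_smul, smul_smul]
  simp

theorem holo_of_dbar {f : ℂ → E} {z : ℂ} (hf : DifferentiableAt ℝ f z) (h : dbar f z = 0) :
    DifferentiableAt ℂ f z := by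
  have h1 : fderiv ℝ f z I = I • fderiv ℝ f z 1 := by
    unfold dbar at h
    rw [smul_eq_zero_iff_right (by norm_num)] at h
    have h2 := congrArg (fun x => (-I) • x) h
    simp only [smul_add, smul_smul, smul_zero] at h2
    have h3 : -I * I = (1:ℂ) := by rw [neg_mul, I_mul_I, neg_neg]
    rw [h3, one_smul, neg_smul] at h2
    rw [← sub_eq_zero, ← h2]; abel
  rw [differentiableAt_complex_iff_differentiableAt_real]
  exact ⟨hf, h1⟩

theorem contDiff_dbar {f : ℂ → E} (hf : ContDiff ℝ ∞ f) : ContDiff ℝ ∞ (dbar f) := by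
  have h1 : ContDiff ℝ ∞ (fderiv ℝ f) := hf.fderiv_right (by simp)
  unfold dbar
  exact contDiff_const.smul ((h1.clm_apply contDiff_const).add
    (contDiff_const.smul (h1.clm_apply contDiff_const)))

theorem tsupport_dbar (f : ℂ → E) : tsupport (dbar f) ⊆ tsupport f := by
  apply closure_minimal _ (isClosed_tsupport f)
  intro z hz
  by_contra h
  apply hz
  have : f =ᶠ[𝓝 z] fun _ => 0 := by
    filter_upwards [(isClosed_tsupport f).isOpen_compl.mem_nhds h] with w hw
      using image_eq_zero_of_notMem_tsupport hw
  rw [dbar_congr this, dbar_const]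

end dbarlemmas

/-- coefficient functions of the flat cutoff -/
def flatA (μ : ℂ → ℂ) (a : ℂ → ℂ) : ℕ → ℂ → ℂ
  | 0 => a
  | m + 1 => fun z => -((m : ℂ) + 1)⁻¹ * (μ z * dbar (flatA μ a m) z)

/-- flat cutoff -/
def flatX (v : ℂ → ℝ) (μ : ℂ → ℂ) (a : ℂ → ℂ) (R : ℕ) (z : ℂ) : ℂ :=
  ∑ m ∈ Finset.range (R + 1), (v z : ℂ) ^ m * flatA μ a m z

theorem flatA_smooth {μ a : ℂ → ℂ} (hμ : ContDiff ℝ ∞ μ) (ha : ContDiff ℝ ∞ a) (m : ℕ) :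
    ContDiff ℝ ∞ (flatA μ a m) := by
  induction m with
  | zero => exact ha
  | succ m ih => exact contDiff_const.mul (hμ.mul (contDiff_dbar ih))

theorem flatA_tsupport {μ a : ℂ → ℂ} (m : ℕ) : tsupport (flatA μ a m) ⊆ tsupport a := by
  induction m with
  | zero => exact subset_rfl
  | succ m ih =>
    refine (closure_minimal ?_ (isClosed_tsupport _)).trans ih
    intro z hz
    apply tsupport_dbar
    apply subset_tsupport
    intro h
    apply hz
    simp [flatA, h]

theorem flatX_tsupport {v : ℂ → ℝ} {μ a : ℂ → ℂ} (R : ℕ) : tsupport (flatX v μ a R) ⊆ tsupport a := by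
  refine closure_minimal ?_ (isClosed_tsupport _)
  intro z hz
  by_contra h
  apply hz
  unfold flatX
  apply Finset.sum_eq_zero
  intro m _
  rw [image_eq_zero_of_notMem_tsupport (fun h' => h (flatA_tsupport m h')), mul_zero]

theorem flatX_smooth {v : ℂ → ℝ} {μ a : ℂ → ℂ} (hv : ContDiff ℝ ∞ v) (hμ : ContDiff ℝ ∞ μ)
    (ha : ContDiff ℝ ∞ a) (R : ℕ) : ContDiff ℝ ∞ (flatX v μ a R) := by
  unfold flatX
  apply ContDiff.sum
  intro m _
  exact ((Complex.ofRealCLM.contDiff.comp hv).pow m).mul (flatA_smooth hμ ha m)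

theorem dbar_flatX {v : ℂ → ℝ} {μ a : ℂ → ℂ} (hv : ContDiff ℝ ∞ v) (hμ : ContDiff ℝ ∞ μ)
    (ha : ContDiff ℝ ∞ a) (h1 : ∀ z ∈ tsupport a, μ z * dbar (fun z => (v z : ℂ)) z = 1) (R : ℕ) (z : ℂ) :
    dbar (flatX v μ a R) z = (v z : ℂ) ^ R * dbar (flatA μ a R) z := by
  have hvc : ContDiff ℝ ∞ (fun z => (v z : ℂ)) := Complex.ofRealCLM.contDiff.comp hv
  have hvd : DifferentiableAt ℝ (fun z => (v z : ℂ)) z := hvc.differentiable (by simp) z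
  have hpow : ∀ m : ℕ, dbar (fun z => (v z : ℂ) ^ (m + 1)) z = (m + 1) * (v z : ℂ) ^ m * dbar (fun z => (v z : ℂ)) z := by
    intro m
    induction m with
    | zero => simp
    | succ m ih =>
      have : (fun z => (v z : ℂ) ^ (m + 1 + 1)) = fun z => (v z : ℂ) ^ (m + 1) • (v z : ℂ) := by
        ext z; rw [smul_eq_mul, pow_succ]
      rw [this, dbar_smul (hvd.fun_pow _) hvd, ih]
      simp only [smul_eq_mul]
      push_cast; ring
  induction R with
  | zero =>
    have : flatX v μ a 0 = flatA μ a 0 := by ext z; simp [flatX]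
    rw [this]; simp
  | succ R ih =>
    have e : flatX v μ a (R + 1) = fun z => flatX v μ a R z + (v z : ℂ) ^ (R + 1) • flatA μ a (R + 1) z := by
      ext z; unfold flatX; rw [Finset.sum_range_succ _ (R + 1), smul_eq_mul]
    have d1 : DifferentiableAt ℝ (flatA μ a (R + 1)) z := (flatA_smooth hμ ha _).differentiable (by simp) z
    rw [e, dbar_add ((flatX_smooth hv hμ ha R).differentiable (by simp) z) ((hvd.fun_pow _).fun_smul d1),
      dbar_smul (hvd.fun_pow _) d1, hpow, ih]
    have key : ((R : ℂ) + 1) * dbar (fun z => (v z : ℂ)) z * flatA μ a (R + 1) z = - dbar (flatA μ a R) z := by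
      by_cases hz : z ∈ tsupport a
      · have h2 := h1 z hz
        have h3 : ((R : ℂ) + 1) ≠ 0 := by exact_mod_cast Nat.succ_ne_zero R
        simp only [flatA]
        have : ((R : ℂ) + 1) * ((R : ℂ) + 1)⁻¹ = 1 := mul_inv_cancel₀ h3
        linear_combination (-(μ z * dbar (fun z => (v z : ℂ)) z) * dbar (flatA μ a R) z) * this - dbar (flatA μ a R) z * h2
      · have h4 : flatA μ a (R + 1) z = 0 :=
          image_eq_zero_of_notMem_tsupport (fun h' => hz (flatA_tsupport _ h'))
        have h5 : dbar (flatA μ a R) z = 0 :=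
          image_eq_zero_of_notMem_tsupport (fun h' => hz (flatA_tsupport _ (tsupport_dbar _ h')))
        rw [h4, h5]; simp
    simp only [smul_eq_mul]
    linear_combination (v z : ℂ) ^ R * key

theorem sum_flatX {ι : Type} (s : Finset ι) {v : ℂ → ℝ} {μ : ℂ → ℂ} {a : ι → ℂ → ℂ}
    (hμ : ContDiff ℝ ∞ μ)
    (ha : ∀ j ∈ s, ContDiff ℝ ∞ (a j)) {W : Set ℂ} (hW : IsOpen W) (h1 : ∀ z ∈ W, ∑ j ∈ s, a j z = 1) (R : ℕ) :
    ∀ z ∈ W, ∑ j ∈ s, flatX v μ (a j) R z = 1 := by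
  have h2 : ∀ m, ∀ z ∈ W, ∑ j ∈ s, flatA μ (a j) m z = if m = 0 then 1 else 0 := by
    intro m
    induction m with
    | zero => simpa [flatA] using h1
    | succ m ih =>
      intro z hz
      have : ∑ j ∈ s, flatA μ (a j) (m+1) z = -((m : ℂ) + 1)⁻¹ * (μ z * ∑ j ∈ s, dbar (flatA μ (a j) m) z) := by
        simp only [flatA, Finset.mul_sum]
      rw [this, ← dbar_sum s (fun j hj => (flatA_smooth hμ (ha j hj) m).differentiable (by simp) z)]
      have : (fun z => ∑ j ∈ s, flatA μ (a j) m z) =ᶠ[𝓝 z] fun _ => (if m = 0 then 1 else 0) := by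
        filter_upwards [hW.mem_nhds hz] with w hw using ih w hw
      rw [dbar_congr this, dbar_const]; simp
  intro z hz
  unfold flatX
  rw [Finset.sum_comm]
  simp only [← Finset.mul_sum, h2 _ z hz]
  rw [Finset.sum_eq_single 0] <;> simp +contextual

theorem dbar_ofReal_ne {v : ℂ → ℝ} {z : ℂ} (hv : DifferentiableAt ℝ v z) (h : fderiv ℝ v z ≠ 0) :
    dbar (fun z => (v z : ℂ)) z ≠ 0 := by
  have h1 : HasFDerivAt (fun z => (v z : ℂ)) (Complex.ofRealCLM.comp (fderiv ℝ v z)) z :=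
    Complex.ofRealCLM.hasFDerivAt.comp z hv.hasFDerivAt
  unfold dbar
  rw [h1.fderiv]
  intro h2
  rw [smul_eq_zero_iff_right (by norm_num)] at h2
  simp only [ContinuousLinearMap.comp_apply, Complex.ofRealCLM_apply, smul_eq_mul] at h2
  have hre := congrArg Complex.re h2
  have him := congrArg Complex.im h2
  simp at hre him
  refine h (ContinuousLinearMap.ext fun x => ?_)
  have : x = x.re • (1:ℂ) + x.im • I := by simp
  rw [this, map_add, map_smul, map_smul, hre, him]; simp

/-- A finite family of flat cutoffs near the boundary. -/
theorem Bd.exists_flat {D : Set ℂ} {v V} (h : Bd D v V) (hD : Bornology.IsBounded D) (R : ℕ) :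
    ∃ (s : Finset ℂ) (χ b : ℂ → ℂ → ℂ) (n : ℂ → ℂ) (τ : ℂ → ℝ),
      (∀ j ∈ s, ContDiff ℝ ∞ (χ j) ∧ HasCompactSupport (χ j) ∧ ContDiff ℝ ∞ (b j) ∧
        HasCompactSupport (b j) ∧
        (∀ z, dbar (χ j) z = (v z : ℂ) ^ R * b j z) ∧
        0 < τ j ∧ ∀ t : ℝ, 0 < t → t < τ j → ∀ z ∈ closure D, z - t * n j ∈ D ∪ (tsupport (χ j))ᶜ) ∧
      ∃ W, IsOpen W ∧ frontier D ⊆ W ∧ ∀ z ∈ W, ∑ j ∈ s, χ j z = 1 := by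
  classical
  have hcpt : IsCompact (frontier D) :=
    Metric.isCompact_of_isClosed_isBounded isClosed_frontier (hD.closure.subset frontier_subset_closure)
  obtain ⟨ψ, hψ, hψs, ⟨V1, hV1o, hV1, hψ1⟩, -⟩ := exists_cutoff isClosed_frontier h.isOpen h.sub
  have hvc : ContDiff ℝ ∞ (fun z => (v z : ℂ)) := Complex.ofRealCLM.contDiff.comp h.smooth
  let μ : ℂ → ℂ := fun z => (ψ z : ℂ) * (dbar (fun z => (v z : ℂ)) z)⁻¹
  have hne : ∀ z ∈ V, dbar (fun z => (v z : ℂ)) z ≠ 0 := fun z hz =>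
    dbar_ofReal_ne (h.smooth.differentiable (by simp) z) (h.ne z hz)
  have hμ : ContDiff ℝ ∞ μ := by
    rw [contDiff_iff_contDiffAt]
    intro z
    by_cases hz : z ∈ tsupport ψ
    · exact (Complex.ofRealCLM.contDiff.comp hψ).contDiffAt.mul
        ((contDiff_dbar hvc).contDiffAt.inv (hne z (hψs hz)))
    · apply contDiffAt_const (c := (0:ℂ)) |>.congr_of_eventuallyEq
      filter_upwards [(isClosed_tsupport ψ).isOpen_compl.mem_nhds hz] with w hw
      simp [μ, image_eq_zero_of_notMem_tsupport hw]
  have hμ1 : ∀ z ∈ V1 ∩ V, μ z * dbar (fun z => (v z : ℂ)) z = 1 := by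
    rintro z ⟨hz, hzV⟩
    simp [μ, hψ1 z hz, hne z hzV]
  have hcone := fun p : frontier D => h.cone p.2
  choose n ρ κ hn hρ hκ hρV hc using hcone
  -- shrink radii so that balls lie in V1
  have hr : ∀ p : frontier D, ∃ r > 0, r ≤ ρ p / 2 ∧ closedBall (p : ℂ) r ⊆ V1 ∩ V := by
    intro p
    obtain ⟨r, hr, hr'⟩ := Metric.nhds_basis_closedBall.mem_iff.1 ((hV1o.inter h.isOpen).mem_nhds ⟨hV1 p.2, h.sub p.2⟩)
    exact ⟨min r (ρ p / 2), by have := hρ p; positivity, min_le_right _ _,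
      (closedBall_subset_closedBall (min_le_left _ _)).trans hr'⟩
  choose r hr0 hrρ hrV using hr
  obtain ⟨t, ht⟩ := hcpt.elim_finite_subcover (fun p : frontier D => ball (p : ℂ) (r p)) (fun _ => isOpen_ball)
    (fun z hz => mem_iUnion.2 ⟨⟨z, hz⟩, mem_ball_self (hr0 _)⟩)
  obtain ⟨T, hTo, hKT, hTU⟩ := normal_exists_closure_subset (isClosed_frontier (s := D))
    (isOpen_biUnion (fun (p : frontier D) (_ : p ∈ t) => isOpen_ball (x := (p : ℂ)) (ε := r p))) ht
  obtain ⟨P, hP⟩ := SmoothPartitionOfUnity.exists_isSubordinate 𝓘(ℝ, ℂ) (isClosed_closure (s := T))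
    (fun p : t => ball (p.1 : ℂ) (r p.1)) (fun _ => isOpen_ball) (by
      intro z hz
      obtain ⟨p, hp, hz⟩ := mem_iUnion₂.1 (hTU hz)
      exact mem_iUnion.2 ⟨⟨p, hp⟩, hz⟩)
  let s : Finset ℂ := t.image Subtype.val
  let a : ℂ → ℂ → ℂ := fun p z => if hp : ∃ q : t, (q.1 : ℂ) = p then (P hp.choose z : ℂ) else 0
  have ha : ∀ q : t, a q.1 = fun z => (P q z : ℂ) := by
    intro q
    ext z
    have hex : ∃ q' : t, (q'.1 : ℂ) = q.1 := ⟨q, rfl⟩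
    have : hex.choose = q := Subtype.ext (Subtype.ext hex.choose_spec)
    simp only [a]
    rw [dif_pos hex, this]
  have hsm : ∀ q : t, ContDiff ℝ ∞ (a q.1) := by
    intro q
    rw [ha]
    exact Complex.ofRealCLM.contDiff.comp (P q).contMDiff.contDiff
  have hts : ∀ q : t, tsupport (a q.1) ⊆ closedBall (q.1 : ℂ) (r q.1) := by
    intro q
    rw [ha]
    refine Subset.trans ?_ ((hP q).trans ball_subset_closedBall)
    apply closure_mono
    intro z hz h0
    apply hz
    simp [h0]
  let nn : ℂ → ℂ := fun p => if hp : p ∈ frontier D then n ⟨p, hp⟩ else 0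
  let ττ : ℂ → ℝ := fun p => if hp : p ∈ frontier D then min (ρ ⟨p, hp⟩) (ρ ⟨p, hp⟩ / 2 / ‖n ⟨p, hp⟩‖) else 0
  refine ⟨s, fun p => flatX v μ (a p) R, fun p => dbar (flatA μ (a p) R), nn, ττ, ?_, T, hTo, hKT, ?_⟩
  · intro p hp
    obtain ⟨q, hq, rfl⟩ := Finset.mem_image.1 hp
    have hsm' := hsm ⟨q, hq⟩
    have hts' := hts ⟨q, hq⟩
    simp only at hsm' hts'
    have hcs : HasCompactSupport (a q) := (isCompact_closedBall _ _).of_isClosed_subset (isClosed_tsupport _) hts'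
    have hnn : nn q = n q := by simp [nn]
    have hττ : ττ q = min (ρ q) (ρ q / 2 / ‖n q‖) := by simp [ττ]
    refine ⟨flatX_smooth h.smooth hμ hsm' R, hcs.of_isClosed_subset (isClosed_tsupport _) (flatX_tsupport R),
      contDiff_dbar (flatA_smooth hμ hsm' R), hcs.of_isClosed_subset (isClosed_tsupport _)
        ((tsupport_dbar _).trans (flatA_tsupport R)),
      dbar_flatX h.smooth hμ hsm' (fun z hz => hμ1 z (hrV q (hts' hz))) R, ?_, ?_⟩
    · rw [hττ]
      have := hρ q
      have := norm_pos_iff.2 (hn q)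
      positivity
    · intro t' ht0 htτ z hz
      rw [hττ, lt_min_iff] at htτ
      rw [hnn]
      by_cases hzb : z ∈ ball (q : ℂ) (ρ q)
      · left
        exact hc q z hz hzb t' ht0 htτ.1 (mem_ball_self (mul_pos (hκ q) ht0))
      · right
        intro hmem
        have h1 := hts' (flatX_tsupport R hmem)
        apply hzb
        rw [mem_closedBall, dist_eq_norm] at h1
        rw [mem_ball, dist_eq_norm]
        have h2 : z - (q : ℂ) = (z - t' * n q - q) + t' * n q := by ring
        rw [h2]
        refine (norm_add_le _ _).trans_lt ?_
        have h3 : ‖(t' : ℂ) * n q‖ < ρ q / 2 := by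
          rw [norm_mul, Complex.norm_real, Real.norm_of_nonneg ht0.le]
          exact (lt_div_iff₀ (norm_pos_iff.2 (hn q))).1 htτ.2
        have := hrρ q
        linarith
  · apply sum_flatX s hμ
    · intro p hp
      obtain ⟨q, hq, rfl⟩ := Finset.mem_image.1 hp
      exact hsm ⟨q, hq⟩
    · exact hTo
    · intro z hz
      have h1 := P.sum_eq_one (subset_closure hz)
      rw [finsum_eq_sum_of_fintype] at h1
      rw [Finset.sum_image (fun x _ y _ hxy => Subtype.ext hxy), ← Finset.sum_coe_sort]
      have : ∀ i : t, a i.1 z = (P i z : ℂ) := fun i => by rw [ha i]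
      rw [Finset.sum_congr rfl (fun i _ => this i)]
      exact_mod_cast h1

end Approx



namespace Approx
open MeasureTheory Topology
open scoped ContDiff Convolution Manifold

theorem flat_fderiv {v : ℂ → ℝ} {V D : Set ℂ} (h : Bd D v V) (hDo : IsOpen D)
    {E : Type} [NormedAddCommGroup E] [NormedSpace ℝ E] (g : ℂ → E)
    (h0 : ∀ z ∉ D, g z = 0) (hb : ∃ C, ∀ z ∈ D, ‖g z‖ ≤ C * |v z| ^ 2) {p : ℂ} (hp : p ∉ D) :
    HasFDerivAt g (0 : ℂ →L[ℝ] E) p := by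
  by_cases hpc : p ∈ closure D
  · have hpf : p ∈ frontier D := by rw [hDo.frontier_eq]; exact ⟨hpc, hp⟩
    have hv0 := (h.fr_iff p (h.sub hpf)).1 hpf
    obtain ⟨C, hC⟩ := hb
    have h1 : v =O[𝓝 p] fun z => z - p := by
      have := (h.smooth.differentiable (by simp) p).hasFDerivAt.isBigO_sub
      simpa [hv0] using this
    have h2 : g =O[𝓝 p] fun z => (v z) ^ 2 := by
      apply Asymptotics.IsBigO.of_bound |C|
      refine Eventually.of_forall fun z => ?_
      by_cases hz : z ∈ D
      · refine (hC z hz).trans ?_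
        rw [norm_pow, Real.norm_eq_abs]
        gcongr
        exact le_abs_self C
      · rw [h0 z hz]; simp; positivity
    have h3 : g =O[𝓝 p] fun z => ‖z - p‖ ^ 2 := h2.trans ((h1.norm_right).pow 2)
    rw [hasFDerivAt_iff_isLittleO]
    simp only [h0 p hp, sub_zero, ContinuousLinearMap.zero_apply]
    refine h3.trans_isLittleO ?_
    have : (fun z : ℂ => ‖z - p‖ ^ 2) = (fun x : ℂ => ‖x‖ ^ 2) ∘ (fun z => z - p) := rfl
    have h4 : (fun x : ℂ => ‖x‖ ^ 2) =o[𝓝 0] fun x => x := Asymptotics.isLittleO_norm_pow_id one_lt_two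
    have h5 : Tendsto (fun z : ℂ => z - p) (𝓝 p) (𝓝 0) := by
      have : Continuous fun z : ℂ => z - p := by fun_prop
      simpa using this.tendsto p
    exact h4.comp_tendsto h5
  · have : g =ᶠ[𝓝 p] fun _ => 0 := by
      filter_upwards [isClosed_closure.isOpen_compl.mem_nhds hpc] with z hz
      exact h0 z fun h' => hz (subset_closure h')
    exact (hasFDerivAt_const (0:E) p).congr_of_eventuallyEq this

theorem flat_ext {v : ℂ → ℝ} {V D : Set ℂ} (h : Bd D v V) (hDo : IsOpen D) (m : ℕ) :
    ∀ {E : Type} [NormedAddCommGroup E] [NormedSpace ℝ E] (g : ℂ → E),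
    (∀ z ∉ D, g z = 0) → ContDiffOn ℝ m g D →
    (∀ i ≤ m, ∃ C, ∀ z ∈ D, ‖iteratedFDeriv ℝ i g z‖ ≤ C * |v z| ^ 2) → ContDiff ℝ m g := by
  induction m with
  | zero =>
    intro E _ _ g h0 hg hb
    have hb0 : ∃ C, ∀ z ∈ D, ‖g z‖ ≤ C * |v z| ^ 2 := by simpa using hb 0 le_rfl
    simp only [CharP.cast_eq_zero, contDiff_zero]
    rw [continuous_iff_continuousAt]
    intro p
    by_cases hp : p ∈ D
    · exact (hg.continuousOn).continuousAt (hDo.mem_nhds hp)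
    · exact (flat_fderiv h hDo g h0 hb0 hp).continuousAt
  | succ m ih =>
    intro E _ _ g h0 hg hb
    have hb0 : ∃ C, ∀ z ∈ D, ‖g z‖ ≤ C * |v z| ^ 2 := by simpa using hb 0 (by simp)
    have hfd := fun p (hp : p ∉ D) => flat_fderiv h hDo g h0 hb0 hp
    push_cast
    rw [contDiff_succ_iff_fderiv]
    refine ⟨?_, by simp, ?_⟩
    · intro p
      by_cases hp : p ∈ D
      · exact (hg.differentiableOn (by simp)).differentiableAt (hDo.mem_nhds hp)
      · exact (hfd p hp).differentiableAt
    · apply ih (fderiv ℝ g) (fun z hz => (hfd z hz).fderiv)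
      · exact hg.fderiv_of_isOpen hDo (by simp)
      · intro i hi
        obtain ⟨C, hC⟩ := hb (i + 1) (by omega)
        refine ⟨C, fun z hz => ?_⟩
        rw [norm_iteratedFDeriv_fderiv]
        exact hC z hz

/-- Functions vanishing to order `N` at the boundary, with weights. -/
def OCl (v : ℂ → ℝ) (D : Set ℂ) (m N : ℕ) {E : Type} [NormedAddCommGroup E] [NormedSpace ℝ E] (g : ℂ → E) : Prop :=
  ContDiffOn ℝ m g D ∧ ∀ i ≤ m, ∃ C, ∀ z ∈ D, ‖iteratedFDeriv ℝ i g z‖ * |v z| ^ i ≤ C * |v z| ^ N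

theorem OCl.smul {v : ℂ → ℝ} {D : Set ℂ} (hDo : IsOpen D) {m N N' : ℕ} {E : Type} [NormedAddCommGroup E] [NormedSpace ℂ E]
    {f : ℂ → ℂ} {g : ℂ → E} (hf : OCl v D m N f) (hg : OCl v D m N' g) :
    OCl v D m (N + N') (fun z => f z • g z) := by
  refine ⟨hf.1.smul hg.1, fun i hi => ?_⟩
  choose! C hC using hf.2
  choose! C' hC' using hg.2
  refine ⟨∑ a ∈ Finset.range (i + 1), (i.choose a : ℝ) * (C a * C' (i - a)), fun z hz => ?_⟩
  have h1 := norm_iteratedFDerivWithin_smul_le hf.1 hg.1 hDo.uniqueDiffOn hz (n := i) (by exact_mod_cast hi)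
  simp only [iteratedFDerivWithin_of_isOpen _ hDo hz] at h1
  calc _ ≤ (∑ a ∈ Finset.range (i + 1), (i.choose a : ℝ) * ‖iteratedFDeriv ℝ a f z‖ *
        ‖iteratedFDeriv ℝ (i - a) g z‖) * |v z| ^ i := by gcongr
    _ ≤ _ := by
      rw [Finset.sum_mul, Finset.sum_mul]
      apply Finset.sum_le_sum
      intro a ha
      have ha : a ≤ i := by simpa [Nat.lt_succ_iff] using ha
      have e1 := hC a (ha.trans hi) z hz
      have e2 := hC' (i - a) ((Nat.sub_le _ _).trans hi) z hz
      have e3 : |v z| ^ i = |v z| ^ a * |v z| ^ (i - a) := by rw [← pow_add]; congr 1; omega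
      calc _ = (i.choose a : ℝ) * ((‖iteratedFDeriv ℝ a f z‖ * |v z| ^ a) * (‖iteratedFDeriv ℝ (i - a) g z‖ * |v z| ^ (i - a))) := by
            rw [e3]; ring
        _ ≤ (i.choose a : ℝ) * ((C a * |v z| ^ N) * (C' (i - a) * |v z| ^ N')) := by
            gcongr
            exact le_trans (by positivity) e1
        _ = _ := by rw [pow_add]; ring

theorem OCl.of_bdd {v : ℂ → ℝ} {D : Set ℂ} (hDb : Bornology.IsBounded D) (hv : Continuous v) {m : ℕ} {E : Type} [NormedAddCommGroup E] [NormedSpace ℝ E]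
    {f : ℂ → E} (hf : ContDiffOn ℝ m f D) (hb : ∀ i ≤ m, ∃ C, ∀ z ∈ D, ‖iteratedFDeriv ℝ i f z‖ ≤ C) :
    OCl v D m 0 f := by
  refine ⟨hf, fun i hi => ?_⟩
  obtain ⟨C, hC⟩ := hb i hi
  obtain ⟨K, hK⟩ := hDb.isCompact_closure.exists_bound_of_continuousOn hv.continuousOn
  refine ⟨C * K ^ i, fun z hz => ?_⟩
  have h2 := hK z (subset_closure hz)
  rw [Real.norm_eq_abs] at h2
  rw [pow_zero, mul_one]
  have := hC z hz
  gcongr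
  exact (norm_nonneg _).trans this

theorem OCl.of_smooth {v : ℂ → ℝ} {D : Set ℂ} (hDb : Bornology.IsBounded D) (hv : Continuous v) (m : ℕ) {E : Type} [NormedAddCommGroup E] [NormedSpace ℝ E]
    {f : ℂ → E} (hf : ContDiff ℝ ∞ f) : OCl v D m 0 f := by
  apply OCl.of_bdd hDb hv
  · exact (hf.of_le (by exact_mod_cast le_top)).contDiffOn
  · intro i _
    have : Continuous (iteratedFDeriv ℝ i f) := hf.continuous_iteratedFDeriv (by exact_mod_cast le_top)
    obtain ⟨K, hK⟩ := hDb.isCompact_closure.exists_bound_of_continuousOn this.continuousOn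
    exact ⟨K, fun z hz => hK z (subset_closure hz)⟩

theorem OCl.self_pow {v : ℂ → ℝ} {D : Set ℂ} (hDo : IsOpen D) (hDb : Bornology.IsBounded D) (hv : ContDiff ℝ ∞ v) (m N : ℕ) :
    OCl v D m N (fun z => (v z : ℂ) ^ N) := by
  have hvc : ContDiff ℝ ∞ (fun z => (v z : ℂ)) := Complex.ofRealCLM.contDiff.comp hv
  induction N with
  | zero => simpa using OCl.of_smooth hDb hv.continuous m (contDiff_const (c := (1:ℂ)))
  | succ N ih =>
    have h1 : OCl v D m 1 (fun z => (v z : ℂ)) := by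
      refine ⟨(hvc.of_le (by exact_mod_cast le_top)).contDiffOn, fun i hi => ?_⟩
      rcases i with _ | i
      · refine ⟨1, fun z hz => ?_⟩
        simp
      · obtain ⟨C, hC⟩ := (OCl.of_smooth (D := D) hDb hv.continuous i (f := fderiv ℝ (fun z => (v z : ℂ)))
          (hvc.fderiv_right (by simp))).2 i le_rfl
        refine ⟨C, fun z hz => ?_⟩
        have := hC z hz
        rw [norm_iteratedFDeriv_fderiv, pow_zero, mul_one] at this
        rw [pow_succ, ← mul_assoc, pow_one]
        gcongr
    have := OCl.smul hDo ih h1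
    simpa only [smul_eq_mul, ← pow_succ] using this

theorem OCl.extend {v : ℂ → ℝ} {V D : Set ℂ} (h : Bd D v V) (hDo : IsOpen D) {m N : ℕ} (hN : m + 2 ≤ N)
    {E : Type} [NormedAddCommGroup E] [NormedSpace ℝ E] (hDb : Bornology.IsBounded D)
    {g : ℂ → E} (hg : OCl v D m N g) (h0 : ∀ z ∉ D, g z = 0) : ContDiff ℝ m g := by
  apply flat_ext h hDo m g h0 hg.1
  intro i hi
  obtain ⟨C, hC⟩ := hg.2 i hi
  obtain ⟨K, hK⟩ := hDb.isCompact_closure.exists_bound_of_continuousOn h.smooth.continuous.continuousOn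
  refine ⟨|C| * K ^ (N - 2 - i), fun z hz => ?_⟩
  have h1 := hC z hz
  have h2 := hK z (subset_closure hz)
  rw [Real.norm_eq_abs] at h2
  have h3 : 0 < |v z| := abs_pos.2 (h.neg z hz).ne
  have e : |v z| ^ N = |v z| ^ (N - 2 - i) * |v z| ^ 2 * |v z| ^ i := by
    rw [← pow_add, ← pow_add]; congr 1; omega
  have h4 : ‖iteratedFDeriv ℝ i g z‖ * |v z| ^ i ≤ (|C| * K ^ (N - 2 - i) * |v z| ^ 2) * |v z| ^ i := by
    refine h1.trans ?_
    rw [e]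
    calc C * (|v z| ^ (N - 2 - i) * |v z| ^ 2 * |v z| ^ i) ≤ |C| * (K ^ (N - 2 - i) * |v z| ^ 2 * |v z| ^ i) := by
          gcongr
          exact le_abs_self C
      _ = _ := by ring
  exact le_of_mul_le_mul_right h4 (by positivity)

end Approx



namespace Approx
open MeasureTheory Topology
open scoped ContDiff Convolution Manifold

section jets
variable {E : Type} [NormedAddCommGroup E] [NormedSpace ℂ E]

/-- jets of x-derivatives up to order `r` on `Ω` -/
def Jt (r : ℕ) (Ω : Set ℂ) (K : ℕ → ℂ → E) : Prop :=
  ∀ i < r, ∀ z ∈ Ω, HasLineDerivAt ℝ (K i) (K (i + 1) z) z 1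

theorem HasLineDerivAt.congr_nhds {f g : ℂ → E} {z v : ℂ} {e : E} (h : HasLineDerivAt ℝ f e z v)
    (hfg : f =ᶠ[𝓝 z] g) : HasLineDerivAt ℝ g e z v := by
  unfold HasLineDerivAt at *
  refine h.congr_of_eventuallyEq ?_
  have : Tendsto (fun t : ℝ => z + t • v) (𝓝 0) (𝓝 z) := by
    have : Continuous (fun t : ℝ => z + t • v) := by fun_prop
    simpa using this.tendsto 0
  exact (this.eventually hfg).mono fun t ht => ht.symm

theorem Jt.unique {r : ℕ} {Ω : Set ℂ} (hΩ : IsOpen Ω) {K K' : ℕ → ℂ → E} (h : Jt r Ω K)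
    (h' : Jt r Ω K') (h0 : EqOn (K 0) (K' 0) Ω) : ∀ i ≤ r, EqOn (K i) (K' i) Ω := by
  intro i
  induction i with
  | zero => exact fun _ => h0
  | succ i ih =>
    intro hi z hz
    have e : K i =ᶠ[𝓝 z] K' i := (hΩ.mem_nhds hz) |> fun hh => by
      filter_upwards [hh] with w hw using ih (by omega) hw
    exact (HasLineDerivAt.congr_nhds (h i hi z hz) e).unique (h' i hi z hz)

theorem Jt.add {r : ℕ} {Ω : Set ℂ} {K K' : ℕ → ℂ → E} (h : Jt r Ω K)
    (h' : Jt r Ω K') : Jt r Ω (fun i z => K i z + K' i z) :=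
  fun i hi z hz => (HasDerivAt.add (h i hi z hz) (h' i hi z hz) :)

theorem Jt.sub {r : ℕ} {Ω : Set ℂ} {K K' : ℕ → ℂ → E} (h : Jt r Ω K)
    (h' : Jt r Ω K') : Jt r Ω (fun i z => K i z - K' i z) :=
  fun i hi z hz => (HasDerivAt.sub (h i hi z hz) (h' i hi z hz) :)

theorem Jt.mono {r : ℕ} {Ω Ω' : Set ℂ} {K : ℕ → ℂ → E} (h : Jt r Ω K) (hs : Ω' ⊆ Ω) : Jt r Ω' K :=
  fun i hi z hz => h i hi z (hs hz)

theorem Jt.zero {r : ℕ} {Ω : Set ℂ} : Jt r Ω (fun _ _ => (0 : E)) :=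
  fun i hi z hz => (hasDerivAt_const (0:ℝ) (0:E) :)

theorem hasLineDerivAt_of_holo {f : ℂ → E} {z : ℂ} (h : DifferentiableAt ℂ f z) :
    HasLineDerivAt ℝ f (deriv f z) z 1 := by
  have := (h.hasDerivAt.hasFDerivAt.restrictScalars ℝ).hasLineDerivAt 1
  simpa using this

theorem Jt.of_contDiff {r : ℕ} {u : ℂ → E} (hu : ContDiff ℝ r u) :
    ∃ K : ℕ → ℂ → E, K 0 = u ∧ (∀ i ≤ r, Continuous (K i)) ∧ Jt r univ K := by
  induction r generalizing u with
  | zero => exact ⟨fun _ => u, rfl, fun i _ => hu.continuous, fun i hi => absurd hi (by omega)⟩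
  | succ r ih =>
    have h1 : ContDiff ℝ r (fun z => fderiv ℝ u z 1) := by
      have : ContDiff ℝ r (fderiv ℝ u) := hu.fderiv_right (by norm_cast)
      exact this.clm_apply contDiff_const
    obtain ⟨K, h0, hc, hJ⟩ := ih h1
    refine ⟨fun i => Nat.casesOn i u K, rfl, ?_, ?_⟩
    · intro i hi
      cases i with
      | zero => exact hu.continuous
      | succ i => exact hc i (by omega)
    · intro i hi z hz
      cases i with
      | zero =>
        have : HasLineDerivAt ℝ u (fderiv ℝ u z 1) z 1 :=
          ((hu.differentiable (by norm_cast)) z).hasFDerivAt.hasLineDerivAt 1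
        simpa [h0] using this
      | succ i => exact hJ i (by omega) z hz

theorem Jt.smul {r : ℕ} {Ω : Set ℂ} {X : ℕ → ℂ → ℂ} {K : ℕ → ℂ → E} (h : Jt r Ω X)
    (h' : Jt r Ω K) :
    Jt r Ω (fun n z => ∑ a ∈ Finset.HasAntidiagonal.antidiagonal n, (n.choose a.1) • (X a.1 z • K a.2 z)) := by
  intro n hn z hz
  simp only
  rw [Finset.sum_antidiagonal_choose_succ_nsmul (fun i j => X i z • K j z) n, ← Finset.sum_add_distrib]
  unfold HasLineDerivAt
  apply HasDerivAt.fun_sum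
  intro a ha
  have ha' := Finset.HasAntidiagonal.mem_antidiagonal.1 ha
  have h1 : HasDerivAt (fun t : ℝ => X a.1 (z + t • 1)) (X (a.1+1) z) 0 := h a.1 (by omega) z hz
  have h2 : HasDerivAt (fun t : ℝ => K a.2 (z + t • 1)) (K (a.2+1) z) 0 := h' a.2 (by omega) z hz
  have h3 := (h1.smul h2).const_smul (n.choose a.1)
  have e : n.choose a.2 = n.choose a.1 := (Nat.choose_symm_of_eq_add (by omega)).symm
  rw [e]
  simpa [Pi.smul_def] using h3

variable [CompleteSpace E]

theorem holo_contDiffAt {Ω : Set ℂ} (hΩ : IsOpen Ω) {h : ℂ → E} (hh : DifferentiableOn ℂ h Ω)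
    {z : ℂ} (hz : z ∈ Ω) (n : WithTop ℕ∞) : ContDiffAt ℂ n h z :=
  (hh.contDiffOn hΩ).contDiffAt (hΩ.mem_nhds hz)

theorem holo_iteratedDeriv {Ω : Set ℂ} (hΩ : IsOpen Ω) {h : ℂ → E} (hh : DifferentiableOn ℂ h Ω) (i : ℕ) :
    DifferentiableOn ℂ (iteratedDeriv i h) Ω := by
  induction i with
  | zero => simpa using hh
  | succ i ih => rw [iteratedDeriv_succ]; exact ih.deriv hΩ

theorem Jt.of_holo {r : ℕ} {Ω : Set ℂ} (hΩ : IsOpen Ω) {h : ℂ → E} (hh : DifferentiableOn ℂ h Ω) :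
    Jt r Ω (fun i => iteratedDeriv i h) := by
  intro i hi z hz
  have := hasLineDerivAt_of_holo ((holo_iteratedDeriv hΩ hh i).differentiableAt (hΩ.mem_nhds hz))
  simpa [iteratedDeriv_succ] using this

end jets
end Approx



namespace Approx
open MeasureTheory Topology
open scoped ContDiff Convolution Manifold

section apx
variable {E : Type} [NormedAddCommGroup E] [NormedSpace ℂ E]

def Apx (r : ℕ) (D : Set ℂ) (f : ℂ → E) (U : ℕ → Set ℂ) (g : ℕ → ℂ → E) : Prop :=
  (∀ ν, IsOpen (U ν) ∧ closure D ⊆ U ν ∧ DifferentiableOn ℂ (g ν) (U ν)) ∧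
  ∀ i ≤ r, ∃ F : ℂ → E, ContinuousOn F (closure D) ∧ EqOn F (iteratedDeriv i f) D ∧
    TendstoUniformlyOn (fun ν => iteratedDeriv i (g ν)) F atTop (closure D)

theorem iteratedDeriv_congr_open {D : Set ℂ} (hD : IsOpen D) {f f' : ℂ → E} (h : EqOn f f' D) (i : ℕ) :
    EqOn (iteratedDeriv i f) (iteratedDeriv i f') D := by
  intro z hz
  exact Filter.EventuallyEq.iteratedDeriv_eq i (by filter_upwards [hD.mem_nhds hz] with w hw using h hw)

theorem Apx.congr {r : ℕ} {D : Set ℂ} (hD : IsOpen D) {f f' : ℂ → E} {U g} (h : Apx r D f U g)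
    (hff : EqOn f f' D) : Apx r D f' U g := by
  refine ⟨h.1, fun i hi => ?_⟩
  obtain ⟨F, h1, h2, h3⟩ := h.2 i hi
  exact ⟨F, h1, h2.trans (iteratedDeriv_congr_open hD hff i), h3⟩

variable [CompleteSpace E]

theorem Apx.add {r : ℕ} {D : Set ℂ} (hD : IsOpen D) {f f' : ℂ → E} (hf : DifferentiableOn ℂ f D)
    (hf' : DifferentiableOn ℂ f' D) {U g U' g'} (h : Apx r D f U g)
    (h' : Apx r D f' U' g') : Apx r D (fun z => f z + f' z) (fun ν => U ν ∩ U' ν) (fun ν z => g ν z + g' ν z) := by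
  refine ⟨fun ν => ⟨(h.1 ν).1.inter (h'.1 ν).1, subset_inter (h.1 ν).2.1 (h'.1 ν).2.1,
    ((h.1 ν).2.2.mono inter_subset_left).add ((h'.1 ν).2.2.mono inter_subset_right)⟩, fun i hi => ?_⟩
  obtain ⟨F, h1, h2, h3⟩ := h.2 i hi
  obtain ⟨F', h1', h2', h3'⟩ := h'.2 i hi
  refine ⟨fun z => F z + F' z, h1.add h1', fun z hz => ?_, ?_⟩
  · have := iteratedDeriv_add (holo_contDiffAt hD hf hz i) (holo_contDiffAt hD hf' hz i)
    simp only [h2 hz, h2' hz]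
    exact this.symm
  · refine (h3.add h3').congr (Eventually.of_forall fun ν z hz => ?_)
    exact (iteratedDeriv_add (holo_contDiffAt (h.1 ν).1 (h.1 ν).2.2 ((h.1 ν).2.1 hz) i)
      (holo_contDiffAt (h'.1 ν).1 (h'.1 ν).2.2 ((h'.1 ν).2.1 hz) i)).symm

theorem Apx.const {r : ℕ} {D : Set ℂ} {f : ℂ → E} {U : Set ℂ} (hU : IsOpen U)
    (hDU : closure D ⊆ U) (hf : DifferentiableOn ℂ f U) : Apx r D f (fun _ => U) (fun _ => f) := by
  refine ⟨fun ν => ⟨hU, hDU, hf⟩, fun i hi => ⟨iteratedDeriv i f, ?_, fun _ _ => rfl, ?_⟩⟩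
  · exact ((holo_iteratedDeriv hU hf i).mono hDU).continuousOn
  · intro u hu
    exact Eventually.of_forall fun n x _ => refl_mem_uniformity hu

theorem Apx.sum {r : ℕ} {D : Set ℂ} (hD : IsOpen D) (s : Finset ℂ) (f : ℂ → ℂ → E)
    (hf : ∀ j ∈ s, DifferentiableOn ℂ (f j) D) (h : ∀ j ∈ s, ∃ U g, Apx r D (f j) U g) :
    ∃ U g, Apx r D (fun z => ∑ j ∈ s, f j z) U g := by
  classical
  induction s using Finset.induction_on with
  | empty => exact ⟨_, _, by simpa using Apx.const (E := E) (f := fun _ => 0) isOpen_univ (subset_univ _) (differentiableOn_const _)⟩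
  | insert a s ha ih =>
    obtain ⟨U, g, h1⟩ := ih (fun j hj => hf j (by simp [hj])) (fun j hj => h j (by simp [hj]))
    obtain ⟨U', g', h2⟩ := h a (by simp)
    refine ⟨_, _, ((Apx.add hD (hf a (by simp)) ?_ h2 h1).congr hD ?_)⟩
    · exact DifferentiableOn.fun_sum fun j hj => hf j (by simp [hj])
    · intro z hz
      simp [Finset.sum_insert ha]

/-- a continuous function, holomorphic on `Ω`, with continuously extending derivatives,
whose shifts of D stay in `Ω`, is approximable. -/
theorem Apx.shift {r : ℕ} {D Ω : Set ℂ} (hD : IsOpen D) (hDb : Bornology.IsBounded D) (hΩ : IsOpen Ω) (hDΩ : D ⊆ Ω)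
    {H : ℕ → ℂ → E} (hc : ∀ i ≤ r, Continuous (H i)) (hJ : Jt r Ω H) (hh : DifferentiableOn ℂ (H 0) Ω)
    {n : ℂ} {τ : ℝ} (hτ : 0 < τ) (hs : ∀ t : ℝ, 0 < t → t < τ → ∀ z ∈ closure D, z - t * n ∈ Ω) :
    ∃ U g, Apx r D (H 0) U g := by
  let t : ℕ → ℝ := fun ν => τ / (ν + 2)
  have ht0 : ∀ ν, 0 < t ν := fun ν => by simp only [t]; positivity
  have ht1 : ∀ ν, t ν < τ := fun ν => by
    simp only [t]
    apply div_lt_self hτ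
    have : (0:ℝ) ≤ ν := by positivity
    linarith
  have htl : Tendsto t atTop (𝓝 0) := by
    simp only [t]
    have : Tendsto (fun ν : ℕ => (ν:ℝ) + 2) atTop atTop :=
      tendsto_atTop_add_const_right _ _ tendsto_natCast_atTop_atTop
    exact this.const_div_atTop τ
  have hcont : ∀ ν, Continuous (fun z : ℂ => z - t ν * n) := fun ν => by fun_prop
  have key : ∀ i ≤ r, EqOn (iteratedDeriv i (H 0)) (H i) Ω := by
    intro i hi
    exact Jt.unique hΩ (Jt.of_holo (r := r) hΩ hh) hJ (by intro z _; simp) i hi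
  refine ⟨fun ν => (fun z : ℂ => z - t ν * n) ⁻¹' Ω, fun ν z => H 0 (z - t ν * n), ⟨fun ν => ⟨hΩ.preimage (hcont ν), ?_, ?_⟩, ?_⟩⟩
  · intro z hz
    exact hs _ (ht0 ν) (ht1 ν) z hz
  · refine hh.comp (by fun_prop) (fun z hz => hz)
  · intro i hi
    refine ⟨H i, (hc i hi).continuousOn, fun z hz => (key i hi (hDΩ hz)).symm, ?_⟩
    have hK : IsCompact (closure D) := hDb.isCompact_closure
    have e : ∀ ν, EqOn (fun z => H i (z - t ν * n)) (iteratedDeriv i (fun z => H 0 (z - t ν * n))) (closure D) := by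
      intro ν z hz
      have := congrFun (iteratedDeriv_comp_sub_const i (H 0) (t ν * n)) z
      rw [this]
      exact (key i hi (hs _ (ht0 ν) (ht1 ν) z hz)).symm
    refine TendstoUniformlyOn.congr ?_ (Eventually.of_forall fun ν => e ν)
    rw [← tendstoLocallyUniformlyOn_iff_tendstoUniformlyOn_of_compact hK]
    have hc2 : Continuous (fun p : ℂ × ℝ => H i (p.1 - p.2 * n)) := by
      have := hc i hi
      fun_prop
    rw [Metric.tendstoLocallyUniformlyOn_iff]
    intro ε hε z hz
    have := (hc2.tendsto (z, 0)).eventually (Metric.ball_mem_nhds _ (half_pos hε))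
    rw [nhds_prod_eq, eventually_prod_iff] at this
    obtain ⟨p, hp, q, hq, hpq⟩ := this
    refine ⟨_, mem_nhdsWithin_of_mem_nhds hp, ?_⟩
    filter_upwards [htl.eventually hq] with ν hν y hy
    have h1 := hpq hy hν
    have h2 := hpq hy hq.self_of_nhds
    simp only [Metric.mem_ball, ofReal_zero, zero_mul, sub_zero] at h1 h2
    calc dist (H i y) (H i (y - t ν * n)) ≤ dist (H i y) (H i z) + dist (H i (y - t ν * n)) (H i z) := dist_triangle_right _ _ _
      _ < ε := by linarith

end apx

section main
variable {E : Type} [NormedAddCommGroup E] [NormedSpace ℂ E] [CompleteSpace E]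

theorem classA_bdd {r : ℕ} {D : Set ℂ} (hD : IsOpen D) (hDb : Bornology.IsBounded D) {f : ℂ → E}
    (hf : ClassA r D f) : ∀ i ≤ r, ∃ C, ∀ z ∈ D, ‖iteratedFDeriv ℝ i f z‖ ≤ C := by
  intro i hi
  obtain ⟨F, h1, h2⟩ := hf.2.2 i hi
  obtain ⟨C, hC⟩ := hDb.isCompact_closure.exists_bound_of_continuousOn h1
  refine ⟨C, fun z hz => ?_⟩
  have e := (holo_contDiffAt hD hf.2.1 hz i).restrictScalars_iteratedFDeriv (𝕜 := ℝ)
  rw [← e]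
  simp only [Function.comp, ContinuousMultilinearMap.norm_restrictScalars]
  rw [norm_iteratedFDeriv_eq_norm_iteratedDeriv, ← h2 hz]
  exact hC z (subset_closure hz)

theorem tietze [FiniteDimensional ℂ E] {K : Set ℂ} (hK : IsClosed K) {g : ℂ → E} (hg : ContinuousOn g K) :
    ∃ G : ℂ → E, Continuous G ∧ EqOn G g K := by
  haveI : TietzeExtension E := TietzeExtension.of_tvs ℂ
  obtain ⟨G, hG⟩ := ContinuousMap.exists_restrict_eq (Y := E) hK ⟨K.restrict g, hg.restrict⟩
  refine ⟨G, G.continuous, fun z hz => ?_⟩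
  exact congrArg (fun h => h ⟨z, hz⟩) hG

theorem exists_apx [FiniteDimensional ℂ E] {r : ℕ} {D : Set ℂ} (hr : 1 ≤ r) (hD : IsOpen D) (hDb : Bornology.IsBounded D)
    (hs : SmoothlyBounded D) {f : ℂ → E} (hf : ClassA r D f) : ∃ U g, Apx r D f U g := by
  obtain ⟨v, V, hB⟩ := exists_bd hs
  obtain ⟨s, χ, b, n, τ, hs, W, hW, hfW, hsum⟩ := hB.exists_flat hDb (r + 2)
  -- continuous extensions
  have hF : ∃ F : ℕ → ℂ → E, (∀ i ≤ r, Continuous (F i)) ∧ ∀ i ≤ r, EqOn (F i) (iteratedDeriv i f) D := by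
    choose! g hg hg' using hf.2.2
    have : ∀ i, ∃ G : ℂ → E, i ≤ r → (Continuous G ∧ EqOn G (g i) (closure D)) := by
      intro i
      by_cases hi : i ≤ r
      · obtain ⟨G, h⟩ := tietze isClosed_closure (hg i hi)
        exact ⟨G, fun _ => h⟩
      · exact ⟨0, fun h => absurd h hi⟩
    choose G hG using this
    exact ⟨G, fun i hi => (hG i hi).1, fun i hi z hz => ((hG i hi).2 (subset_closure hz)).trans (hg' i hi hz)⟩
  obtain ⟨F, hFc, hFe⟩ := hF
  have hF0 : EqOn (F 0) f D := by simpa using hFe 0 (by omega)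
  have hF0d : DifferentiableOn ℂ (F 0) D := hf.2.1.congr hF0
  have hFJ : Jt r D F := by
    intro i hi z hz
    have h1 := Jt.of_holo (r := r) hD hf.2.1 i hi z hz
    simp only at h1
    rw [← hFe (i+1) (by omega) hz] at h1
    exact HasLineDerivAt.congr_nhds h1 (by filter_upwards [hD.mem_nhds hz] with w hw using (hFe i (by omega) hw).symm)
  -- right hand sides
  let β : ℂ → ℂ → E := fun j => D.indicator (fun z => ((v z : ℂ) ^ (r+2) * b j z) • f z)
  have hf0 : OCl v D r 0 f := OCl.of_bdd hDb hB.smooth.continuous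
    (fun z hz => ((holo_contDiffAt hD hf.2.1 hz r).restrict_scalars ℝ).contDiffWithinAt) (classA_bdd hD hDb hf)
  have hβ : ∀ j ∈ s, ContDiff ℝ r (β j) := by
    intro j hj
    have h1 := ((OCl.self_pow hD hDb hB.smooth r (r+2)).smul hD
      (OCl.of_smooth hDb hB.smooth.continuous r (hs j hj).2.2.1)).smul hD hf0
    refine OCl.extend hB hD (N := r + 2 + 0 + 0) (by omega) hDb ?_ (fun z hz => indicator_of_notMem hz _)
    have ee : EqOn (β j) (fun z => ((v z : ℂ) ^ (r+2) • b j z) • f z) D := fun z hz => by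
      simp [β, indicator_of_mem hz]
    refine ⟨h1.1.congr ee, fun i hi => ?_⟩
    obtain ⟨C, hC⟩ := h1.2 i hi
    refine ⟨C, fun z hz => ?_⟩
    have : β j =ᶠ[𝓝 z] (fun z => ((v z : ℂ) ^ (r+2) • b j z) • f z) := by
      filter_upwards [hD.mem_nhds hz] with w hw using ee hw
    rw [this.iteratedFDeriv ℝ i |>.self_of_nhds]
    exact hC z hz
  have hβc : ∀ j ∈ s, HasCompactSupport (β j) := by
    intro j hj
    apply HasCompactSupport.intro hDb.isCompact_closure
    intro z hz
    exact indicator_of_notMem (fun h => hz (subset_closure h)) _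
  have hr1 : (1 : WithTop ℕ∞) ≤ (r : ℕ) := by exact_mod_cast hr
  have hr0 : (r : WithTop ℕ∞) ≠ 0 := by
    have : r ≠ 0 := by omega
    exact_mod_cast this
  let u : ℂ → ℂ → E := fun j => cauchyT (β j)
  have hu : ∀ j ∈ s, ContDiff ℝ r (u j) := fun j hj => contDiff_cauchyT (hβ j hj) (hβc j hj)
  have hud : ∀ j ∈ s, ∀ z, dbar (u j) z = β j z := fun j hj z => dbar_cauchyT ((hβ j hj).of_le hr1) (hβc j hj) z
  have huD : ∀ j ∈ s, ∀ z, DifferentiableAt ℝ (u j) z := fun j hj z => (hu j hj).differentiable hr0 z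
  have hχD : ∀ j ∈ s, ∀ z, DifferentiableAt ℝ (χ j) z := fun j hj z => (hs j hj).1.differentiable (by simp) z
  have hFD : ∀ z ∈ D, DifferentiableAt ℝ (F 0) z := fun z hz => (hF0d.differentiableAt (hD.mem_nhds hz)).restrictScalars ℝ
  have hFb : ∀ z ∈ D, dbar (F 0) z = 0 := fun z hz => dbar_of_holo (hF0d.differentiableAt (hD.mem_nhds hz))
  let h : ℂ → ℂ → E := fun j z => χ j z • F 0 z - u j z
  have hΩo : ∀ j, IsOpen (D ∪ (tsupport (χ j))ᶜ) := fun j => hD.union (isClosed_tsupport _).isOpen_compl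
  have hz0 : ∀ j, ∀ z ∈ (tsupport (χ j))ᶜ, χ j =ᶠ[𝓝 z] 0 := fun j z hz => notMem_tsupport_iff_eventuallyEq.1 hz
  have hh : ∀ j ∈ s, DifferentiableOn ℂ (h j) (D ∪ (tsupport (χ j))ᶜ) := by
    intro j hj z hz
    apply DifferentiableAt.differentiableWithinAt
    by_cases hzD : z ∈ D
    · apply holo_of_dbar (((hχD j hj z).fun_smul (hFD z hzD)).fun_sub (huD j hj z))
      rw [dbar_sub ((hχD j hj z).fun_smul (hFD z hzD)) (huD j hj z)]
      rw [dbar_smul (hχD j hj z) (hFD z hzD), hFb z hzD, (hs j hj).2.2.2.2.1, hud j hj]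
      simp [β, indicator_of_mem hzD, hF0 hzD]
    · have hz' := hz.resolve_left hzD
      have e : h j =ᶠ[𝓝 z] fun z => - u j z := by
        filter_upwards [hz0 j z hz'] with w hw
        simp [h, hw]
      rw [e.differentiableAt_iff]
      apply DifferentiableAt.fun_neg
      apply holo_of_dbar (huD j hj z)
      rw [hud j hj]
      exact indicator_of_notMem hzD _
  have hApx : ∀ j ∈ s, ∃ U g, Apx r D (h j) U g := by
    intro j hj
    obtain ⟨KX, hX0, hXc, hXJ⟩ := Jt.of_contDiff (r := r) ((hs j hj).1.of_le (by exact_mod_cast le_top))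
    obtain ⟨KU, hU0, hUc, hUJ⟩ := Jt.of_contDiff (hu j hj)
    let H : ℕ → ℂ → E := fun n z => (∑ a ∈ Finset.HasAntidiagonal.antidiagonal n, (n.choose a.1) • (KX a.1 z • F a.2 z)) - KU n z
    have hH0 : H 0 = h j := by
      funext z
      simp [H, hX0, hU0, h]
    have hJ1 : Jt r D H := ((hXJ.mono (subset_univ _)).smul hFJ).sub (hUJ.mono (subset_univ _))
    have hJ2 : Jt r (tsupport (χ j))ᶜ H := by
      have hop : IsOpen (tsupport (χ j))ᶜ := (isClosed_tsupport _).isOpen_compl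
      have hX : ∀ i ≤ r, EqOn (KX i) (fun _ => 0) (tsupport (χ j))ᶜ :=
        Jt.unique hop (hXJ.mono (subset_univ _)) (Jt.zero) (by
          intro z hz
          rw [hX0]
          exact (hz0 j z hz).self_of_nhds)
      have hHe : ∀ i ≤ r, EqOn (fun z => 0 - KU i z) (H i) (tsupport (χ j))ᶜ := by
        intro i hi z hz
        simp only [H]
        congr 1
        symm
        apply Finset.sum_eq_zero
        intro a ha
        have := Finset.HasAntidiagonal.mem_antidiagonal.1 ha
        rw [hX a.1 (by omega) hz]
        simp
      intro i hi z hz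
      have h1 := (Jt.zero.sub (hUJ.mono (subset_univ _))) i hi z hz
      rw [← hHe (i+1) (by omega) hz]
      exact HasLineDerivAt.congr_nhds h1 (by filter_upwards [hop.mem_nhds hz] with w hw using hHe i (by omega) hw)
    have hJ : Jt r (D ∪ (tsupport (χ j))ᶜ) H := by
      rintro i hi z (hz | hz)
      · exact hJ1 i hi z hz
      · exact hJ2 i hi z hz
    have hHc : ∀ i ≤ r, Continuous (H i) := by
      intro i hi
      refine Continuous.sub (continuous_finset_sum _ fun a ha => ?_) (hUc i hi)
      have := Finset.HasAntidiagonal.mem_antidiagonal.1 ha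
      exact Continuous.fun_const_smul ((hXc a.1 (by omega)).fun_smul (hFc a.2 (by omega))) _
    have := Apx.shift (r := r) hD hDb (hΩo j) subset_union_left hHc hJ (by rw [hH0]; exact hh j hj)
      (hs j hj).2.2.2.2.2.1 (hs j hj).2.2.2.2.2.2
    rwa [hH0] at this
  obtain ⟨U1, g1, hA1⟩ := Apx.sum hD s h (fun j hj => (hh j hj).mono subset_union_left) hApx
  let g0 : ℂ → E := fun z => (1 - ∑ j ∈ s, χ j z) • F 0 z + ∑ j ∈ s, u j z
  have hsd : ∀ z, DifferentiableAt ℝ (fun z => ∑ j ∈ s, χ j z) z := fun z => DifferentiableAt.fun_sum fun j hj => hχD j hj z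
  have hsu : ∀ z, DifferentiableAt ℝ (fun z => ∑ j ∈ s, u j z) z := fun z => DifferentiableAt.fun_sum fun j hj => huD j hj z
  have hg0 : DifferentiableOn ℂ g0 (D ∪ W) := by
    intro z hz
    apply DifferentiableAt.differentiableWithinAt
    by_cases hzD : z ∈ D
    · have d1 : DifferentiableAt ℝ (fun z => 1 - ∑ j ∈ s, χ j z) z := (differentiableAt_const _).fun_sub (hsd z)
      apply holo_of_dbar ((d1.fun_smul (hFD z hzD)).fun_add (hsu z))
      rw [dbar_add (d1.fun_smul (hFD z hzD)) (hsu z), dbar_smul d1 (hFD z hzD), hFb z hzD,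
        dbar_sub (differentiableAt_const _) (hsd z), dbar_const, dbar_sum s (fun j hj => hχD j hj z),
        dbar_sum s (fun j hj => huD j hj z)]
      have : ∀ j ∈ s, dbar (u j) z = dbar (χ j) z • F 0 z := by
        intro j hj
        rw [hud j hj, (hs j hj).2.2.2.2.1]
        simp [β, indicator_of_mem hzD, hF0 hzD]
      rw [Finset.sum_congr rfl this, ← Finset.sum_smul]
      simp
    · have hz' := hz.resolve_left hzD
      have e : g0 =ᶠ[𝓝 z] fun z => ∑ j ∈ s, u j z := by
        filter_upwards [hW.mem_nhds hz'] with w hw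
        simp [g0, hsum w hw]
      rw [e.differentiableAt_iff]
      apply holo_of_dbar (hsu z)
      rw [dbar_sum s (fun j hj => huD j hj z)]
      apply Finset.sum_eq_zero
      intro j hj
      rw [hud j hj]
      exact indicator_of_notMem hzD _
  have hcl : closure D ⊆ D ∪ W := by
    rw [closure_eq_self_union_frontier]
    exact union_subset_union_right _ hfW
  have hA0 := Apx.const (r := r) (hD.union hW) hcl hg0
  refine ⟨_, _, (hA0.add hD (hg0.mono subset_union_left)
    (DifferentiableOn.fun_sum fun j hj => (hh j hj).mono subset_union_left) hA1).congr hD ?_⟩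
  intro z hz
  simp only [g0, h, Finset.sum_sub_distrib, ← Finset.sum_smul, sub_smul, one_smul]
  rw [← hF0 hz]
  abel

end main
end Approx



namespace Approx
open MeasureTheory Topology
open scoped ContDiff Convolution Manifold

section interp
variable {E : Type} [NormedAddCommGroup E] [NormedSpace ℂ E] [CompleteSpace E]

theorem iteratedDeriv_smul_vec {p : ℂ → ℂ} (hp : Differentiable ℂ p) (c : E) (i : ℕ) :
    iteratedDeriv i (fun z => p z • c) = fun z => iteratedDeriv i p z • c := by
  induction i with
  | zero => simp
  | succ i ih =>
    have hdi : Differentiable ℂ (iteratedDeriv i p) := differentiableOn_univ.1 (holo_iteratedDeriv isOpen_univ hp.differentiableOn i)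
    rw [iteratedDeriv_succ, iteratedDeriv_succ, ih]
    funext z
    exact deriv_smul_const (hdi z) _

theorem Apx.smul_const {r : ℕ} {D : Set ℂ} (hDb : Bornology.IsBounded D) {p : ℂ → ℂ} (hp : Differentiable ℂ p)
    {c : ℕ → E} (hc : Tendsto c atTop (𝓝 0)) : Apx r D (fun _ => (0:E)) (fun _ => univ) (fun ν z => p z • c ν) := by
  refine ⟨fun ν => ⟨isOpen_univ, subset_univ _, (hp.smul_const _).differentiableOn⟩, fun i hi => ⟨fun _ => 0, continuousOn_const, fun z _ => by simp, ?_⟩⟩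
  have hd : Continuous (iteratedDeriv i p) :=
    (differentiableOn_univ.1 (holo_iteratedDeriv isOpen_univ hp.differentiableOn i)).continuous
  obtain ⟨C, hC⟩ := hDb.isCompact_closure.exists_bound_of_continuousOn hd.continuousOn
  have e : ∀ ν, iteratedDeriv i (fun z => p z • c ν) = fun z => iteratedDeriv i p z • c ν :=
    fun ν => iteratedDeriv_smul_vec hp (c ν) i
  simp_rw [e]
  rw [Metric.tendstoUniformlyOn_iff]
  intro ε hε
  have h1 : Tendsto (fun ν => C * ‖c ν‖) atTop (𝓝 0) := by simpa using (hc.norm).const_mul C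
  filter_upwards [h1.eventually (gt_mem_nhds hε)] with ν hν z hz
  rw [dist_zero_left, norm_smul]
  exact lt_of_le_of_lt (mul_le_mul_of_nonneg_right (hC z hz) (norm_nonneg _)) hν

def Itp (r : ℕ) (D : Set ℂ) (f : ℂ → E) (P : Polynomial ℂ) : Prop :=
  ∃ U g, ∃ h : ℕ → ℂ → E, Apx r D f U g ∧ (∀ ν, DifferentiableOn ℂ (h ν) D) ∧
    (∀ ν, ∀ z ∈ D, g ν z - f z = P.eval z • h ν z) ∧ TendstoLocallyUniformlyOn h (fun _ => 0) atTop D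

theorem Itp.one {r : ℕ} {D : Set ℂ} {f : ℂ → E} (hf : DifferentiableOn ℂ f D)
    (h : ∃ U g, Apx r D f U g) : Itp r D f 1 := by
  obtain ⟨U, g, h⟩ := h
  refine ⟨U, g, fun ν z => g ν z - f z, h, fun ν => ((h.1 ν).2.2.mono (subset_closure.trans (h.1 ν).2.1)).sub hf, by simp, ?_⟩
  apply TendstoUniformlyOn.tendstoLocallyUniformlyOn
  obtain ⟨F, h1, h2, h3⟩ := h.2 0 (by omega)
  rw [Metric.tendstoUniformlyOn_iff] at h3 ⊢
  intro ε hε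
  filter_upwards [h3 ε hε] with ν hν z hz
  have := hν z (subset_closure hz)
  rw [h2 hz] at this
  simpa [dist_eq_norm, norm_sub_rev] using this

theorem dslope_tendsto {D : Set ℂ} (hD : IsOpen D) {h : ℕ → ℂ → E} (hh : ∀ ν, DifferentiableOn ℂ (h ν) D)
    (ht : TendstoLocallyUniformlyOn h (fun _ => 0) atTop D) {b : ℂ} (hb : b ∈ D) :
    TendstoLocallyUniformlyOn (fun ν => dslope (h ν) b) (fun _ => 0) atTop D := by
  have ht' := ht
  rw [Metric.tendstoLocallyUniformlyOn_iff] at ht ⊢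
  intro ε hε z hz
  by_cases hzb : z = b
  · subst hzb
    obtain ⟨R, hR, hbR⟩ := Metric.nhds_basis_closedBall.mem_iff.1 (hD.mem_nhds hz)
    have hu : TendstoUniformlyOn h (fun _ => 0) atTop (closedBall z R) :=
      (tendstoLocallyUniformlyOn_iff_tendstoUniformlyOn_of_compact (isCompact_closedBall z R)).1 (ht'.mono hbR)
    rw [Metric.tendstoUniformlyOn_iff] at hu
    refine ⟨ball z R, mem_nhdsWithin_of_mem_nhds (ball_mem_nhds _ hR), ?_⟩
    filter_upwards [hu (ε * R / 4) (by positivity)] with ν hν y hy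
    have hm : MapsTo (h ν) (ball z R) (ball (h ν z) (ε * R / 2)) := by
      intro w hw
      have h1 := hν w (ball_subset_closedBall hw)
      have h2 := hν z (mem_closedBall_self hR.le)
      rw [mem_ball]
      calc dist (h ν w) (h ν z) ≤ dist 0 (h ν w) + dist 0 (h ν z) := dist_triangle_left _ _ _
        _ < _ := by linarith
    have := Complex.norm_dslope_le_div_of_mapsTo_ball ((hh ν).mono (ball_subset_closedBall.trans hbR)) (hm.mono_right ball_subset_closedBall) hy
    rw [dist_zero_left]
    refine this.trans_lt ?_
    rw [div_lt_iff₀ hR]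
    nlinarith [mul_pos hε hR]
  · have hd : 0 < dist z b := dist_pos.2 hzb
    obtain ⟨t, htn, hte⟩ := ht (ε * (dist z b / 2) / 2) (by positivity) z hz
    refine ⟨t ∩ ball z (dist z b / 2), inter_mem htn (mem_nhdsWithin_of_mem_nhds (ball_mem_nhds _ (by positivity))), ?_⟩
    obtain ⟨t2, htn2, hte2⟩ := ht (ε * (dist z b / 2) / 2) (by positivity) b hb
    filter_upwards [hte, hte2] with ν hν hν2 y hy
    have h1 := hν y hy.1
    have h2 := hν2 b (mem_of_mem_nhdsWithin hb htn2)
    have h3 : dist z b / 2 < dist y b := by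
      have := hy.2
      rw [mem_ball] at this
      have := dist_triangle_left z b y
      linarith
    have hyb : y ≠ b := dist_pos.1 (by linarith)
    rw [dist_zero_left] at *
    rw [dslope_of_ne _ hyb, slope_def_module, norm_smul, norm_inv, ← dist_eq_norm, inv_mul_lt_iff₀ (by linarith)]
    have := norm_sub_le (h ν y) (h ν b)
    nlinarith

theorem Itp.mul {r : ℕ} {D : Set ℂ} (hD : IsOpen D) (hDb : Bornology.IsBounded D) {f : ℂ → E} (hf : DifferentiableOn ℂ f D) {P : Polynomial ℂ}
    (h : Itp r D f P) {b : ℂ} (hb : b ∈ D) : Itp r D f (P * (Polynomial.X - Polynomial.C b)) := by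
  obtain ⟨U, g, h, hA, hh, he, ht⟩ := h
  have hc : Tendsto (fun ν => - h ν b) atTop (𝓝 0) := by
    have := (ht.tendsto_at hb).neg
    simpa using this
  have hA2 := (hA.add hD hf (differentiableOn_const 0) (Apx.smul_const hDb P.differentiable hc)).congr (f' := f) hD (by intro z _; simp)
  refine ⟨_, _, fun ν => dslope (h ν) b, hA2, fun ν => ?_, fun ν z hz => ?_, dslope_tendsto hD hh ht hb⟩
  · exact (Complex.differentiableOn_dslope (hD.mem_nhds hb)).2 (hh ν)
  · have e1 := sub_smul_dslope (h ν) b z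
    simp only [Polynomial.eval_mul, Polynomial.eval_sub, Polynomial.eval_X, Polynomial.eval_C, mul_smul]
    rw [e1, smul_sub, ← he ν z hz]
    simp
    abel

theorem exists_interp [FiniteDimensional ℂ E] {r : ℕ} {D : Set ℂ} (hr : 1 ≤ r) (hD : IsOpen D) (hDb : Bornology.IsBounded D)
    (hs : SmoothlyBounded D) {f : ℂ → E} (hf : ClassA r D f) (B : Finset ℂ) (hB : ∀ b ∈ B, b ∈ D) (N : ℕ) :
    ∃ U g, Apx r D f U g ∧ ∀ b ∈ B, ∃ h : ℕ → ℂ → E, (∀ ν, DifferentiableOn ℂ (h ν) D) ∧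
      (∀ ν, ∀ z ∈ D, g ν z - f z = (z - b) ^ N • h ν z) ∧ TendstoLocallyUniformlyOn h (fun _ => 0) atTop D := by
  classical
  have h0 : Itp r D f 1 := Itp.one hf.2.1 (exists_apx hr hD hDb hs hf)
  have h1 : ∀ s : Finset ℂ, (∀ b ∈ s, b ∈ D) → Itp r D f (∏ b ∈ s, (Polynomial.X - Polynomial.C b) ^ N) := by
    intro s
    induction s using Finset.induction_on with
    | empty => intro _; simpa using h0
    | insert a s ha ih =>
      intro hs
      rw [Finset.prod_insert ha, mul_comm]
      have h2 := ih (fun b hb => hs b (by simp [hb]))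
      generalize (∏ b ∈ s, (Polynomial.X - Polynomial.C b) ^ N) = Q at h2
      clear ih
      induction N with
      | zero => simpa using h2
      | succ n ih => rw [pow_succ, ← mul_assoc]; exact ih.mul hD hDb hf.2.1 (hs a (by simp))
  obtain ⟨U, g, h, hA, hh, he, ht⟩ := h1 B hB
  refine ⟨U, g, hA, fun b hb => ?_⟩
  refine ⟨fun ν z => (∏ a ∈ B.erase b, (Polynomial.X - Polynomial.C a) ^ N).eval z • h ν z, fun ν => (Polynomial.differentiable _).differentiableOn.smul (hh ν), fun ν z hz => ?_, ?_⟩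
  · rw [he ν z hz, ← Finset.mul_prod_erase B _ hb]
    simp [mul_smul]
  · generalize (∏ a ∈ B.erase b, (Polynomial.X - Polynomial.C a) ^ N) = Q
    rw [Metric.tendstoLocallyUniformlyOn_iff] at ht ⊢
    intro ε hε z hz
    obtain ⟨t, htn, hte⟩ := ht (ε / (‖Q.eval z‖ + 1)) (by positivity) z hz
    have hq : ∀ᶠ y in 𝓝 z, ‖Q.eval y‖ < ‖Q.eval z‖ + 1 :=
      (Q.continuous.norm.tendsto z).eventually (gt_mem_nhds (by linarith))
    refine ⟨t ∩ {y | ‖Q.eval y‖ < ‖Q.eval z‖ + 1}, inter_mem htn (mem_nhdsWithin_of_mem_nhds hq), ?_⟩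
    filter_upwards [hte] with ν hν y hy
    have h1 := hν y hy.1
    have h2 : ‖Q.eval y‖ < ‖Q.eval z‖ + 1 := hy.2
    rw [dist_zero_left] at *
    rw [norm_smul]
    rw [lt_div_iff₀ (by positivity)] at h1
    nlinarith [norm_nonneg (h ν y)]

end interp
end Approx



namespace Approx
open MeasureTheory Topology
open scoped ContDiff Convolution Manifold

section osgood
variable {H : Type} [NormedAddCommGroup H] [NormedSpace ℂ H]
variable {G : Type} [NormedAddCommGroup G] [NormedSpace ℂ G]

theorem cauchy_fderiv {f : H → G} {x : H} {R C : ℝ} (hR : 0 < R) (hf : DifferentiableOn ℂ f (ball x R))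
    (hC : ∀ y ∈ ball x R, ‖f y‖ ≤ C) : ‖fderiv ℂ f x‖ ≤ 2 * C / R := by
  have hC0 : 0 ≤ C := (norm_nonneg _).trans (hC x (mem_ball_self hR))
  refine ContinuousLinearMap.opNorm_le_bound _ (by positivity) fun v => ?_
  by_cases hv : v = 0
  · simp [hv]
  have hv' : 0 < ‖v‖ := norm_pos_iff.2 hv
  set r := R / (2 * ‖v‖) with hr
  have hr0 : 0 < r := by positivity
  have hline : ∀ ζ ∈ closedBall (0:ℂ) r, x + ζ • v ∈ ball x R := by
    intro ζ hζ
    rw [mem_closedBall_zero_iff] at hζ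
    rw [mem_ball, dist_self_add_left, norm_smul]
    calc ‖ζ‖ * ‖v‖ ≤ r * ‖v‖ := by gcongr
      _ = R / 2 := by rw [hr]; field_simp
      _ < R := by linarith
  have hd : DifferentiableOn ℂ (fun ζ : ℂ => f (x + ζ • v)) (closedBall 0 r) :=
    hf.comp (by fun_prop) hline
  have h1 := norm_deriv_le_of_forall_mem_sphere_norm_le hr0 (f := fun ζ : ℂ => f (x + ζ • v)) (c := 0) (C := C)
    (by
      refine DifferentiableOn.diffContOnCl ?_
      rw [closure_ball _ hr0.ne']
      exact hd)
    (fun ζ hζ => hC _ (hline ζ (sphere_subset_closedBall hζ)))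
  have h2 : HasDerivAt (fun ζ : ℂ => f (x + ζ • v)) (fderiv ℂ f x v) 0 := by
    have hfx : HasFDerivAt f (fderiv ℂ f x) (x + (0:ℂ) • v) := by
      simpa using (hf.differentiableAt (ball_mem_nhds x hR)).hasFDerivAt
    have hl : HasDerivAt (fun ζ : ℂ => x + ζ • v) v 0 := by
      simpa using ((hasDerivAt_id (0:ℂ)).smul_const v).const_add x
    exact hfx.comp_hasDerivAt (0:ℂ) hl
  rw [h2.deriv] at h1
  refine h1.trans (le_of_eq ?_)
  rw [hr]
  field_simp

theorem param_diff [FiniteDimensional ℂ H] [CompleteSpace G] {Φ : H → ℝ → G} {x0 : H} {R a b : ℝ} (hR : 0 < R)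
    (hab : a ≤ b)
    (hc : ContinuousOn (fun p : H × ℝ => Φ p.1 p.2) (closedBall x0 R ×ˢ Icc a b))
    (hd : ∀ θ ∈ Icc a b, DifferentiableOn ℂ (fun x => Φ x θ) (closedBall x0 R)) :
    DifferentiableAt ℂ (fun x => ∫ θ in a..b, Φ x θ) x0 := by
  haveI : ProperSpace H := FiniteDimensional.proper ℂ H
  have hK : IsCompact (closedBall x0 R ×ˢ Icc a b) := (isCompact_closedBall _ _).prod isCompact_Icc
  obtain ⟨C, hC⟩ := hK.exists_bound_of_continuousOn hc
  have hsub : ∀ x ∈ ball x0 (R/2), ball x (R/2) ⊆ closedBall x0 R := by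
    intro x hx y hy
    rw [mem_ball] at *
    rw [mem_closedBall]
    linarith [dist_triangle y x x0]
  have hx0 : ball x0 (R/2) ⊆ closedBall x0 R := hsub x0 (mem_ball_self (by positivity))
  have hcx : ∀ x ∈ ball x0 (R/2), ContinuousOn (Φ x) (Icc a b) := by
    intro x hx
    exact hc.comp (f := fun θ => (x, θ)) (by fun_prop) (fun θ hθ => ⟨hx0 hx, hθ⟩)
  have hF' : ContinuousOn (fun θ => fderiv ℂ (fun x => Φ x θ) x0) (Icc a b) := by
    have hu := hK.uniformContinuousOn_of_continuous hc
    rw [Metric.uniformContinuousOn_iff] at hu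
    rw [Metric.continuousOn_iff]
    intro θ hθ ε hε
    obtain ⟨δ, hδ, hh⟩ := hu (ε * R / 4) (by positivity)
    refine ⟨δ, hδ, fun θ' hθ' hd' => ?_⟩
    have hda : ∀ θ ∈ Icc a b, DifferentiableAt ℂ (fun x => Φ x θ) x0 := fun θ hθ =>
      (hd θ hθ).differentiableAt (closedBall_mem_nhds _ hR)
    rw [dist_eq_norm, ← fderiv_fun_sub (hda _ hθ') (hda _ hθ)]
    have := cauchy_fderiv hR (f := fun x => Φ x θ' - Φ x θ) (x := x0) (C := ε * R / 4)
      (((hd _ hθ').sub (hd _ hθ)).mono ball_subset_closedBall) (by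
        intro y hy
        have := hh (y, θ') ⟨ball_subset_closedBall hy, hθ'⟩ (y, θ) ⟨ball_subset_closedBall hy, hθ⟩ (by
          rw [Prod.dist_eq]; simpa using hd')
        rw [← dist_eq_norm]
        exact this.le)
    refine this.trans_lt ?_
    rw [div_lt_iff₀ hR]
    nlinarith [mul_pos hε hR]
  have hI : Set.uIoc a b ⊆ Icc a b := by rw [uIoc_of_le hab]; exact Ioc_subset_Icc_self
  have hms : MeasurableSet (Set.uIoc a b) := measurableSet_uIoc
  refine (intervalIntegral.hasFDerivAt_integral_of_dominated_of_fderiv_le (𝕜 := ℂ) (s := ball x0 (R/2)) (μ := volume) (a := a) (b := b)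
    (bound := fun _ => 2 * C / (R/2)) (F := Φ)
    (F' := fun x θ => fderiv ℂ (fun x => Φ x θ) x) (ball_mem_nhds _ (by positivity)) ?_ ?_ ?_ ?_ ?_ ?_).differentiableAt
  · filter_upwards [ball_mem_nhds x0 (half_pos hR)] with x hx
    exact ((hcx x hx).mono hI).aestronglyMeasurable hms
  · apply ContinuousOn.intervalIntegrable
    rw [uIcc_of_le hab]
    exact hcx x0 (mem_ball_self (by positivity))
  · exact (hF'.mono hI).aestronglyMeasurable hms
  · refine Eventually.of_forall fun θ hθ x hx => ?_
    exact cauchy_fderiv (half_pos hR) ((hd θ (hI hθ)).mono (hsub x hx)) (fun y hy => hC (y, θ) ⟨hsub x hx hy, hI hθ⟩)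
  · exact intervalIntegrable_const
  · refine Eventually.of_forall fun θ hθ x hx => ?_
    exact ((hd θ (hI hθ)).differentiableAt (mem_of_superset (isOpen_ball.mem_nhds hx) hx0)).hasFDerivAt

theorem diff_of_apply [FiniteDimensional ℂ H] {H' : Type} [NormedAddCommGroup H'] [NormedSpace ℂ H']
    {A : H' → H →L[ℂ] G} {x : H'} (h : ∀ v, DifferentiableAt ℂ (fun y => A y v) x) : DifferentiableAt ℂ A x := by
  let b := Module.finBasis ℂ H
  have e : A = fun y => ∑ i, (LinearMap.toContinuousLinearMap (b.coord i)).smulRight (A y (b i)) := by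
    funext y
    ext v
    have h1 : A y v = A y (∑ i, b.repr v i • b i) := by rw [b.sum_repr v]
    rw [h1, map_sum]
    simp [ContinuousLinearMap.sum_apply]
  rw [e]
  apply DifferentiableAt.fun_sum
  intro i _
  have := ((ContinuousLinearMap.smulRightL ℂ H G (LinearMap.toContinuousLinearMap (b.coord i))).differentiableAt (x := A x (b i))).comp x (h (b i))
  exact this

theorem osgood_fderiv [FiniteDimensional ℂ H] [CompleteSpace G] {f : H → G} {Ω : Set H} (hΩ : IsOpen Ω)
    (hf : DifferentiableOn ℂ f Ω) : DifferentiableOn ℂ (fderiv ℂ f) Ω := by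
  intro x hx
  apply DifferentiableAt.differentiableWithinAt
  apply diff_of_apply
  intro v
  obtain ⟨R, hR, hb⟩ := Metric.isOpen_iff.1 hΩ x hx
  set r := R / (4 * (‖v‖ + 1)) with hr
  have hr0 : 0 < r := by positivity
  have hrv : r * ‖v‖ ≤ R / 4 := by
    rw [hr, div_mul_eq_mul_div, div_le_div_iff₀ (by positivity) (by positivity)]
    nlinarith [norm_nonneg v]
  have hmem : ∀ y ∈ closedBall x (R/4), ∀ ζ ∈ closedBall (0:ℂ) r, y + ζ • v ∈ Ω := by
    intro y hy ζ hζ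
    apply hb
    rw [mem_closedBall] at hy
    rw [mem_closedBall_zero_iff] at hζ
    rw [mem_ball]
    calc dist (y + ζ • v) x ≤ dist (y + ζ • v) y + dist y x := dist_triangle _ _ _
      _ ≤ r * ‖v‖ + R / 4 := by
        rw [dist_self_add_left, norm_smul]; gcongr
      _ < R := by linarith
  have e : (fun y => fderiv ℂ f y v) =ᶠ[𝓝 x] fun y => (2 * Real.pi * I : ℂ)⁻¹ • ∫ θ in (0:ℝ)..(2 * Real.pi),
      (deriv (circleMap 0 r) θ * (circleMap 0 r θ) ^ (-2 : ℤ)) • f (y + circleMap 0 r θ • v) := by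
    filter_upwards [closedBall_mem_nhds x (show 0 < R/4 by positivity)] with y hy
    have hd : DifferentiableOn ℂ (fun ζ : ℂ => f (y + ζ • v)) (closedBall 0 r) :=
      hf.comp (by fun_prop) (hmem y hy)
    have h1 := DifferentiableOn.deriv_eq_smul_circleIntegral hr0 hd
    have h2 : HasDerivAt (fun ζ : ℂ => f (y + ζ • v)) (fderiv ℂ f y v) 0 := by
      have hyΩ : y ∈ Ω := by simpa using hmem y hy 0 (mem_closedBall_self hr0.le)
      have hfx : HasFDerivAt f (fderiv ℂ f y) (y + (0:ℂ) • v) := by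
        simpa using (hf.differentiableAt (hΩ.mem_nhds hyΩ)).hasFDerivAt
      have hl : HasDerivAt (fun ζ : ℂ => y + ζ • v) v 0 := by
        simpa using ((hasDerivAt_id (0:ℂ)).smul_const v).const_add y
      exact hfx.comp_hasDerivAt (0:ℂ) hl
    rw [h2.deriv] at h1
    rw [eq_inv_smul_iff₀ (by simp [Real.pi_ne_zero]), ← h1, circleIntegral]
    simp only [sub_zero, smul_smul, one_div, zpow_neg]
    rfl
  rw [e.differentiableAt_iff]
  apply DifferentiableAt.fun_const_smul
  have hcm : ∀ θ, circleMap 0 r θ ∈ closedBall (0:ℂ) r := fun θ => circleMap_mem_closedBall _ hr0.le _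
  apply param_diff (R := R/4) (by positivity) (by positivity)
  · apply ContinuousOn.smul
    · have : Continuous fun p : H × ℝ => deriv (circleMap 0 r) p.2 * (circleMap 0 r p.2) ^ (-2 : ℤ) := by
        simp only [deriv_circleMap]
        refine Continuous.mul (by fun_prop) (Continuous.zpow₀ (by fun_prop) _ ?_)
        intro p
        left
        exact circleMap_ne_center hr0.ne'
      exact this.continuousOn
    · refine hf.continuousOn.comp (by fun_prop) ?_
      rintro ⟨y, θ⟩ ⟨hy, _⟩
      exact hmem y hy _ (hcm θ)
  · intro θ _
    apply DifferentiableOn.fun_const_smul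
    exact hf.comp (by fun_prop) (fun y hy => hmem y hy _ (hcm θ))

theorem osgood [FiniteDimensional ℂ H] (n : ℕ) : ∀ {G : Type} [NormedAddCommGroup G] [NormedSpace ℂ G] [CompleteSpace G] {f : H → G} {Ω : Set H},
    IsOpen Ω → DifferentiableOn ℂ f Ω → ContDiffOn ℂ n f Ω := by
  induction n with
  | zero => intro G _ _ _ f Ω _ hf; exact contDiffOn_zero.2 hf.continuousOn
  | succ n ih =>
    intro G _ _ _ f Ω hΩ hf
    push_cast
    rw [contDiffOn_succ_iff_fderiv_of_isOpen hΩ]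
    exact ⟨hf, fun h => absurd h (by simp), ih hΩ (osgood_fderiv hΩ hf)⟩

end osgood
end Approx

namespace Approx
open MeasureTheory Topology
open scoped ContDiff Convolution Manifold

section charts
variable {M : ℕ}

structure Chart (X : Set (Cn M)) (e : ℕ) (U : Set (Cn M)) (O : Set (Fin e → ℂ))
    (φ : Cn M → Fin e → ℂ) (ψ : (Fin e → ℂ) → Cn M) : Prop where
  oU : IsOpen U
  oO : IsOpen O
  dφ : DifferentiableOn ℂ φ U
  dψ : DifferentiableOn ℂ ψ O
  mX : ∀ s ∈ O, ψ s ∈ X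
  mU : ∀ s ∈ O, ψ s ∈ U
  φψ : ∀ s ∈ O, φ (ψ s) = s
  mO : ∀ x ∈ X, x ∈ U → φ x ∈ O
  ψφ : ∀ x ∈ X, x ∈ U → ψ (φ x) = x

theorem exists_chart {d : ℕ} {X : Set (Cn M)} (hX : ClosedComplexSubmanifold M d X) {x : Cn M} (hx : x ∈ X) :
    ∃ U O φ ψ, Chart X (min d M) U O φ ψ ∧ x ∈ U := by
  obtain ⟨U, U', hU, hxU, hU', Φ, Ψ, hΦ, hΦm, hΨ, hΨm, h1, h2, h3⟩ := hX.2 x hx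
  let e := min d M
  let π : Cn M →L[ℂ] (Fin e → ℂ) := LinearMap.toContinuousLinearMap
    { toFun := fun w i => w (Fin.castLE (min_le_right d M) i)
      map_add' := by intro a b; rfl
      map_smul' := by intro a b; rfl }
  let ι : (Fin e → ℂ) →L[ℂ] Cn M := LinearMap.toContinuousLinearMap
    { toFun := fun s => WithLp.toLp 2 fun j => if h : (j : ℕ) < e then s ⟨j, h⟩ else 0
      map_add' := by
        intro a b; ext j; by_cases h : (j : ℕ) < e <;> simp [h]
      map_smul' := by
        intro a b; ext j; by_cases h : (j : ℕ) < e <;> simp [h] }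
  have hιa : ∀ s j, ι s j = if h : (j : ℕ) < e then s ⟨j, h⟩ else 0 := fun s j => rfl
  have hπa : ∀ w i, π w i = w (Fin.castLE (min_le_right d M) i) := fun s j => rfl
  have hπι : ∀ s, π (ι s) = s := by
    intro s; ext i
    rw [hπa, hιa, dif_pos (by exact i.2)]; rfl
  have hιπ : ∀ w : Cn M, (∀ j : Fin M, d ≤ (j:ℕ) → w j = 0) → ι (π w) = w := by
    intro w hw
    ext j
    rw [hιa]
    by_cases h : (j : ℕ) < e
    · simp [h, hπa]
    · simp only [h, dite_false]
      exact (hw j (by have := j.2; simp only [e, not_lt, min_le_iff] at h; omega)).symm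
  have hι0 : ∀ s, ∀ j : Fin M, d ≤ (j:ℕ) → ι s j = 0 := by
    intro s j hj
    rw [hιa, dif_neg]
    simp only [e, not_lt, min_le_iff]; exact Or.inl hj
  have hin : ∀ s, ι s ∈ U' → Ψ (ι s) ∈ X ∩ U := by
    intro s hs
    have : ι s ∈ Φ '' (X ∩ U) := by rw [h3]; exact ⟨hs, hι0 s⟩
    obtain ⟨y, hy, hye⟩ := this
    rw [← hye, h1 y hy.2]; exact hy
  have hout : ∀ x ∈ X, x ∈ U → Φ x ∈ U' ∧ ι (π (Φ x)) = Φ x := by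
    intro x hx hxU
    have : Φ x ∈ Φ '' (X ∩ U) := ⟨x, ⟨hx, hxU⟩, rfl⟩
    rw [h3] at this
    exact ⟨this.1, hιπ _ this.2⟩
  refine ⟨U, ι ⁻¹' U', fun x => π (Φ x), fun s => Ψ (ι s), ⟨hU, hU'.preimage ι.continuous, ?_, ?_, ?_, ?_, ?_, ?_, ?_⟩, hxU⟩
  · exact π.differentiable.comp_differentiableOn hΦ
  · exact hΨ.comp ι.differentiable.differentiableOn (fun s hs => hs)
  · exact fun s hs => (hin s hs).1
  · exact fun s hs => (hin s hs).2
  · intro s hs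
    show π (Φ (Ψ (ι s))) = s
    rw [h2 _ hs, hπι]
  · intro x hx hxU
    show ι (π (Φ x)) ∈ U'
    rw [(hout x hx hxU).2]; exact (hout x hx hxU).1
  · intro x hx hxU
    show Ψ (ι (π (Φ x))) = x
    rw [(hout x hx hxU).2, h1 x hxU]

/-- Tangent vectors of `X` at `x`. -/
def Tan (X : Set (Cn M)) (x : Cn M) : Set (Cn M) :=
  {u | ∃ γ : ℂ → Cn M, γ 0 = x ∧ (∀ᶠ t in 𝓝 0, γ t ∈ X) ∧ HasDerivAt γ u 0}

theorem Chart.tan {X : Set (Cn M)} {e U O φ ψ} (h : Chart X e U O φ ψ) {x : Cn M} (hx : x ∈ X) (hxU : x ∈ U) :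
    Tan X x = range (fderiv ℂ ψ (φ x)) := by
  have hd : HasFDerivAt ψ (fderiv ℂ ψ (φ x)) (φ x) :=
    (h.dψ.differentiableAt (h.oO.mem_nhds (h.mO x hx hxU))).hasFDerivAt
  have hd' : HasFDerivAt φ (fderiv ℂ φ x) x :=
    (h.dφ.differentiableAt (h.oU.mem_nhds hxU)).hasFDerivAt
  ext u
  constructor
  · rintro ⟨γ, h0, hγ, hγd⟩
    refine ⟨fderiv ℂ φ x u, ?_⟩
    have e1 : γ =ᶠ[𝓝 0] fun t => ψ (φ (γ t)) := by
      have : ∀ᶠ t in 𝓝 0, γ t ∈ U := hγd.continuousAt.eventually (by rw [h0]; exact h.oU.mem_nhds hxU)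
      filter_upwards [this, hγ] with t ht ht'
      rw [h.ψφ _ ht' ht]
    have e2 : HasDerivAt (fun t => ψ (φ (γ t))) (fderiv ℂ ψ (φ x) (fderiv ℂ φ x u)) 0 := by
      have a1 : HasDerivAt (fun t => φ (γ t)) (fderiv ℂ φ x u) 0 := HasFDerivAt.comp_hasDerivAt (0:ℂ) (h0 ▸ hd') hγd
      exact HasFDerivAt.comp_hasDerivAt (0:ℂ) (by simpa [h0] using hd) a1
    exact e2.unique (hγd.congr_of_eventuallyEq e1.symm)
  · rintro ⟨s, rfl⟩
    have hl : HasDerivAt (fun ζ : ℂ => φ x + ζ • s) s 0 := by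
      simpa using ((hasDerivAt_id (0:ℂ)).smul_const s).const_add (φ x)
    refine ⟨fun t => ψ (φ x + t • s), by simp [h.ψφ x hx hxU], ?_, ?_⟩
    · have : ∀ᶠ t : ℂ in 𝓝 0, φ x + t • s ∈ O :=
        hl.continuousAt.eventually (by simpa using h.oO.mem_nhds (h.mO x hx hxU))
      filter_upwards [this] with t ht using h.mX _ ht
    · exact HasFDerivAt.comp_hasDerivAt (0:ℂ) (by simpa using hd) hl

theorem Chart.inj {X : Set (Cn M)} {e U O φ ψ} (h : Chart X e U O φ ψ) {s : Fin e → ℂ} (hs : s ∈ O) :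
    Function.Injective (fderiv ℂ ψ s) := by
  have hd : HasFDerivAt ψ (fderiv ℂ ψ s) s := (h.dψ.differentiableAt (h.oO.mem_nhds hs)).hasFDerivAt
  have hd' : HasFDerivAt φ (fderiv ℂ φ (ψ s)) (ψ s) :=
    (h.dφ.differentiableAt (h.oU.mem_nhds (h.mU s hs))).hasFDerivAt
  have h1 := hd'.comp s hd
  have h2 : (φ ∘ ψ) =ᶠ[𝓝 s] id := by
    filter_upwards [h.oO.mem_nhds hs] with t ht using h.φψ t ht
  have h3 := (h1.congr_of_eventuallyEq h2.symm).unique (hasFDerivAt_id s)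
  intro a b hab
  have ha : fderiv ℂ φ (ψ s) (fderiv ℂ ψ s a) = a := congrArg (fun l => l a) h3
  have hb : fderiv ℂ φ (ψ s) (fderiv ℂ ψ s b) = b := congrArg (fun l => l b) h3
  rw [← ha, hab, hb]

end charts
end Approx

namespace Approx
open MeasureTheory Topology
open scoped ContDiff Convolution Manifold NNReal

section bdry

theorem deriv_bound {E : Type} [NormedAddCommGroup E] [NormedSpace ℂ E] {r : ℕ} (hr : 1 ≤ r) {D : Set ℂ}
    (hDb : Bornology.IsBounded D) {f : ℂ → E} (hf : ClassA r D f) : ∃ C, 0 ≤ C ∧ ∀ z ∈ D, ‖deriv f z‖ ≤ C := by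
  obtain ⟨g, hg, hge⟩ := hf.2.2 1 hr
  obtain ⟨C, hC⟩ := (hDb.isCompact_closure).exists_bound_of_continuousOn hg
  refine ⟨max C 0, le_max_right _ _, fun z hz => ?_⟩
  have := hC z (subset_closure hz)
  rw [hge hz, iteratedDeriv_one] at this
  exact this.trans (le_max_left _ _)

theorem bdry_lip {E : Type} [NormedAddCommGroup E] [NormedSpace ℂ E] {r : ℕ} (hr : 1 ≤ r) {D : Set ℂ}
    (hD : IsOpen D) (hDb : Bornology.IsBounded D) (hs : SmoothlyBounded D) {f : ℂ → E} (hf : ClassA r D f)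
    {p : ℂ} (hp : p ∈ frontier D) : ∃ ρ > 0, ∃ K : ℝ≥0, LipschitzOnWith K f (closure D ∩ ball p ρ) := by
  obtain ⟨v, V, hB⟩ := exists_bd hs
  obtain ⟨n, ρ, κ, hn, hρ, hκ, -, hcone⟩ := hB.cone hp
  obtain ⟨C, hC0, hC⟩ := deriv_bound hr hDb hf
  have hsub : ∀ z ∈ closure D, z ∈ ball p ρ → ∀ t : ℝ, 0 < t → t < ρ → z - t * n ∈ D := by
    intro z hz hzp t ht htρ
    exact hcone z hz hzp t ht htρ (mem_ball_self (by positivity))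
  have hdf : ∀ z ∈ D, DifferentiableAt ℂ f z := fun z hz => hf.2.1.differentiableAt (hD.mem_nhds hz)
  have hseg : ∀ z ∈ closure D, z ∈ ball p ρ → ∀ t : ℝ, 0 < t → t < ρ → ‖f z - f (z - t * n)‖ ≤ C * ‖n‖ * t := by
    intro z hz hzp t ht htρ
    have h1 : ∀ s ∈ Ioc 0 t, ‖f (z - s * n) - f (z - t * n)‖ ≤ C * ‖n‖ * t := by
      intro s hs
      let γ : ℝ → E := fun x => f (z - x * n)
      have hγ : ∀ x ∈ Icc s t, HasDerivAt γ ((-n) • deriv f (z - x * n)) x := by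
        intro x hx
        have a1 : HasDerivAt (fun x : ℝ => z - x * n) (-n) x := by
          have := ((ofRealCLM.hasDerivAt (x := x)).mul_const n).const_sub z
          simpa using this
        exact (hdf _ (hsub z hz hzp x (by linarith [hs.1, hx.1]) (by linarith [hx.2]))).hasDerivAt.scomp x a1
      have := Convex.norm_image_sub_le_of_norm_deriv_le (f := γ) (C := C * ‖n‖) (s := Icc s t) (x := t) (y := s)
        (fun x hx => (hγ x hx).differentiableAt) (by
          intro x hx
          rw [(hγ x hx).deriv, norm_smul, norm_neg, mul_comm]
          gcongr
          exact hC _ (hsub z hz hzp x (by linarith [hs.1, hx.1]) (by linarith [hx.2]))) (convex_Icc _ _) (right_mem_Icc.2 hs.2) (left_mem_Icc.2 hs.2)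
      refine this.trans ?_
      gcongr
      rw [Real.norm_eq_abs, abs_sub_comm, abs_of_nonneg (by linarith [hs.2])]
      linarith [hs.1]
    have hcl : ContinuousWithinAt (fun s : ℝ => f (z - s * n)) (Ioc 0 t) 0 := by
      have a1 : ContinuousWithinAt f (closure D) (z - (0:ℝ) * n) := by simpa using hf.1 z hz
      refine a1.comp (t := closure D) (f := fun s : ℝ => z - s * n) (by fun_prop) ?_
      intro s hs
      exact subset_closure (hsub z hz hzp s hs.1 (by linarith [hs.2]))
    have : (𝓝[Ioc 0 t] (0:ℝ)).NeBot := by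
      rw [← mem_closure_iff_nhdsWithin_neBot, closure_Ioc ht.ne]
      exact left_mem_Icc.2 ht.le
    refine le_of_tendsto (x := 𝓝[Ioc 0 t] (0:ℝ)) (f := fun s : ℝ => ‖f (z - s * n) - f (z - t * n)‖) ?_ ?_
    · have := (hcl.sub (continuousWithinAt_const (b := f (z - t * n)))).norm
      simpa [ContinuousWithinAt] using this
    · filter_upwards [self_mem_nhdsWithin] with s hs using h1 s hs
  set ρ1 := min ρ (κ * ρ / 8) with hρ1
  have hrpos : 0 < ρ1 := by positivity
  set K : ℝ := C * (1 + 4 / κ * ‖n‖) with hK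
  have hK0 : 0 ≤ K := by positivity
  refine ⟨ρ1, hrpos, K.toNNReal, ?_⟩
  apply LipschitzOnWith.of_dist_le_mul
  rintro z ⟨hz, hzp⟩ z' ⟨hz', hzp'⟩
  rw [Real.coe_toNNReal _ hK0]
  rcases eq_or_ne z z' with rfl | hne
  · simp
  have hδ : 0 < dist z z' := dist_pos.2 hne
  set δ := dist z z' with hδd
  have hδρ : δ < κ * ρ / 4 := by
    rw [mem_ball] at hzp hzp'
    have := dist_triangle_right z z' p
    have h3 : ρ1 ≤ κ * ρ / 8 := min_le_right _ _
    linarith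
  set t := 2 * δ / κ with ht
  have ht0 : 0 < t := by positivity
  have htρ : t < ρ := by rw [ht, div_lt_iff₀ hκ]; nlinarith
  have hκt : κ * t = 2 * δ := by rw [ht]; field_simp
  have hb1 := ball_subset_ball (x := p) (min_le_left ρ (κ * ρ / 8)) hzp
  have hb2 := ball_subset_ball (x := p) (min_le_left ρ (κ * ρ / 8)) hzp'
  have e1 := hseg z hz hb1 t ht0 htρ
  have e2 := hseg z' hz' hb2 t ht0 htρ
  have hmem : z' - t * n ∈ ball (z - t * n) (κ * t) := by
    rw [mem_ball, dist_sub_right, hκt, dist_comm, ← hδd]; linarith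
  have e3 : ‖f (z - t * n) - f (z' - t * n)‖ ≤ C * δ := by
    have := Convex.norm_image_sub_le_of_norm_deriv_le (f := f) (C := C) (s := ball (z - t * n) (κ * t)) (x := z' - t * n) (y := z - t * n)
      (fun x hx => hdf x (hcone z hz hb1 t ht0 htρ hx)) (fun x hx => hC x (hcone z hz hb1 t ht0 htρ hx)) (convex_ball _ _) hmem (mem_ball_self (by positivity))
    rw [← dist_eq_norm (z - t * n) (z' - t * n), dist_sub_right] at this
    exact this
  have hfin : K * δ = C * δ + 2 * (C * ‖n‖ * t) := by rw [hK, ht]; field_simp; ring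
  rw [hfin, dist_eq_norm]
  have : f z - f z' = (f z - f (z - t * n)) + (f (z - t * n) - f (z' - t * n)) - (f z' - f (z' - t * n)) := by abel
  rw [this]
  have n1 := norm_sub_le ((f z - f (z - t * n)) + (f (z - t * n) - f (z' - t * n))) (f z' - f (z' - t * n))
  have n2 := norm_add_le (f z - f (z - t * n)) (f (z - t * n) - f (z' - t * n))
  linarith

theorem bdry_anti {D : Set ℂ} (hD : IsOpen D) (hs : SmoothlyBounded D)
    {p : ℂ} (hp : p ∈ frontier D) : ∃ ρ > 0, ∃ n : ℂ, ∃ K : ℝ≥0, ∀ z ∈ frontier D ∩ ball p ρ, ∀ z' ∈ frontier D ∩ ball p ρ,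
      dist z z' ≤ K * dist (z / n).im (z' / n).im := by
  obtain ⟨v, V, hB⟩ := exists_bd hs
  obtain ⟨n, ρ, κ, hn, hρ, hκ, -, hcone⟩ := hB.cone hp
  have hn' : 0 < ‖n‖ := norm_pos_iff.2 hn
  set ρ1 := min ρ (ρ * ‖n‖ / 2) with hρ1
  have hrpos : 0 < ρ1 := by positivity
  have key : ∀ z ∈ frontier D ∩ ball p ρ1, ∀ z' ∈ frontier D ∩ ball p ρ1, (z' / n - z / n).re < 0 →
      |(z' / n - z / n).re| ≤ ‖n‖ / κ * |(z' / n - z / n).im| := by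
    intro z hz z' hz' hre
    by_contra hcon
    push Not at hcon
    have ht : 0 < -(z' / n - z / n).re := by linarith
    rw [abs_of_neg hre] at hcon
    have hlt : -(z' / n - z / n).re < ρ := by
      have h1 := (abs_re_le_norm (z' / n - z / n))
      rw [abs_of_neg hre] at h1
      refine h1.trans_lt ?_
      rw [← sub_div, norm_div, div_lt_iff₀ hn', ← dist_eq_norm]
      have h2 := dist_triangle_right z' z p
      have h3 := hz.2
      have h4 := hz'.2
      rw [mem_ball] at h3 h4
      have h5 : ρ1 ≤ ρ * ‖n‖ / 2 := min_le_right _ _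
      linarith
    have hmem := hcone z (frontier_subset_closure hz.1) (ball_subset_ball (min_le_left _ _) hz.2) _ ht hlt
    have : z' ∈ D := by
      apply hmem
      rw [mem_ball, dist_eq_norm]
      have e : z' - (z - (-(z' / n - z / n).re : ℝ) * n) = (((z' / n - z / n).im : ℝ) * I) * n := by
        have := re_add_im (z' / n - z / n)
        have h2 : z' - z = (z' / n - z / n) * n := by field_simp
        have : z' - z = ((((z' / n - z / n).re : ℝ) : ℂ) + ((z' / n - z / n).im : ℝ) * I) * n := by rw [this]; exact h2
        push_cast
        linear_combination this
      rw [e, norm_mul, norm_mul, norm_I, norm_real, mul_one, Real.norm_eq_abs]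
      have : κ * (‖n‖ / κ * |(z' / n - z / n).im|) < κ * (-(z' / n - z / n).re) := by gcongr
      calc _ = κ * (‖n‖ / κ * |(z' / n - z / n).im|) := by field_simp
        _ < _ := this
    exact (hD.inter_frontier_eq.subset ⟨this, hz'.1⟩ : z' ∈ (∅ : Set ℂ))
  have key2 : ∀ z ∈ frontier D ∩ ball p ρ1, ∀ z' ∈ frontier D ∩ ball p ρ1,
      |(z' / n - z / n).re| ≤ ‖n‖ / κ * |(z' / n - z / n).im| := by
    intro z hz z' hz'
    rcases lt_trichotomy (z' / n - z / n).re 0 with h | h | h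
    · exact key z hz z' hz' h
    · rw [h]; simp; positivity
    · have := key z' hz' z hz (by rw [← neg_sub, neg_re]; linarith)
      rwa [← neg_sub, neg_re, neg_im, abs_neg, abs_neg] at this
  refine ⟨ρ1, hrpos, n, (‖n‖ * (‖n‖ / κ + 1)).toNNReal, fun z hz z' hz' => ?_⟩
  rw [Real.coe_toNNReal _ (by positivity)]
  rw [dist_comm z, dist_comm _ (z' / n).im, dist_eq_norm, Real.dist_eq, ← sub_im]
  have h2 : z' - z = n * (z' / n - z / n) := by field_simp
  have h3 := norm_le_abs_re_add_abs_im (z' / n - z / n)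
  have h4 := key2 z hz z' hz'
  calc ‖z' - z‖ = ‖n‖ * ‖z' / n - z / n‖ := by rw [← norm_mul, ← h2]
    _ ≤ ‖n‖ * (‖n‖ / κ * |(z' / n - z / n).im| + |(z' / n - z / n).im|) := by gcongr; linarith
    _ = _ := by ring

theorem dimH_bdry {D : Set ℂ} (hD : IsOpen D) (hs : SmoothlyBounded D) (e : ℕ) :
    dimH (frontier D ×ˢ (univ : Set (Fin e → ℂ))) ≤ ((1 + 2 * e : ℕ) : ENNReal) := by
  by_contra hcon
  push Not at hcon
  obtain ⟨⟨p, s0⟩, hp, hlt⟩ := exists_mem_nhdsWithin_lt_dimH_of_lt_dimH hcon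
  obtain ⟨ρ, hρ, n, K, hK⟩ := bdry_anti hD hs hp.1
  let t : Set (ℂ × (Fin e → ℂ)) := (frontier D ∩ ball p ρ) ×ˢ univ
  have ht : t ∈ 𝓝[frontier D ×ˢ univ] (p, s0) := by
    have : t = (frontier D ×ˢ univ) ∩ (ball p ρ ×ˢ univ) := by ext x; simp [t]
    rw [this]
    exact inter_mem self_mem_nhdsWithin (mem_nhdsWithin_of_mem_nhds (prod_mem_nhds (ball_mem_nhds _ hρ) univ_mem))
  refine absurd (hlt t ht) (not_lt.2 ?_)
  let Θ : ℂ × (Fin e → ℂ) → ℝ × (Fin e → ℂ) := fun x => ((x.1 / n).im, x.2)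
  have hΘ : ∀ x ∈ t, ∀ y ∈ t, dist x y ≤ (max K 1 : ℝ≥0) * dist (Θ x) (Θ y) := by
    rintro ⟨z, s⟩ ⟨hz, -⟩ ⟨z', s'⟩ ⟨hz', -⟩
    have h1 := hK z hz z' hz'
    rw [Prod.dist_eq]
    have hm : dist (Θ (z,s)) (Θ (z',s')) = max (dist (z / n).im (z' / n).im) (dist s s') := Prod.dist_eq
    rw [hm]
    refine max_le ?_ ?_
    · refine h1.trans ?_
      have : (K:ℝ) ≤ (max K 1 : ℝ≥0) := by exact_mod_cast le_max_left _ _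
      gcongr
      exact le_max_left _ _
    · have : (1:ℝ) ≤ (max K 1 : ℝ≥0) := by exact_mod_cast le_max_right _ _
      calc dist s s' = 1 * dist s s' := by ring
        _ ≤ _ := by gcongr; exact le_max_right _ _
  have hinj : InjOn Θ t := by
    intro x hx y hy hxy
    have := hΘ x hx y hy
    rw [hxy, dist_self, mul_zero] at this
    exact dist_le_zero.1 this
  have hL : LipschitzOnWith (max K 1) (Function.invFunOn Θ t) (Θ '' t) := by
    apply LipschitzOnWith.of_dist_le_mul
    rintro _ ⟨x, hx, rfl⟩ _ ⟨y, hy, rfl⟩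
    rw [hinj.leftInvOn_invFunOn hx, hinj.leftInvOn_invFunOn hy]
    exact hΘ x hx y hy
  have h1 := hL.dimH_image_le
  rw [hinj.leftInvOn_invFunOn.image_image] at h1
  refine h1.trans ((dimH_mono (subset_univ _)).trans ?_)
  rw [Real.dimH_univ_eq_finrank]
  simp [Module.finrank_prod, Module.finrank_pi_fintype, mul_comm]

theorem dimH_lip_image {E V G : Type} [NormedAddCommGroup E] [NormedSpace ℂ E] [NormedAddCommGroup V] [NormedSpace ℂ V]
    [NormedAddCommGroup G] [NormedSpace ℂ G] [SecondCountableTopology V] {f : ℂ → E} {A : Set ℂ} {K : ℝ≥0} (hK : LipschitzOnWith K f A) {h : E × V → G}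
    (hh : ∀ z ∈ A, ∀ s, ContDiffAt ℂ 1 h (f z, s)) : dimH ((fun x : ℂ × V => h (f x.1, x.2)) '' (A ×ˢ univ)) ≤ dimH (A ×ˢ (univ : Set V)) := by
  apply dimH_image_le_of_locally_lipschitzOn
  rintro ⟨z, s⟩ ⟨hz, -⟩
  obtain ⟨C, t, ht, hL⟩ := (hh z hz s).exists_lipschitzOnWith
  have hj : LipschitzOnWith (max K 1) (fun x : ℂ × V => (f x.1, x.2)) (A ×ˢ univ) := by
    apply LipschitzOnWith.prodMk
    · have := hK.comp (g := f) (f := Prod.fst) (s := (A ×ˢ (univ : Set V))) (K := 1) (LipschitzWith.prod_fst.lipschitzOnWith) (by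
        rintro ⟨z, s⟩ ⟨hz, -⟩
        exact hz)
      simpa [Function.comp_def] using this
    · exact LipschitzWith.prod_snd.lipschitzOnWith
  refine ⟨C * max K 1, (A ×ˢ univ) ∩ (fun x : ℂ × V => (f x.1, x.2)) ⁻¹' t, inter_mem self_mem_nhdsWithin ?_, ?_⟩
  · exact (hj.continuousOn (z, s) ⟨hz, mem_univ _⟩).preimage_mem_nhdsWithin ht
  · exact hL.comp (hj.mono inter_subset_left) (fun x hx => hx.2)

theorem dimH_tan {M d r : ℕ} (hr : 1 ≤ r) {D : Set ℂ} (hD : IsOpen D) (hDb : Bornology.IsBounded D) (hs : SmoothlyBounded D)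
    {X : Set (Cn M)} (hX : ClosedComplexSubmanifold M d X)
    {f : ℂ → Cn M} (hf : ClassA r D f) (hfX : ∀ z ∈ closure D, f z ∈ X) :
    dimH (⋃ z ∈ frontier D, Tan X (f z)) ≤ ((1 + 2 * (min d M) : ℕ) : ENNReal) := by
  have hloc : ∀ p ∈ frontier D, ∃ W ∈ 𝓝[frontier D] p, dimH (⋃ z ∈ W ∩ frontier D, Tan X (f z)) ≤ ((1 + 2 * (min d M) : ℕ) : ENNReal) := by
    intro p hp
    have hpc := frontier_subset_closure hp
    obtain ⟨U, O, φ, ψ, hc, hxU⟩ := exists_chart hX (hfX p hpc)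
    obtain ⟨ρ, hρ, K, hK⟩ := bdry_lip hr hD hDb hs hf hp
    have hW : f ⁻¹' U ∩ ball p ρ ∈ 𝓝[frontier D] p := by
      refine inter_mem ?_ (mem_nhdsWithin_of_mem_nhds (ball_mem_nhds _ hρ))
      exact (hf.1 p hpc).mono frontier_subset_closure (hc.oU.mem_nhds hxU)
    refine ⟨_, hW, ?_⟩
    set W := f ⁻¹' U ∩ ball p ρ with hWd
    let H : ℂ × (Fin (min d M) → ℂ) → Cn M := fun x => fderiv ℂ ψ (φ (f x.1)) x.2
    have hsub : (⋃ z ∈ W ∩ frontier D, Tan X (f z)) ⊆ H '' ((W ∩ frontier D) ×ˢ univ) := by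
      intro u hu
      simp only [mem_iUnion] at hu
      obtain ⟨z, hz, hu⟩ := hu
      rw [hc.tan (hfX z (frontier_subset_closure hz.2)) hz.1.1] at hu
      obtain ⟨s, rfl⟩ := hu
      exact ⟨(z, s), ⟨hz, mem_univ _⟩, rfl⟩
    refine (dimH_mono hsub).trans (le_trans (le_trans (dimH_lip_image (f := f) (hK.mono ?_) (h := fun y => fderiv ℂ ψ (φ y.1) y.2) ?_) (dimH_mono (prod_mono_left inter_subset_right))) (dimH_bdry hD hs _))
    · rintro z hz
      exact ⟨frontier_subset_closure hz.2, hz.1.2⟩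
    intro z hz s
    have hzc := frontier_subset_closure hz.2
    have a1 : ContDiffAt ℂ 1 φ (f z) := (osgood 1 hc.oU hc.dφ).contDiffAt (hc.oU.mem_nhds hz.1.1)
    have a2 : ContDiffAt ℂ 1 (fderiv ℂ ψ) (φ (f z)) :=
      (osgood 1 hc.oO (osgood_fderiv hc.oO hc.dψ)).contDiffAt (hc.oO.mem_nhds (hc.mO _ (hfX z hzc) hz.1.1))
    have a3 : ContDiffAt ℂ 1 (fun y : Cn M × (Fin (min d M) → ℂ) => fderiv ℂ ψ (φ y.1)) (f z, s) :=
      (a2.comp (f z) a1).comp (f := Prod.fst) (f z, s) contDiffAt_fst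
    exact a3.clm_apply contDiffAt_snd
  choose! W hW hWd using hloc
  have hcomp : IsCompact (frontier D) := hDb.isCompact_closure.of_isClosed_subset isClosed_frontier frontier_subset_closure
  obtain ⟨T, hT, hcov⟩ := hcomp.elim_nhdsWithin_subcover W hW
  have : (⋃ z ∈ frontier D, Tan X (f z)) ⊆ ⋃ p ∈ T, ⋃ z ∈ W p ∩ frontier D, Tan X (f z) := by
    intro u hu
    simp only [mem_iUnion] at hu
    obtain ⟨z, hz, hu⟩ := hu
    obtain ⟨p, hpT, hzp⟩ := mem_iUnion₂.1 (hcov hz)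
    exact mem_iUnion₂.2 ⟨p, hpT, mem_iUnion₂.2 ⟨z, ⟨hzp, hz⟩, hu⟩⟩
  refine (dimH_mono this).trans ?_
  have h2 := dimH_bUnion (s := (T : Set ℂ)) T.countable_toSet (fun p => ⋃ z ∈ W p ∩ frontier D, Tan X (f z))
  simp only [Finset.mem_coe] at h2
  rw [h2]
  exact iSup₂_le fun p hp => hWd p (hT p hp)

end bdry
end Approx

namespace Approx
open MeasureTheory Topology
open scoped ContDiff Convolution Manifold NNReal

section generic

theorem kill_line {m : ℕ} {v : Fin (m+1) → ℂ} (hv : v ≠ 0) :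
    ∃ P : (Fin (m+1) → ℂ) →L[ℂ] (Fin m → ℂ), ∀ w, P w = 0 → ∃ c : ℂ, w = c • v := by
  let Q := Submodule.span ℂ {v}
  have h1 : Module.finrank ℂ Q = 1 := finrank_span_singleton hv
  have h2 := Submodule.finrank_quotient_add_finrank Q
  have h3 : Module.finrank ℂ ((Fin (m+1) → ℂ) ⧸ Q) = Module.finrank ℂ (Fin m → ℂ) := by
    rw [h1] at h2; simp at h2 ⊢; exact h2
  let e := LinearEquiv.ofFinrankEq _ _ h3
  refine ⟨LinearMap.toContinuousLinearMap (e.toLinearMap ∘ₗ Q.mkQ), fun w hw => ?_⟩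
  have : Q.mkQ w = 0 := by simpa using hw
  rw [Submodule.mkQ_apply, Submodule.Quotient.mk_eq_zero] at this
  obtain ⟨c, hc⟩ := Submodule.mem_span_singleton.1 this
  exact ⟨c, hc.symm⟩

theorem generic_step {E : Type} [NormedAddCommGroup E] [NormedSpace ℂ E] {m e : ℕ} {S : Set E} (hS : ∀ u ∈ S, ∀ c : ℂ, c • u ∈ S)
    (hdim : dimH S ≤ ((1 + 2 * e : ℕ) : ENNReal)) (hem : e ≤ m) (L : E →L[ℂ] (Fin (m+1) → ℂ)) (hL : ∀ u ∈ S, L u = 0 → u = 0) :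
    ∃ L : E →L[ℂ] (Fin m → ℂ), ∀ u ∈ S, L u = 0 → u = 0 := by
  have h1 : dimH (L '' S) < Module.finrank ℝ (Fin (m+1) → ℂ) := by
    refine (L.lipschitz.dimH_image_le S).trans_lt (hdim.trans_lt ?_)
    rw [Nat.cast_lt]
    simp [Module.finrank_pi_fintype]
    omega
  have h2 := dense_compl_of_dimH_lt_finrank h1
  obtain ⟨v, hv, hv2⟩ := h2.exists_mem_open (isOpen_compl_singleton (x := (0 : Fin (m+1) → ℂ))) ⟨fun _ => 1, by
    intro h; simpa using congrFun h 0⟩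
  obtain ⟨P, hP⟩ := kill_line (v := v) hv2
  refine ⟨P.comp L, fun u hu h => ?_⟩
  obtain ⟨c, hc⟩ := hP (L u) h
  by_cases h0 : c = 0
  · exact hL u hu (by rw [hc, h0, zero_smul])
  · exact absurd ⟨c⁻¹ • u, hS u hu _, by rw [map_smul, hc, inv_smul_smul₀ h0]⟩ hv

theorem generic {M e : ℕ} {S : Set (Cn M)} (hS : ∀ u ∈ S, ∀ c : ℂ, c • u ∈ S)
    (hdim : dimH S ≤ ((1 + 2 * e : ℕ) : ENNReal)) (he : e ≤ M) :
    ∃ L : Cn M →L[ℂ] (Fin e → ℂ), ∀ u ∈ S, L u = 0 → u = 0 := by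
  have key : ∀ j m, m + j = M → e ≤ m → ∃ L : Cn M →L[ℂ] (Fin m → ℂ), ∀ u ∈ S, L u = 0 → u = 0 := by
    intro j
    induction j with
    | zero =>
      rintro m rfl _
      exact ⟨(EuclideanSpace.equiv (Fin m) ℂ).toContinuousLinearMap, fun u _ h => by simpa using h⟩
    | succ j ih =>
      intro m hm hem
      obtain ⟨L, hL⟩ := ih (m+1) (by omega) (by omega)
      exact generic_step hS hdim hem L hL
  exact key (M - e) e (by omega) le_rfl

end generic
end Approx

namespace Approx
open MeasureTheory Topology
open scoped ContDiff Convolution Manifold NNReal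

section dets
variable {e : ℕ}

def mt (B : (Fin e → ℂ) →L[ℂ] (Fin e → ℂ)) : Matrix (Fin e) (Fin e) ℂ := fun i j => B (Pi.single j 1) i

theorem mt_mulVec (B : (Fin e → ℂ) →L[ℂ] (Fin e → ℂ)) (s : Fin e → ℂ) : (mt B).mulVec s = B s := by
  have : mt B = LinearMap.toMatrix' (B : (Fin e → ℂ) →ₗ[ℂ] (Fin e → ℂ)) := by
    ext i j; simp [mt, LinearMap.toMatrix'_apply]
  rw [this, ← Matrix.toLin'_apply, Matrix.toLin'_toMatrix']; rfl

def dt (B : (Fin e → ℂ) →L[ℂ] (Fin e → ℂ)) : ℂ := (mt B).det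

theorem dt_eq_zero {B : (Fin e → ℂ) →L[ℂ] (Fin e → ℂ)} : dt B = 0 ↔ ∃ s, s ≠ 0 ∧ B s = 0 := by
  rw [dt, ← Matrix.exists_mulVec_eq_zero_iff]
  simp [mt_mulVec]

theorem diff_det {H : Type} [NormedAddCommGroup H] [NormedSpace ℂ H] {n : ℕ} {A : H → Matrix (Fin n) (Fin n) ℂ} {x : H}
    (h : ∀ i j, DifferentiableAt ℂ (fun y => A y i j) x) : DifferentiableAt ℂ (fun y => (A y).det) x := by
  simp only [Matrix.det_apply]
  apply DifferentiableAt.fun_sum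
  intro σ _
  apply DifferentiableAt.fun_const_smul
  exact (HasFDerivAt.finset_prod (fun i _ => (h (σ i) i).hasFDerivAt)).differentiableAt

theorem diff_mt : ∀ i j, Differentiable ℂ (fun B : (Fin e → ℂ) →L[ℂ] (Fin e → ℂ) => mt B i j) := by
  intro i j
  unfold mt
  fun_prop

theorem diff_dt : Differentiable ℂ (dt (e := e)) := fun _ => diff_det (fun i j => diff_mt i j _)

def adj (B : (Fin e → ℂ) →L[ℂ] (Fin e → ℂ)) : (Fin e → ℂ) →L[ℂ] (Fin e → ℂ) :=
  LinearMap.toContinuousLinearMap (Matrix.toLin' (mt B).adjugate)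

theorem adj_apply (B : (Fin e → ℂ) →L[ℂ] (Fin e → ℂ)) (s) : B (adj B s) = dt B • s := by
  rw [← mt_mulVec, adj]
  simp [Matrix.mul_adjugate, dt, Matrix.smul_mulVec]

theorem diff_adj : Differentiable ℂ (adj (e := e)) := by
  intro B
  apply diff_of_apply
  intro v
  rw [differentiableAt_pi]
  intro i
  simp only [adj, LinearMap.coe_toContinuousLinearMap', Matrix.toLin'_apply, Matrix.mulVec, dotProduct]
  apply DifferentiableAt.fun_sum
  intro j _
  apply DifferentiableAt.mul_const
  simp only [Matrix.adjugate_apply]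
  apply diff_det
  intro a b
  by_cases h : a = j
  · subst h; simp
  · simp only [Matrix.updateRow_ne h]
    exact diff_mt _ _ _

end dets

section bad
variable {M : ℕ}

def BadPt {e : ℕ} (X : Set (Cn M)) (L : Cn M →L[ℂ] (Fin e → ℂ)) (x : Cn M) : Prop := ∃ u ∈ Tan X x, L u = 0 ∧ u ≠ 0

theorem Chart.bad_iff {X : Set (Cn M)} {e U O φ ψ} (h : Chart X e U O φ ψ) (L : Cn M →L[ℂ] (Fin e → ℂ)) {x : Cn M} (hx : x ∈ X) (hxU : x ∈ U) :
    BadPt X L x ↔ dt (L.comp (fderiv ℂ ψ (φ x))) = 0 := by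
  rw [dt_eq_zero, BadPt, h.tan hx hxU]
  constructor
  · rintro ⟨_, ⟨s, rfl⟩, h1, h2⟩
    exact ⟨s, fun hs => h2 (by rw [hs, map_zero]), h1⟩
  · rintro ⟨s, hs, h1⟩
    refine ⟨_, ⟨s, rfl⟩, h1, fun h2 => hs (h.inj (h.mO x hx hxU) (by rw [h2, map_zero]))⟩

theorem bad_finite {d r : ℕ} {D : Set ℂ} (hD : IsOpen D) (hDb : Bornology.IsBounded D) (hDc : IsConnected D)
    {X : Set (Cn M)} (hX : ClosedComplexSubmanifold M d X)
    {f : ℂ → Cn M} (hf : ClassA r D f) (hfX : ∀ z ∈ closure D, f z ∈ X) {L : Cn M →L[ℂ] (Fin (min d M) → ℂ)}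
    (hL : ∀ z ∈ frontier D, ¬ BadPt X L (f z)) :
    {z ∈ closure D | BadPt X L (f z)}.Finite := by
  have hloc : ∀ z0 ∈ closure D, ∃ A : ℂ → (Fin (min d M) → ℂ) →L[ℂ] (Fin (min d M) → ℂ), ContinuousWithinAt A (closure D) z0 ∧
      (∀ᶠ z in 𝓝[closure D] z0, (BadPt X L (f z) ↔ dt (A z) = 0)) ∧ (z0 ∈ D → ∀ᶠ z in 𝓝 z0, DifferentiableAt ℂ A z) := by
    intro z0 hz0
    obtain ⟨U, O, φ, ψ, hc, hxU⟩ := exists_chart hX (hfX z0 hz0)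
    have hLd : DifferentiableOn ℂ (fun s => L.comp (fderiv ℂ ψ s)) O :=
      (differentiableOn_const L).clm_comp (osgood_fderiv hc.oO hc.dψ)
    have hO : ∀ z ∈ closure D, f z ∈ U → φ (f z) ∈ O := fun z hz hzU => hc.mO _ (hfX z hz) hzU
    refine ⟨fun z => L.comp (fderiv ℂ ψ (φ (f z))), ?_, ?_, ?_⟩
    · have a1 : ContinuousAt (fun s => L.comp (fderiv ℂ ψ s)) (φ (f z0)) := (hLd.differentiableAt (hc.oO.mem_nhds (hO _ hz0 hxU))).continuousAt
      have a2 : ContinuousAt φ (f z0) := (hc.dφ.differentiableAt (hc.oU.mem_nhds hxU)).continuousAt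
      have a3 : ContinuousWithinAt (fun z => φ (f z)) (closure D) z0 := ContinuousAt.comp_continuousWithinAt a2 (hf.1 z0 hz0)
      exact ContinuousAt.comp_continuousWithinAt (f := fun z => φ (f z)) a1 a3
    · filter_upwards [(hf.1 z0 hz0).preimage_mem_nhdsWithin (hc.oU.mem_nhds hxU), self_mem_nhdsWithin] with z hz hzD
      exact hc.bad_iff L (hfX z hzD) hz
    · intro hzD
      have : ∀ᶠ z in 𝓝 z0, f z ∈ U := (hf.2.1.differentiableAt (hD.mem_nhds hzD)).continuousAt.eventually (hc.oU.mem_nhds hxU)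
      filter_upwards [this, hD.mem_nhds hzD] with z hz hzD
      have b1 : DifferentiableAt ℂ f z := hf.2.1.differentiableAt (hD.mem_nhds hzD)
      have b2 : DifferentiableAt ℂ φ (f z) := hc.dφ.differentiableAt (hc.oU.mem_nhds hz)
      have b3 := hLd.differentiableAt (hc.oO.mem_nhds (hO _ (subset_closure hzD) hz))
      have b4 : DifferentiableAt ℂ (fun z => φ (f z)) z := b2.comp z b1
      exact DifferentiableAt.comp z (f := fun z => φ (f z)) b3 b4
  have hgood : ∀ z0 ∈ closure D, ¬ BadPt X L (f z0) → ∀ᶠ z in 𝓝[closure D] z0, ¬ BadPt X L (f z) := by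
    intro z0 hz0 hb
    obtain ⟨A, h1, h2, -⟩ := hloc z0 hz0
    have h3 : ContinuousWithinAt (fun z => dt (A z)) (closure D) z0 := diff_dt.continuous.continuousAt.comp_continuousWithinAt h1
    have h4 : dt (A z0) ≠ 0 := fun h => hb ((h2.self_of_nhdsWithin hz0).2 h)
    filter_upwards [h2, h3.eventually_ne h4] with z hz hz2 hz3
    exact hz2 (hz.1 hz3)
  have hnd : ∀ z0 ∈ D, (𝓝[closure D] z0) = 𝓝 z0 := fun z0 hz0 =>
    nhdsWithin_eq_nhds.2 (mem_of_superset (hD.mem_nhds hz0) subset_closure)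
  have hdich : ∀ z0 ∈ D, (∀ᶠ z in 𝓝 z0, BadPt X L (f z)) ∨ (∀ᶠ z in 𝓝[≠] z0, ¬ BadPt X L (f z)) := by
    intro z0 hz0
    obtain ⟨A, h1, h2, h3⟩ := hloc z0 (subset_closure hz0)
    rw [hnd z0 hz0] at h2
    have han : AnalyticAt ℂ (fun z => dt (A z)) z0 := by
      rw [analyticAt_iff_eventually_differentiableAt]
      filter_upwards [h3 hz0] with z hz
      exact (diff_dt _).comp z hz
    rcases han.eventually_eq_zero_or_eventually_ne_zero with h | h
    · left
      filter_upwards [h, h2] with z hz hz2 using hz2.2 hz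
    · right
      filter_upwards [h, mem_nhdsWithin_of_mem_nhds h2] with z hz hz2 hz3 using hz (hz2.1 hz3)
  have hfr : (frontier D).Nonempty := by
    rw [nonempty_iff_ne_empty]
    intro h
    have hcl : IsClopen D := isClopen_iff_frontier_eq_empty.2 h
    rcases isClopen_iff.1 hcl with h | h
    · exact hDc.nonempty.ne_empty h
    · rw [h] at hDb
      exact NormedSpace.unbounded_univ ℂ ℂ hDb
  have hdich2 : ∀ z0 ∈ D, (∀ᶠ z in 𝓝[≠] z0, ¬ BadPt X L (f z)) := by
    by_contra hcon
    push Not at hcon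
    obtain ⟨z1, hz1, hz1'⟩ := hcon
    have hz1b : ∀ᶠ z in 𝓝 z1, BadPt X L (f z) := by
      rcases hdich z1 hz1 with h | h
      · exact h
      · exact absurd h hz1'
    have hsub : D ⊆ {z | ∀ᶠ y in 𝓝 z, BadPt X L (f y)} := by
      apply hDc.isPreconnected.subset_of_closure_inter_subset
      · rw [isOpen_iff_mem_nhds]
        intro z hz
        exact hz.eventually_nhds
      · exact ⟨z1, hz1, hz1b⟩
      · rintro z ⟨hz, hzD⟩
        rcases hdich z hzD with h | h
        · exact h
        · exfalso
          have h' : ∀ᶠ y in 𝓝 z, y ≠ z → ¬ BadPt X L (f y) := eventually_nhdsWithin_iff.1 h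
          obtain ⟨w, hw1, hw2⟩ := mem_closure_iff_nhds.1 hz _ h'.eventually_nhds
          have hw3 : ∀ᶠ y in 𝓝 w, y ≠ z → ¬ BadPt X L (f y) := hw1
          have hw4 : ∀ᶠ y in 𝓝 w, BadPt X L (f y) := hw2
          have hw5 : ∀ᶠ y in 𝓝[≠] w, y ∈ ({z} : Set ℂ)  := by
            apply eventually_nhdsWithin_of_eventually_nhds
            filter_upwards [hw3, hw4] with y h1 h2
            by_contra h3
            exact h1 h3 h2
          have hw6 : ∀ᶠ y in 𝓝 w, y ∈ ({z} : Set ℂ) := by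
            filter_upwards [hw3, hw4] with y h1 h2
            by_contra h3
            exact h1 h3 h2
          have hw7 : ∀ᶠ y in 𝓝[≠] w, y ≠ z := by
            rw [hw6.self_of_nhds]
            exact self_mem_nhdsWithin
          obtain ⟨y, hy1, hy2⟩ := (hw5.and hw7).exists
          exact hy2 hy1
    obtain ⟨p, hp⟩ := hfr
    have hpc := frontier_subset_closure hp
    have h1 := hgood p hpc (hL p hp)
    obtain ⟨W, hWo, hpW, hWs⟩ := mem_nhdsWithin.1 h1
    obtain ⟨y, hy1, hy2⟩ := mem_closure_iff.1 hpc W hWo hpW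
    exact hWs ⟨hy1, subset_closure hy2⟩ (hsub hy2).self_of_nhds
  have hiso : ∀ z0 ∈ closure D, ∃ W ∈ 𝓝[closure D] z0, ∀ z ∈ W, BadPt X L (f z) → z = z0 := by
    intro z0 hz0
    by_cases hzD : z0 ∈ D
    · refine ⟨{z | BadPt X L (f z) → z = z0}, ?_, fun z hz => hz⟩
      rw [hnd z0 hzD]
      have := eventually_nhdsWithin_iff.1 (hdich2 z0 hzD)
      filter_upwards [this] with z hz hb
      by_contra hne
      exact hz hne hb
    · have hp : z0 ∈ frontier D := by rw [hD.frontier_eq]; exact ⟨hz0, hzD⟩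
      exact ⟨_, hgood z0 hz0 (hL z0 hp), fun z hz hb => absurd hb hz⟩
  choose! W hW hWd using hiso
  obtain ⟨T, hT, hcov⟩ := hDb.isCompact_closure.elim_nhdsWithin_subcover W hW
  refine T.finite_toSet.subset ?_
  rintro z ⟨hz, hb⟩
  obtain ⟨p, hpT, hzp⟩ := mem_iUnion₂.1 (hcov hz)
  rw [hWd p (hT p hpT) z hzp hb]
  exact hpT

theorem exists_proj {d r : ℕ} (hr : 1 ≤ r) {D : Set ℂ} (hD : IsOpen D) (hDb : Bornology.IsBounded D) (hDc : IsConnected D) (hs : SmoothlyBounded D)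
    {X : Set (Cn M)} (hX : ClosedComplexSubmanifold M d X)
    {f : ℂ → Cn M} (hf : ClassA r D f) (hfX : ∀ z ∈ closure D, f z ∈ X) :
    ∃ L : Cn M →L[ℂ] (Fin (min d M) → ℂ), ∃ B : Finset ℂ, (∀ b ∈ B, b ∈ D) ∧ ∀ z ∈ closure D, BadPt X L (f z) → z ∈ B := by
  obtain ⟨L, hL⟩ := generic (e := min d M) (S := ⋃ z ∈ frontier D, Tan X (f z)) (by
    intro u hu c
    simp only [mem_iUnion] at hu ⊢
    obtain ⟨z, hz, hu⟩ := hu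
    refine ⟨z, hz, ?_⟩
    have hz' := hfX z (frontier_subset_closure hz)
    obtain ⟨U, O, φ, ψ, hc, hxU⟩ := exists_chart hX hz'
    rw [hc.tan hz' hxU] at hu ⊢
    obtain ⟨s, rfl⟩ := hu
    exact ⟨c • s, by rw [map_smul]⟩) (dimH_tan hr hD hDb hs hX hf hfX) (min_le_right _ _)
  have hLf : ∀ z ∈ frontier D, ¬ BadPt X L (f z) := by
    rintro z hz ⟨u, hu, h1, h2⟩
    exact h2 (hL u (mem_iUnion₂.2 ⟨z, hz, hu⟩) h1)
  have hfin := bad_finite hD hDb hDc hX hf hfX hLf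
  refine ⟨L, hfin.toFinset, ?_, ?_⟩
  · intro b hb
    rw [Finite.mem_toFinset] at hb
    by_contra hbD
    exact hLf b (by rw [hD.frontier_eq]; exact ⟨hb.1, hbD⟩) hb.2
  · intro z hz hb
    rw [Finite.mem_toFinset]
    exact ⟨hz, hb⟩

end bad
end Approx

namespace Approx
open MeasureTheory Topology
open scoped ContDiff Convolution Manifold NNReal

section tools
variable {V W : Type} [NormedAddCommGroup V] [NormedSpace ℂ V] [NormedAddCommGroup W] [NormedSpace ℂ W]
  [FiniteDimensional ℂ V] [CompleteSpace W]

theorem inv_fun {G : V → W} {a : V} {P : V → Prop} (hG : ∀ᶠ x in 𝓝 a, DifferentiableAt ℂ G x ∧ P x)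
    (I : V ≃L[ℂ] W) (hI : HasFDerivAt G (I : V →L[ℂ] W) a) :
    ∃ S O' Λ, IsOpen S ∧ a ∈ S ∧ (∀ x ∈ S, DifferentiableAt ℂ G x ∧ P x) ∧ IsOpen O' ∧ G a ∈ O' ∧ DifferentiableOn ℂ Λ O' ∧
      MapsTo Λ O' S ∧ MapsTo G S O' ∧ (∀ x ∈ S, Λ (G x) = x) ∧ ∀ y ∈ O', G (Λ y) = y := by
  haveI : CompleteSpace V := FiniteDimensional.complete ℂ V
  obtain ⟨Ω, hΩ, hΩo, ha⟩ := _root_.eventually_nhds_iff.1 hG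
  have hc : ContDiffAt ℂ 1 G a :=
    (osgood 1 hΩo (fun x hx => (hΩ x hx).1.differentiableWithinAt)).contDiffAt (hΩo.mem_nhds ha)
  let e := hc.toOpenPartialHomeomorph G hI one_ne_zero
  have hae : a ∈ e.source := hc.mem_toOpenPartialHomeomorph_source hI one_ne_zero
  have hGe : ∀ x, e x = G x := fun x => rfl
  have hl : ContDiffAt ℂ 1 e.symm (G a) := hc.to_localInverse hI one_ne_zero
  have hl2 : ∀ᶠ y in 𝓝 (G a), DifferentiableAt ℂ e.symm y := by
    filter_upwards [hl.eventually (by simp)] with y hy using hy.differentiableAt one_ne_zero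
  obtain ⟨O1, hO1, hO1o, haO1⟩ := _root_.eventually_nhds_iff.1 hl2
  let O' := (e.target ∩ e.symm ⁻¹' Ω) ∩ O1
  have hO' : IsOpen O' := (e.symm.isOpen_inter_preimage hΩo).inter hO1o
  refine ⟨e.source ∩ e ⁻¹' O', O', e.symm, e.isOpen_inter_preimage hO', ⟨hae, ?_⟩, ?_, hO', ?_, ?_, ?_, ?_, ?_, ?_⟩
  · refine ⟨⟨e.map_source hae, ?_⟩, haO1⟩
    show e.symm (e a) ∈ Ω
    rw [e.left_inv hae]; exact ha
  · rintro x ⟨hx, hx'⟩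
    have : e.symm (e x) ∈ Ω := hx'.1.2
    rw [e.left_inv hx] at this
    exact hΩ x this
  · refine ⟨⟨e.map_source hae, ?_⟩, haO1⟩
    show e.symm (e a) ∈ Ω
    rw [e.left_inv hae]; exact ha
  · exact fun y hy => (hO1 y hy.2).differentiableWithinAt
  · intro y hy
    refine ⟨e.map_target hy.1.1, ?_⟩
    show e (e.symm y) ∈ O'
    rw [e.right_inv hy.1.1]; exact hy
  · exact fun x hx => hx.2
  · exact fun x hx => e.left_inv hx.1
  · exact fun y hy => e.right_inv hy.1.1

theorem taylor2 {F : V → W} {O : Set V} (hO : IsOpen O) (hF : DifferentiableOn ℂ F O) {q0 : V} (hq : q0 ∈ O) :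
    ∃ Q : V × ℂ × V → W, ∀ᶠ x : V × ℂ × V in 𝓝 (q0, 0, 0), DifferentiableAt ℂ Q x ∧ x.1 + x.2.1 • x.2.2 ∈ O ∧
      F (x.1 + x.2.1 • x.2.2) = F x.1 + x.2.1 • fderiv ℂ F x.1 x.2.2 + x.2.1 ^ 2 • Q x ∧ (x.2.2 = 0 → Q x = 0) := by
  have hF1 := osgood_fderiv hO hF
  have hF2 := osgood_fderiv hO hF1
  obtain ⟨R, hR, hRO⟩ := Metric.isOpen_iff.1 hO q0 hq
  let c : V × ℂ × V → ℝ → V := fun x θ => x.1 + ((θ : ℂ) * x.2.1) • x.2.2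
  set R1 := min (R / 4) 1 with hR1
  have hR1p : 0 < R1 := by positivity
  have hcO : ∀ x ∈ ball ((q0, 0, 0) : V × ℂ × V) R1, ∀ θ ∈ Icc (0:ℝ) 1, c x θ ∈ O := by
    rintro ⟨q, t, σ⟩ hx θ hθ
    apply hRO
    rw [mem_ball, Prod.dist_eq, Prod.dist_eq] at hx
    simp only [max_lt_iff, dist_zero_right] at hx
    obtain ⟨h1, h2, h3⟩ := hx
    have h4 : R1 ≤ R / 4 := min_le_left _ _
    have h5 : R1 ≤ 1 := min_le_right _ _
    rw [mem_ball]
    have h6 : ‖((θ : ℂ) * t) • σ‖ ≤ R1 := by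
      rw [norm_smul, norm_mul, norm_real, Real.norm_eq_abs, abs_of_nonneg hθ.1]
      have : θ * ‖t‖ ≤ 1 := by nlinarith [norm_nonneg t, hθ.2, hθ.1]
      nlinarith [norm_nonneg σ, norm_nonneg t]
    calc dist (q + ((θ : ℂ) * t) • σ) q0 ≤ dist (q + ((θ : ℂ) * t) • σ) q + dist q q0 := dist_triangle _ _ _
      _ ≤ R1 + R1 := by rw [dist_self_add_left]; linarith
      _ < R := by linarith
  let Φ : V × ℂ × V → ℝ → W := fun x θ => (1 - (θ : ℂ)) • fderiv ℂ (fderiv ℂ F) (c x θ) x.2.2 x.2.2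
  refine ⟨fun x => ∫ θ in (0:ℝ)..1, Φ x θ, ?_⟩
  filter_upwards [ball_mem_nhds _ hR1p] with x hx
  have hcd : ∀ θ, Differentiable ℂ (fun x => c x θ) := fun θ => by
    show Differentiable ℂ (fun x : V × ℂ × V => x.1 + ((θ : ℂ) * x.2.1) • x.2.2)
    fun_prop
  have hcc : Continuous (fun y : (V × ℂ × V) × ℝ => c y.1 y.2) := by
    show Continuous (fun y : (V × ℂ × V) × ℝ => y.1.1 + ((y.2 : ℂ) * y.1.2.1) • y.1.2.2)
    fun_prop
  have hone : (1:ℝ) ∈ Icc (0:ℝ) 1 := by simp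
  refine ⟨?_, by simpa [c] using hcO x hx 1 hone, ?_, ?_⟩
  · obtain ⟨R2, hR2, hR2s⟩ := Metric.nhds_basis_closedBall.mem_iff.1 (isOpen_ball.mem_nhds hx)
    apply param_diff (R := R2) hR2 zero_le_one
    · have : ContinuousOn (fun y : (V × ℂ × V) × ℝ => fderiv ℂ (fderiv ℂ F) (c y.1 y.2)) (closedBall x R2 ×ˢ Icc 0 1) :=
        hF2.continuousOn.comp hcc.continuousOn (fun y hy => hcO y.1 (hR2s hy.1) y.2 hy.2)
      apply ContinuousOn.smul
      · fun_prop
      · exact (this.clm_apply (by fun_prop)).clm_apply (by fun_prop)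
    · intro θ hθ
      apply DifferentiableOn.fun_const_smul
      have : DifferentiableOn ℂ (fun y : (V × ℂ × V) => fderiv ℂ (fderiv ℂ F) (c y θ)) (closedBall x R2) :=
        hF2.comp (hcd θ).differentiableOn (fun y hy => hcO y (hR2s hy) θ hθ)
      exact (this.clm_apply (by fun_prop)).clm_apply (by fun_prop)
  · obtain ⟨q, t, σ⟩ := x
    let x : V × ℂ × V := (q, t, σ)
    have hcder : ∀ θ, HasDerivAt (c x) (t • σ) θ := by
      intro θ
      have := (((ofRealCLM.hasDerivAt (x := θ)).mul_const t).smul_const σ).const_add q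
      simpa [c, x] using this
    have hd1 : ∀ θ ∈ Icc (0:ℝ) 1, HasDerivAt (fun θ => F (c x θ)) (t • fderiv ℂ F (c x θ) σ) θ := by
      intro θ hθ
      have a1 : HasFDerivAt F (fderiv ℂ F (c x θ)) (c x θ) := (hF.differentiableAt (hO.mem_nhds (hcO x hx θ hθ))).hasFDerivAt
      have := (a1.restrictScalars ℝ).comp_hasDerivAt θ (hcder θ)
      simpa [Function.comp_def] using this
    have hd2 : ∀ θ ∈ Icc (0:ℝ) 1, HasDerivAt (fun θ => fderiv ℂ F (c x θ)) (t • fderiv ℂ (fderiv ℂ F) (c x θ) σ) θ := by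
      intro θ hθ
      have a1 : HasFDerivAt (fderiv ℂ F) (fderiv ℂ (fderiv ℂ F) (c x θ)) (c x θ) := (hF1.differentiableAt (hO.mem_nhds (hcO x hx θ hθ))).hasFDerivAt
      have := (a1.restrictScalars ℝ).comp_hasDerivAt θ (hcder θ)
      simpa [Function.comp_def] using this
    have hd3 : ∀ θ ∈ Icc (0:ℝ) 1, HasDerivAt (fun θ : ℝ => F (c x θ) + (1 - (θ:ℂ)) • (t • fderiv ℂ F (c x θ) σ)) (t ^ 2 • Φ x θ) θ := by
      intro θ hθ
      have a1 : HasDerivAt (fun θ : ℝ => (1 - (θ:ℂ))) (-1) θ := by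
        simpa using (ofRealCLM.hasDerivAt (x := θ)).const_sub (1:ℂ)
      have a2 : HasDerivAt (fun θ => t • fderiv ℂ F (c x θ) σ) (t • (t • fderiv ℂ (fderiv ℂ F) (c x θ) σ) σ) θ := by
        have := (((ContinuousLinearMap.apply ℂ W σ).hasFDerivAt (x := fderiv ℂ F (c x θ))).restrictScalars ℝ).comp_hasDerivAt θ (hd2 θ hθ)
        have := this.fun_const_smul t
        simpa [Function.comp_def] using this
      have a3 := (hd1 θ hθ).fun_add (a1.fun_smul a2)
      refine a3.congr_deriv ?_
      simp only [Φ, x, ContinuousLinearMap.smul_apply]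
      module
    have hintg : IntervalIntegrable (fun θ => t ^ 2 • Φ x θ) volume 0 1 := by
      apply ContinuousOn.intervalIntegrable
      rw [uIcc_of_le zero_le_one]
      have : ContinuousOn (fun θ : ℝ => fderiv ℂ (fderiv ℂ F) (c x θ)) (Icc 0 1) :=
        hF2.continuousOn.comp (hcc.comp (by fun_prop : Continuous fun θ : ℝ => (x, θ))).continuousOn (fun θ hθ => hcO x hx θ hθ)
      apply ContinuousOn.const_smul
      apply ContinuousOn.smul
      · fun_prop
      · exact (this.clm_apply (by fun_prop)).clm_apply (by fun_prop)
    have := intervalIntegral.integral_eq_sub_of_hasDerivAt (a := 0) (b := 1) (by rw [uIcc_of_le zero_le_one]; exact hd3) hintg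
    rw [intervalIntegral.integral_smul] at this
    show F (q + t • σ) = F q + t • fderiv ℂ F q σ + t ^ 2 • (∫ θ in (0:ℝ)..1, Φ x θ)
    rw [this]
    simp [c, x]
  · intro h0
    have : ∀ θ, Φ x θ = 0 := by intro θ; simp [Φ, h0]
    simp [this]

theorem exists_T {e : ℕ} {A : ℂ → (Fin e → ℂ) →L[ℂ] (Fin e → ℂ)} {b : ℂ} (hA : ∀ᶠ z in 𝓝 b, DifferentiableAt ℂ A z)
    (hne : ∀ᶠ z in 𝓝[≠] b, dt (A z) ≠ 0) :
    ∃ (n : ℕ) (T : ℂ → (Fin e → ℂ) →L[ℂ] (Fin e → ℂ)), ∀ᶠ z in 𝓝 b, DifferentiableAt ℂ T z ∧ ∀ s, A z (T z s) = (z - b) ^ n • s := by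
  have han : AnalyticAt ℂ (fun z => dt (A z)) b := by
    rw [analyticAt_iff_eventually_differentiableAt]
    filter_upwards [hA] with z hz
    exact (diff_dt _).comp z hz
  have hnz : ¬ ∀ᶠ z in 𝓝 b, dt (A z) = 0 := by
    intro h
    obtain ⟨z, h1, h2⟩ := (hne.and (eventually_nhdsWithin_of_eventually_nhds h)).exists
    exact h1 h2
  obtain ⟨n, u, hu, hu0, hun⟩ := (AnalyticAt.exists_eventuallyEq_pow_smul_nonzero_iff han).2 hnz
  refine ⟨n, fun z => (u z)⁻¹ • adj (A z), ?_⟩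
  filter_upwards [hA, hun, hu.eventually_analyticAt, hu.continuousAt.eventually_ne hu0] with z h1 h2 h3 h4
  refine ⟨(h3.differentiableAt.inv h4).smul ((diff_adj _).comp z h1), fun s => ?_⟩
  simp only [ContinuousLinearMap.smul_apply, map_smul, adj_apply, h2, smul_smul, smul_eq_mul]
  congr 1
  field_simp

theorem jet_zero {b : ℂ} (k : ℕ) : ∀ (i : ℕ) (w : ℂ → W), i ≤ k → (∀ᶠ z in 𝓝 b, DifferentiableAt ℂ w z) →
    iteratedDeriv i (fun z => (z - b) ^ (k+1) • w z) b = 0 := by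
  induction k with
  | zero => intro i w hi _; obtain rfl : i = 0 := by omega
            simp
  | succ k ih =>
    intro i w hi hw
    rcases i with _ | i
    · simp
    rw [iteratedDeriv_succ']
    have : deriv (fun z => (z - b) ^ (k+1+1) • w z) =ᶠ[𝓝 b] fun z => (z - b) ^ (k+1) • (((k+1+1 : ℕ) : ℂ) • w z + (z - b) • deriv w z) := by
      filter_upwards [hw] with z hz
      have a1 : HasDerivAt (fun z => (z - b) ^ (k+1+1)) (((k+1+1 : ℕ) : ℂ) * (z - b) ^ (k+1)) z := by
        simpa using ((hasDerivAt_id z).sub_const b).fun_pow (k+1+1)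
      rw [(a1.fun_smul hz.hasDerivAt).deriv]
      module
    rw [this.iteratedDeriv_eq]
    apply ih i _ (by omega)
    have han : AnalyticAt ℂ w b := analyticAt_iff_eventually_differentiableAt.2 hw
    have : AnalyticAt ℂ (fun z => (((k+1+1 : ℕ) : ℂ) • w z + (z - b) • deriv w z)) b := by
      have := han.deriv
      fun_prop
    exact this.eventually_analyticAt.mono fun z hz => hz.differentiableAt

end tools
end Approx

namespace Approx
open MeasureTheory Topology
open scoped ContDiff Convolution Manifold NNReal

theorem smul_deriv_zero {V W : Type} [NormedAddCommGroup V] [NormedSpace ℂ V] [NormedAddCommGroup W] [NormedSpace ℂ W]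
    {a : V → ℂ} {c : V → W} {x : V} (ha : DifferentiableAt ℂ a x) (hc : DifferentiableAt ℂ c x) (ha0 : a x = 0) (hc0 : c x = 0) :
    HasFDerivAt (fun y => a y • c y) (0 : V →L[ℂ] W) x := by
  have := ha.hasFDerivAt.fun_smul hc.hasFDerivAt
  refine this.congr_fderiv ?_
  ext v; simp [ha0, hc0]

theorem disc_map0 {e : ℕ} {E : Type} [NormedAddCommGroup E] [NormedSpace ℂ E] [FiniteDimensional ℂ E]
    {ψ : (Fin e → ℂ) → E} {O : Set (Fin e → ℂ)} (hO : IsOpen O) (hψ : DifferentiableOn ℂ ψ O)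
    {p : ℂ → (Fin e → ℂ)} {b : ℂ} (hp : ∀ᶠ z in 𝓝 b, DifferentiableAt ℂ p z) (hpb : p b ∈ O)
    (L : E →L[ℂ] (Fin e → ℂ)) (hne : ∀ᶠ z in 𝓝[≠] b, dt (L.comp (fderiv ℂ ψ (p z))) ≠ 0) (k : ℕ) :
    ∃ N0, ∀ N ≥ N0, ∃ Ξ om : ℂ × (Fin e → ℂ) → E, ∀ᶠ x in 𝓝 ((b, 0) : ℂ × (Fin e → ℂ)),
      DifferentiableAt ℂ Ξ x ∧ DifferentiableAt ℂ om x ∧ Ξ x ∈ ψ '' O ∧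
      L (Ξ x) = L (ψ (p x.1)) + (x.1 - b) ^ N • x.2 ∧ Ξ (x.1, 0) = ψ (p x.1) ∧
      Ξ x = ψ (p x.1) + (x.1 - b) ^ (k+1) • om x := by
  haveI : CompleteSpace E := FiniteDimensional.complete ℂ E
  have hψ1 := osgood_fderiv hO hψ
  have hpO : ∀ᶠ z in 𝓝 b, p z ∈ O := hp.self_of_nhds.continuousAt.eventually_mem (hO.mem_nhds hpb)
  have hA : ∀ᶠ z in 𝓝 b, DifferentiableAt ℂ (fun z => L.comp (fderiv ℂ ψ (p z))) z := by
    filter_upwards [hp, hpO] with z h1 h2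
    have : DifferentiableAt ℂ (fun z => fderiv ℂ ψ (p z)) z := (hψ1.differentiableAt (hO.mem_nhds h2)).comp z h1
    exact (differentiableAt_const L).clm_comp this
  obtain ⟨n, T, hT⟩ := exists_T hA hne
  obtain ⟨Q, hQ⟩ := taylor2 hO hψ hpb
  refine ⟨n + (k + 1) + n + 1, fun N hN => ?_⟩
  obtain ⟨j, rfl⟩ := Nat.exists_eq_add_of_le hN
  set m := n + (k + 1) with hm
  let V := Fin e → ℂ
  let q : ℂ × V × V → V × ℂ × V := fun x => (p x.1, (x.1 - b) ^ m, T x.1 x.2.2)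
  let x0 : ℂ × V × V := (b, 0, 0)
  have hq0 : q x0 = (p b, 0, 0) := by simp [q, x0, hm]
  have hqd : ∀ x : ℂ × V × V, DifferentiableAt ℂ p x.1 → DifferentiableAt ℂ T x.1 → DifferentiableAt ℂ q x := by
    intro x h1 h2
    have h3 : DifferentiableAt ℂ (fun x : ℂ × V × V => p x.1) x := h1.comp x differentiableAt_fst
    have h4 : DifferentiableAt ℂ (fun x : ℂ × V × V => T x.1) x := DifferentiableAt.comp (g := T) x h2 differentiableAt_fst
    have h5 : DifferentiableAt ℂ (fun x : ℂ × V × V => T x.1 x.2.2) x := h4.clm_apply (by fun_prop)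
    have h6 : DifferentiableAt ℂ (fun x : ℂ × V × V => (x.1 - b) ^ m) x := by fun_prop
    exact h3.prodMk (h6.prodMk h5)
  have hfst : Tendsto (fun x : ℂ × V × V => x.1) (𝓝 x0) (𝓝 b) := continuous_fst.tendsto x0
  have hqc : Tendsto q (𝓝 x0) (𝓝 (p b, 0, 0)) := by
    rw [← hq0]
    exact (hqd x0 hp.self_of_nhds hT.self_of_nhds.1).continuousAt
  let G : ℂ × V × V → ℂ × V × V := fun x => (x.1, x.2.1, x.2.2 + (x.1 - b) ^ (k+1) • L (Q (q x)) - (x.1 - b) ^ (j+1) • x.2.1)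
  have hQq : ∀ x, DifferentiableAt ℂ q x → DifferentiableAt ℂ Q (q x) → DifferentiableAt ℂ (fun x => L (Q (q x))) x := by
    intro x h1 h2
    exact L.differentiableAt.comp x (h2.comp x h1)
  have hGd : ∀ x, DifferentiableAt ℂ q x → DifferentiableAt ℂ Q (q x) → DifferentiableAt ℂ G x := by
    intro x h1 h2
    have := hQq x h1 h2
    have h3 : DifferentiableAt ℂ (fun x : ℂ × V × V => (x.1 - b) ^ (k+1)) x := by fun_prop
    have h4 : DifferentiableAt ℂ (fun x : ℂ × V × V => (x.1 - b) ^ (j+1) • x.2.1) x := by fun_prop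
    have h5 : DifferentiableAt ℂ (fun x : ℂ × V × V => x.2.2) x := by fun_prop
    exact differentiableAt_fst.prodMk ((by fun_prop : DifferentiableAt ℂ (fun x : ℂ × V × V => x.2.1) x).prodMk ((h5.fun_add (h3.fun_smul this)).fun_sub h4))
  have hQ0 := hQ.self_of_nhds
  have hG0 : HasFDerivAt G ((ContinuousLinearEquiv.refl ℂ (ℂ × V × V)) : (ℂ × V × V) →L[ℂ] (ℂ × V × V)) x0 := by
    have h1 := hQq x0 (hqd x0 hp.self_of_nhds hT.self_of_nhds.1) (by rw [hq0]; exact hQ0.1)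
    have h2 : L (Q (q x0)) = 0 := by rw [hq0, hQ0.2.2.2 rfl, map_zero]
    have t1 : HasFDerivAt (fun x : ℂ × V × V => (x.1 - b) ^ (k+1) • L (Q (q x))) 0 x0 :=
      smul_deriv_zero (by fun_prop) h1 (by simp [x0]) h2
    have t2 : HasFDerivAt (fun x : ℂ × V × V => (x.1 - b) ^ (j+1) • x.2.1) 0 x0 :=
      smul_deriv_zero (by fun_prop) (by fun_prop) (by simp [x0]) rfl
    have t3 : HasFDerivAt (fun x : ℂ × V × V => x.2.2) _ x0 := (hasFDerivAt_snd (𝕜 := ℂ) (p := x0.2)).comp x0 hasFDerivAt_snd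
    have t4 : HasFDerivAt (fun x : ℂ × V × V => x.2.1) _ x0 := (hasFDerivAt_fst (𝕜 := ℂ) (p := x0.2)).comp x0 hasFDerivAt_snd
    have := (hasFDerivAt_fst (𝕜 := ℂ) (p := x0)).prodMk (t4.prodMk ((t3.fun_add t1).fun_sub t2))
    refine this.congr_fderiv ?_
    ext v <;> simp
  let P : ℂ × V × V → Prop := fun x => (DifferentiableAt ℂ p x.1 ∧ p x.1 ∈ O) ∧ (DifferentiableAt ℂ T x.1 ∧ ∀ s, L.comp (fderiv ℂ ψ (p x.1)) (T x.1 s) = (x.1 - b) ^ n • s) ∧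
    (DifferentiableAt ℂ Q (q x) ∧ (q x).1 + (q x).2.1 • (q x).2.2 ∈ O ∧
      ψ ((q x).1 + (q x).2.1 • (q x).2.2) = ψ (q x).1 + (q x).2.1 • fderiv ℂ ψ (q x).1 (q x).2.2 + (q x).2.1 ^ 2 • Q (q x) ∧ ((q x).2.2 = 0 → Q (q x) = 0))
  have hev : ∀ᶠ x in 𝓝 x0, DifferentiableAt ℂ G x ∧ P x := by
    filter_upwards [hfst.eventually hp, hfst.eventually hpO, hfst.eventually hT, hqc.eventually hQ] with x h1 h2 h3 h4
    exact ⟨hGd x (hqd x h1 h3.1) h4.1, ⟨h1, h2⟩, h3, h4⟩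
  obtain ⟨S, O', Λ, hS, hx0S, hSP, hO', hx0O', hΛ, hΛS, hGS, hΛG, hGΛ⟩ := inv_fun hev (ContinuousLinearEquiv.refl ℂ (ℂ × V × V)) hG0
  have hGzero : ∀ z : ℂ, (z, 0, 0) ∈ S → G (z, 0, 0) = (z, 0, 0) := by
    intro z hz
    have : Q (q (z, 0, 0)) = 0 := (hSP _ hz).2.2.2.2.2.2 (by simp [q])
    simp [G, this]
  rw [hGzero b hx0S] at hx0O'
  let ι : ℂ × V → ℂ × V × V := fun x => (x.1, x.2, 0)
  have hιd : Differentiable ℂ ι := differentiable_fst.prodMk (differentiable_snd.prodMk (differentiable_const 0))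
  let Sg : ℂ × V → V := fun x => (Λ (ι x)).2.2
  have e1 : ∀ᶠ x in 𝓝 ((b, 0) : ℂ × V), ι x ∈ O' :=
    (hιd.continuous.tendsto (b, 0)).eventually (hO'.mem_nhds hx0O')
  have e2 : ∀ᶠ x in 𝓝 ((b, 0) : ℂ × V), ι (x.1, 0) ∈ S := by
    have : Continuous fun x : ℂ × V => ι (x.1, 0) := hιd.continuous.comp (by fun_prop)
    exact (this.tendsto (b, 0)).eventually (hS.mem_nhds hx0S)
  refine ⟨fun x => ψ (p x.1 + (x.1 - b) ^ m • T x.1 (Sg x)), fun x => (x.1 - b) ^ n • (fderiv ℂ ψ (p x.1) (T x.1 (Sg x)) + (x.1 - b) ^ m • Q (q (x.1, x.2, Sg x))), ?_⟩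
  filter_upwards [e1, e2] with x h1 h2
  have hΛx : Λ (ι x) = (x.1, x.2, Sg x) := by
    have := hGΛ _ h1
    have a1 : (Λ (ι x)).1 = x.1 := congrArg Prod.fst this
    have a2 : (Λ (ι x)).2.1 = x.2 := congrArg (fun y => y.2.1) this
    ext1
    · exact a1
    · ext1
      · exact a2
      · rfl
  have hs := hΛS h1
  rw [hΛx] at hs
  have hGx := hGΛ _ h1
  rw [hΛx] at hGx
  have hG3 : Sg x + (x.1 - b) ^ (k+1) • L (Q (q (x.1, x.2, Sg x))) - (x.1 - b) ^ (j+1) • x.2 = 0 := congrArg (fun y => y.2.2) hGx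
  obtain ⟨_, ⟨hpd, hpO'⟩, ⟨hTd, hTA⟩, hQd, hmem, htay, -⟩ := hSP _ hs
  have hΛd : DifferentiableAt ℂ Λ (ι x) := hΛ.differentiableAt (hO'.mem_nhds h1)
  have hSgd : DifferentiableAt ℂ Sg x := ((hΛd.comp x (hιd x)).snd).snd
  have d1 : DifferentiableAt ℂ (fun x : ℂ × V => p x.1) x := hpd.comp x differentiableAt_fst
  have d2 : DifferentiableAt ℂ (fun x : ℂ × V => T x.1) x := DifferentiableAt.comp (g := T) x hTd differentiableAt_fst
  have d3 : DifferentiableAt ℂ (fun x : ℂ × V => T x.1 (Sg x)) x := d2.clm_apply hSgd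
  have d4 : ∀ i : ℕ, DifferentiableAt ℂ (fun x : ℂ × V => (x.1 - b) ^ i) x := fun i => by fun_prop
  have d5 : DifferentiableAt ℂ (fun x : ℂ × V => Q (q (x.1, x.2, Sg x))) x := by
    have : DifferentiableAt ℂ (fun x : ℂ × V => q (x.1, x.2, Sg x)) x := d1.prodMk ((d4 m).prodMk d3)
    exact DifferentiableAt.comp (g := Q) x hQd this
  have d6 : DifferentiableAt ℂ (fun x : ℂ × V => fderiv ℂ ψ (p x.1)) x :=
    DifferentiableAt.comp (g := fderiv ℂ ψ) x (hψ1.differentiableAt (hO.mem_nhds hpO')) d1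
  refine ⟨?_, ?_, ⟨_, hmem, rfl⟩, ?_, ?_, ?_⟩
  · exact DifferentiableAt.comp (g := ψ) x (hψ.differentiableAt (hO.mem_nhds hmem)) (d1.fun_add ((d4 m).fun_smul d3))
  · exact (d4 n).fun_smul ((d6.clm_apply d3).fun_add ((d4 m).fun_smul d5))
  · have e3 : ψ (p x.1 + (x.1 - b) ^ m • T x.1 (Sg x)) = ψ (p x.1) + (x.1 - b) ^ m • fderiv ℂ ψ (p x.1) (T x.1 (Sg x)) + ((x.1 - b) ^ m) ^ 2 • Q (q (x.1, x.2, Sg x)) := htay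
    have e4 : L (fderiv ℂ ψ (p x.1) (T x.1 (Sg x))) = (x.1 - b) ^ n • Sg x := hTA _
    have e5 : Sg x = (x.1 - b) ^ (j+1) • x.2 - (x.1 - b) ^ (k+1) • L (Q (q (x.1, x.2, Sg x))) := by
      rw [← sub_eq_zero, ← hG3]; module
    show L (ψ (p x.1 + (x.1 - b) ^ m • T x.1 (Sg x))) = _
    rw [e3, map_add, map_add, map_smul, map_smul, e4]
    generalize L (Q (q (x.1, x.2, Sg x))) = y at *
    rw [e5, hm]
    module
  · have : Sg (x.1, 0) = 0 := by
      have a1 := hΛG _ h2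
      have a2 : G (ι (x.1, 0)) = ι (x.1, 0) := hGzero x.1 h2
      rw [a2] at a1
      show (Λ (ι (x.1, 0))).2.2 = 0
      rw [a1]
    simp [this]
  · have e3 : ψ (p x.1 + (x.1 - b) ^ m • T x.1 (Sg x)) = ψ (p x.1) + (x.1 - b) ^ m • fderiv ℂ ψ (p x.1) (T x.1 (Sg x)) + ((x.1 - b) ^ m) ^ 2 • Q (q (x.1, x.2, Sg x)) := htay
    show ψ (p x.1 + (x.1 - b) ^ m • T x.1 (Sg x)) = _
    rw [e3, hm]
    module

end Approx

namespace Approx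
open MeasureTheory Topology
open scoped ContDiff Convolution Manifold NNReal

theorem unif_comp {V E : Type} [NormedAddCommGroup V] [NormedSpace ℂ V] [FiniteDimensional ℂ V] [NormedAddCommGroup E]
    {Xi : ℂ × V → E} {b : ℂ} {ρ R : ℝ} (hXi : ContinuousOn Xi (closedBall b ρ ×ˢ closedBall 0 R)) (hR : 0 < R)
    {u : ℕ → ℂ → V} (hu : TendstoUniformlyOn u (fun _ => 0) atTop (closedBall b ρ)) :
    TendstoUniformlyOn (fun ν z => Xi (z, u ν z)) (fun z => Xi (z, 0)) atTop (closedBall b ρ) := by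
  haveI : ProperSpace V := FiniteDimensional.proper ℂ V
  have huc := ((isCompact_closedBall b ρ).prod (isCompact_closedBall (0:V) R)).uniformContinuousOn_of_continuous hXi
  rw [Metric.uniformContinuousOn_iff] at huc
  rw [Metric.tendstoUniformlyOn_iff] at hu ⊢
  intro ε hε
  obtain ⟨δ, hδ, h⟩ := huc ε hε
  filter_upwards [hu (min δ R) (by positivity)] with ν hν z hz
  have := hν z hz
  rw [dist_zero_left, lt_min_iff] at this
  apply h _ ⟨hz, by simp [hR.le]⟩ _ ⟨hz, by simpa using this.2.le⟩
  simp [Prod.dist_eq, dist_zero_left, this.1, hδ]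

theorem disc_solve {M d : ℕ} {X : Set (Cn M)} (hX : ClosedComplexSubmanifold M d X) {D : Set ℂ} (hD : IsOpen D)
    {f : ℂ → Cn M} (hf : DifferentiableOn ℂ f D) (hfX : ∀ z ∈ D, f z ∈ X) {b : ℂ} (hb : b ∈ D)
    (L : Cn M →L[ℂ] (Fin (min d M) → ℂ)) (hne : ∀ᶠ z in 𝓝[≠] b, ¬ BadPt X L (f z)) (k : ℕ) :
    ∃ N0, ∀ N ≥ N0, ∃ ρ > 0, ball b ρ ⊆ D ∧ ∀ h : ℕ → ℂ → Cn M, (∀ ν, DifferentiableOn ℂ (h ν) D) →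
      TendstoLocallyUniformlyOn h (fun _ => 0) atTop D → ∃ F : ℕ → ℂ → Cn M,
      (∀ᶠ ν in atTop, DifferentiableOn ℂ (F ν) (ball b ρ) ∧ (∀ z ∈ ball b ρ, F ν z ∈ X ∧ L (F ν z) = L (f z) + (z - b) ^ N • L (h ν z)) ∧
        ∀ i ≤ k, iteratedDeriv i (F ν) b = iteratedDeriv i f b) ∧
      TendstoUniformlyOn F f atTop (ball b ρ) := by
  obtain ⟨U, O, φ, ψ, hc, hbU⟩ := exists_chart hX (hfX b hb)
  have hD' : ∀ᶠ z in 𝓝 b, z ∈ D := hD.mem_nhds hb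
  have hU' : ∀ᶠ z in 𝓝 b, f z ∈ U :=
    (hf.differentiableAt (hD.mem_nhds hb)).continuousAt.eventually_mem (hc.oU.mem_nhds hbU)
  have hp : ∀ᶠ z in 𝓝 b, DifferentiableAt ℂ (fun z => φ (f z)) z := by
    filter_upwards [hD', hU'] with z h1 h2
    exact DifferentiableAt.comp (g := φ) z (hc.dφ.differentiableAt (hc.oU.mem_nhds h2)) (hf.differentiableAt (hD.mem_nhds h1))
  have hne' : ∀ᶠ z in 𝓝[≠] b, dt (L.comp (fderiv ℂ ψ (φ (f z)))) ≠ 0 := by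
    filter_upwards [hne, eventually_nhdsWithin_of_eventually_nhds hD', eventually_nhdsWithin_of_eventually_nhds hU'] with z h1 h2 h3
    rwa [Ne, ← hc.bad_iff L (hfX z h2) h3]
  obtain ⟨N0, hN0⟩ := disc_map0 hc.oO hc.dψ hp (hc.mO _ (hfX b hb) hbU) L hne' k
  refine ⟨N0, fun N hN => ?_⟩
  obtain ⟨Xi, om, hXi⟩ := hN0 N hN
  have hall := hXi.and ((continuous_fst.tendsto ((b, 0) : ℂ × (Fin (min d M) → ℂ))).eventually (hD'.and hU'))
  obtain ⟨R, hR, hRs⟩ := Metric.eventually_nhds_iff_ball.1 hall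
  have hmem : ∀ z ∈ closedBall b (R/2), ∀ η ∈ closedBall (0 : Fin (min d M) → ℂ) (R/2), ((z, η) : ℂ × (Fin (min d M) → ℂ)) ∈ ball ((b, 0) : ℂ × (Fin (min d M) → ℂ)) R := by
    intro z hz η hη
    rw [mem_closedBall] at hz hη
    rw [mem_ball, Prod.dist_eq, max_lt_iff]
    constructor
    · show dist z b < R
      linarith
    · show dist η 0 < R
      linarith
  have h0 : (0 : Fin (min d M) → ℂ) ∈ closedBall (0 : Fin (min d M) → ℂ) (R/2) := by simp; positivity
  have hcl : closedBall b (R/2) ⊆ D := fun z hz => (hRs _ (hmem z hz 0 h0)).2.1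
  refine ⟨R/2, by positivity, ball_subset_closedBall.trans hcl, fun h hhd hh => ?_⟩
  have hψf : ∀ z ∈ closedBall b (R/2), ψ (φ (f z)) = f z := fun z hz => hc.ψφ _ (hfX z (hcl hz)) (hRs _ (hmem z hz 0 h0)).2.2
  have hLh : TendstoUniformlyOn (fun ν z => L (h ν z)) (fun _ => 0) atTop (closedBall b (R/2)) := by
    have h1 := (tendstoLocallyUniformlyOn_iff_forall_isCompact hD).1 hh _ hcl (isCompact_closedBall b (R/2))
    have := L.uniformContinuous.comp_tendstoUniformlyOn h1
    simpa [Function.comp_def] using this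
  refine ⟨fun ν z => Xi (z, L (h ν z)), ?_, ?_⟩
  · have hsm := (Metric.tendstoUniformlyOn_iff.1 hLh) (R/2) (by positivity)
    filter_upwards [hsm] with ν hν
    have hg : ∀ z ∈ closedBall b (R/2), ((z, L (h ν z)) : ℂ × (Fin (min d M) → ℂ)) ∈ ball ((b, 0) : ℂ × (Fin (min d M) → ℂ)) R := by
      intro z hz
      apply hmem z hz
      have := hν z hz
      rw [dist_zero_left] at this
      simpa using this.le
    have hin : ∀ z ∈ D, DifferentiableAt ℂ (fun z => ((z, L (h ν z)) : ℂ × (Fin (min d M) → ℂ))) z := by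
      intro z hz
      exact differentiableAt_id.prodMk (L.differentiableAt.comp z ((hhd ν).differentiableAt (hD.mem_nhds hz)))
    have hd1 : ∀ z ∈ closedBall b (R/2), DifferentiableAt ℂ (fun z => Xi (z, L (h ν z))) z := fun z hz =>
      DifferentiableAt.comp (g := Xi) z (hRs _ (hg z hz)).1.1 (hin z (hcl hz))
    refine ⟨fun z hz => (hd1 z (ball_subset_closedBall hz)).differentiableWithinAt, ?_, ?_⟩
    · intro z hz
      have hz' := ball_subset_closedBall hz
      obtain ⟨⟨-, -, ⟨s, hs, hs'⟩, h2, -⟩, -⟩ := hRs _ (hg z hz')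
      refine ⟨?_, ?_⟩
      · show Xi (z, L (h ν z)) ∈ X
        rw [← hs']; exact hc.mX _ hs
      · rw [h2, hψf z hz']
    · intro i hi
      have hbb : b ∈ ball b (R/2) := mem_ball_self (by positivity)
      have hd2 : DifferentiableOn ℂ (fun z => om (z, L (h ν z))) (ball b (R/2)) := fun z hz =>
        (DifferentiableAt.comp (g := om) z (hRs _ (hg z (ball_subset_closedBall hz))).1.2.1 (hin z (hcl (ball_subset_closedBall hz)))).differentiableWithinAt
      have heq : EqOn (fun z => Xi (z, L (h ν z))) (fun z => f z + (z - b) ^ (k+1) • om (z, L (h ν z))) (ball b (R/2)) := by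
        intro z hz
        have hz' := ball_subset_closedBall hz
        have := (hRs _ (hg z hz')).1.2.2.2.2.2
        show Xi (z, L (h ν z)) = _
        rw [this]
        show ψ (φ (f z)) + _ = _
        rw [hψf z hz']
      rw [iteratedDeriv_congr_open isOpen_ball heq i hbb]
      have c1 := holo_contDiffAt hD hf hb i
      have c2 : ContDiffAt ℂ i (fun z => (z - b) ^ (k+1) • om (z, L (h ν z))) b :=
        holo_contDiffAt isOpen_ball (DifferentiableOn.fun_smul (by fun_prop) hd2) hbb i
      rw [iteratedDeriv_fun_add c1 c2, jet_zero k i _ hi, add_zero]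
      filter_upwards [isOpen_ball.mem_nhds hbb] with z hz using hd2.differentiableAt (isOpen_ball.mem_nhds hz)
  · have hcont : ContinuousOn Xi (closedBall b (R/2) ×ˢ closedBall 0 (R/2)) := by
      rintro ⟨z, η⟩ ⟨hz, hη⟩
      exact (hRs _ (hmem z hz η hη)).1.1.continuousAt.continuousWithinAt
    have := unif_comp hcont (by positivity) hLh
    refine (this.congr_right ?_).mono ball_subset_closedBall
    intro z hz
    have h1 := (hRs _ (hmem z hz 0 h0)).1.2.2.2.2.1
    show Xi (z, 0) = f z
    exact h1.trans (hψf z hz)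

end Approx

namespace Approx
open MeasureTheory Topology
open scoped ContDiff Convolution Manifold NNReal

theorem unif_comp0 {E F : Type} [NormedAddCommGroup E] [NormedSpace ℂ E] [FiniteDimensional ℂ E] [NormedAddCommGroup F]
    {O : Set E} (hO : IsOpen O) {R : E → F} (hR : ContinuousOn R O) {S : Set ℂ} (hS : IsCompact S) {γ : ℕ → ℂ → E} {Γ : ℂ → E}
    (hΓ : ContinuousOn Γ S) (hΓO : ∀ z ∈ S, Γ z ∈ O) (h : TendstoUniformlyOn γ Γ atTop S) :
    (∀ᶠ ν in atTop, ∀ z ∈ S, γ ν z ∈ O) ∧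
    TendstoUniformlyOn (fun ν z => R (γ ν z)) (fun z => R (Γ z)) atTop S := by
  have : ProperSpace E := FiniteDimensional.proper ℂ E
  have hK := hS.image_of_continuousOn hΓ
  obtain ⟨δ, hδ, hδO⟩ := hK.exists_cthickening_subset_open hO (by rintro _ ⟨z, hz, rfl⟩; exact hΓO z hz)
  have hK2 : IsCompact (cthickening δ (Γ '' S)) := hK.cthickening
  have hu := hK2.uniformContinuousOn_of_continuous (hR.mono hδO)
  rw [Metric.uniformContinuousOn_iff] at hu
  rw [Metric.tendstoUniformlyOn_iff] at h ⊢
  have hmem : ∀ ν, (∀ z ∈ S, dist (Γ z) (γ ν z) < δ) → ∀ z ∈ S, γ ν z ∈ cthickening δ (Γ '' S) := by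
    intro ν hν z hz
    exact mem_cthickening_of_dist_le _ _ _ _ ⟨z, hz, rfl⟩ (by rw [dist_comm]; exact (hν z hz).le)
  constructor
  · filter_upwards [h δ hδ] with ν hν z hz
    exact hδO (hmem ν hν z hz)
  · intro ε hε
    obtain ⟨η, hη, hh⟩ := hu ε hε
    filter_upwards [h δ hδ, h η hη] with ν h1 h2 z hz
    exact hh _ (self_subset_cthickening _ ⟨z, hz, rfl⟩) _ (hmem ν h1 z hz) (h2 z hz)

theorem iteratedDeriv_prodMk {E F : Type} [NormedAddCommGroup E] [NormedSpace ℂ E] [NormedAddCommGroup F] [NormedSpace ℂ F]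
    [CompleteSpace E] [CompleteSpace F]
    {U : Set ℂ} (hU : IsOpen U) {a : ℂ → E} {c : ℂ → F} (ha : DifferentiableOn ℂ a U) (hc : DifferentiableOn ℂ c U) (j : ℕ) :
    EqOn (iteratedDeriv j (fun z => (a z, c z))) (fun z => (iteratedDeriv j a z, iteratedDeriv j c z)) U := by
  induction j with
  | zero => intro z _; simp
  | succ j ih =>
    intro z hz
    rw [iteratedDeriv_succ]
    have h1 := ((holo_iteratedDeriv hU ha j).differentiableAt (hU.mem_nhds hz)).hasDerivAt
    have h2 := ((holo_iteratedDeriv hU hc j).differentiableAt (hU.mem_nhds hz)).hasDerivAt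
    rw [(ih.eventuallyEq_of_mem (hU.mem_nhds hz)).deriv_eq, (h1.prodMk h2).deriv, iteratedDeriv_succ, iteratedDeriv_succ]

theorem comp_conv (i : ℕ) : ∀ {E F : Type} [NormedAddCommGroup E] [NormedSpace ℂ E] [FiniteDimensional ℂ E]
    [NormedAddCommGroup F] [NormedSpace ℂ F] [FiniteDimensional ℂ F] {O : Set E} (_ : IsOpen O) {R : E → F} (_ : DifferentiableOn ℂ R O)
    {S : Set ℂ} (_ : IsCompact S) {U : ℕ → Set ℂ} {γ : ℕ → ℂ → E} (_ : ∀ ν, IsOpen (U ν) ∧ S ⊆ U ν ∧ DifferentiableOn ℂ (γ ν) (U ν))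
    {Γ : ℕ → ℂ → E} (_ : ∀ j ≤ i, ContinuousOn (Γ j) S ∧ TendstoUniformlyOn (fun ν => iteratedDeriv j (γ ν)) (Γ j) atTop S)
    (_ : ∀ z ∈ S, Γ 0 z ∈ O),
    ∃ G : ℂ → F, ContinuousOn G S ∧ TendstoUniformlyOn (fun ν => iteratedDeriv i (fun z => R (γ ν z))) G atTop S := by
  induction i with
  | zero =>
    intro E F _ _ _ _ _ _ O hO R hR S hS U γ hγ Γ hΓ hΓO
    have h0 := hΓ 0 le_rfl
    simp only [iteratedDeriv_zero] at h0 ⊢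
    exact ⟨_, hR.continuousOn.comp h0.1 hΓO, (unif_comp0 hO hR.continuousOn hS h0.1 hΓO h0.2).2⟩
  | succ i ih =>
    intro E F _ _ _ _ _ _ O hO R hR S hS U γ hγ Γ hΓ hΓO
    have : CompleteSpace E := FiniteDimensional.complete ℂ E
    have : CompleteSpace F := FiniteDimensional.complete ℂ F
    have hR1 := osgood_fderiv hO hR
    have hR1' : DifferentiableOn ℂ (fun y : E × E => fderiv ℂ R y.1 y.2) (O ×ˢ univ) := by
      have : DifferentiableOn ℂ (fun y : E × E => fderiv ℂ R y.1) (O ×ˢ univ) :=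
        hR1.comp differentiableOn_fst (fun y hy => hy.1)
      exact this.clm_apply differentiableOn_snd
    have hdγ : ∀ ν, DifferentiableOn ℂ (deriv (γ ν)) (U ν) := fun ν => (hγ ν).2.2.deriv (hγ ν).1
    obtain ⟨G, hG, hGt⟩ := ih (hO.prod isOpen_univ) hR1' hS (U := U) (γ := fun ν z => (γ ν z, deriv (γ ν) z)) (Γ := fun j z => (Γ j z, Γ (j+1) z))
      (fun ν => ⟨(hγ ν).1, (hγ ν).2.1, (hγ ν).2.2.prodMk (hdγ ν)⟩)
      (by
        intro j hj
        have h1 := hΓ j (by omega)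
        have h2 := hΓ (j+1) (by omega)
        refine ⟨h1.1.prodMk h2.1, ?_⟩
        have h3 : TendstoUniformlyOn (fun ν z => (iteratedDeriv j (γ ν) z, iteratedDeriv (j+1) (γ ν) z)) (fun z => (Γ j z, Γ (j+1) z)) atTop S := by
          have a1 := Metric.tendstoUniformlyOn_iff.1 h1.2
          have a2 := Metric.tendstoUniformlyOn_iff.1 h2.2
          rw [Metric.tendstoUniformlyOn_iff]
          intro ε hε
          filter_upwards [a1 ε hε, a2 ε hε] with ν b1 b2 z hz
          rw [Prod.dist_eq, max_lt_iff]
          exact ⟨b1 z hz, b2 z hz⟩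
        refine h3.congr (Eventually.of_forall fun ν z hz => ?_)
        have := iteratedDeriv_prodMk (hγ ν).1 (hγ ν).2.2 (hdγ ν) j ((hγ ν).2.1 hz)
        rw [this, ← iteratedDeriv_succ'])
      (fun z hz => ⟨hΓO z hz, mem_univ _⟩)
    refine ⟨G, hG, hGt.congr ?_⟩
    have h0 := hΓ 0 (by omega)
    simp only [iteratedDeriv_zero] at h0
    filter_upwards [(unif_comp0 hO hR.continuousOn hS h0.1 hΓO h0.2).1] with ν hν z hz
    have hop : IsOpen (U ν ∩ γ ν ⁻¹' O) := (hγ ν).2.2.continuousOn.isOpen_inter_preimage (hγ ν).1 hO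
    show _ = iteratedDeriv (i+1) (fun z => R (γ ν z)) z
    rw [iteratedDeriv_succ']
    apply iteratedDeriv_congr_open hop ?_ i ⟨(hγ ν).2.1 hz, hν z hz⟩
    intro w hw
    have b1 := ((hγ ν).2.2.differentiableAt ((hγ ν).1.mem_nhds hw.1)).hasDerivAt
    have b2 := (hR.differentiableAt (hO.mem_nhds hw.2)).hasFDerivAt
    exact (b2.comp_hasDerivAt w b1).deriv.symm

theorem deriv_conv {E : Type} [NormedAddCommGroup E] [NormedSpace ℂ E] [CompleteSpace E] {Ω : Set ℂ} (hΩ : IsOpen Ω)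
    {γ : ℕ → ℂ → E} {f : ℂ → E} (h : TendstoLocallyUniformlyOn γ f atTop Ω) (hγ : ∀ᶠ ν in atTop, DifferentiableOn ℂ (γ ν) Ω) (i : ℕ) :
    TendstoLocallyUniformlyOn (fun ν => iteratedDeriv i (γ ν)) (iteratedDeriv i f) atTop Ω := by
  induction i with
  | zero => simpa using h
  | succ i ih =>
    have := ih.deriv (by filter_upwards [hγ] with ν hν using holo_iteratedDeriv hΩ hν i) hΩ
    simp only [iteratedDeriv_succ]
    exact this

end Approx

namespace Approx
open MeasureTheory Topology
open scoped ContDiff Convolution Manifold NNReal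

/-- Local section data for `L` over `X`. -/
structure Sec {M e : ℕ} (X : Set (Cn M)) (L : Cn M →L[ℂ] (Fin e → ℂ)) (W : Set (Cn M)) (O' : Set (Fin e → ℂ))
    (R : (Fin e → ℂ) → Cn M) : Prop where
  oW : IsOpen W
  oO : IsOpen O'
  dR : DifferentiableOn ℂ R O'
  mX : ∀ v ∈ O', R v ∈ X
  LR : ∀ v ∈ O', L (R v) = v
  mO : ∀ w ∈ X, w ∈ W → L w ∈ O'
  RL : ∀ w ∈ X, w ∈ W → R (L w) = w

theorem local_sec {M d : ℕ} {X : Set (Cn M)} (hX : ClosedComplexSubmanifold M d X)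
    (L : Cn M →L[ℂ] (Fin (min d M) → ℂ)) {y : Cn M} (hy : y ∈ X) (hb : ¬ BadPt X L y) :
    ∃ W O' R, Sec X L W O' R ∧ y ∈ W := by
  obtain ⟨U, O, φ, ψ, hc, hyU⟩ := exists_chart hX hy
  rw [hc.bad_iff L hy hyU, dt_eq_zero] at hb
  have hinj : Function.Injective (L.comp (fderiv ℂ ψ (φ y))) := by
    rw [injective_iff_map_eq_zero]
    intro s hs
    by_contra hne
    exact hb ⟨s, hne, hs⟩
  let I0 := LinearEquiv.ofInjectiveEndo (L.comp (fderiv ℂ ψ (φ y)) : (Fin (min d M) → ℂ) →ₗ[ℂ] (Fin (min d M) → ℂ)) hinj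
  let I : (Fin (min d M) → ℂ) ≃L[ℂ] (Fin (min d M) → ℂ) := I0.toContinuousLinearEquiv
  have hφy := hc.mO y hy hyU
  have hI : HasFDerivAt (fun s => L (ψ s)) (I : (Fin (min d M) → ℂ) →L[ℂ] (Fin (min d M) → ℂ)) (φ y) := by
    have h1 := L.hasFDerivAt.comp (φ y) (hc.dψ.differentiableAt (hc.oO.mem_nhds hφy)).hasFDerivAt
    refine h1.congr_fderiv ?_
    ext1 s
    rfl
  have hG : ∀ᶠ s in 𝓝 (φ y), DifferentiableAt ℂ (fun s => L (ψ s)) s ∧ s ∈ O := by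
    filter_upwards [hc.oO.mem_nhds hφy] with s hs
    exact ⟨L.differentiableAt.comp s (hc.dψ.differentiableAt (hc.oO.mem_nhds hs)), hs⟩
  obtain ⟨S, O', Λ, hS, hyS, hSP, hO', hyO', hΛ, hΛS, hGS, hΛG, hGΛ⟩ := inv_fun hG I hI
  refine ⟨U ∩ φ ⁻¹' S, O', fun v => ψ (Λ v), ⟨hc.dφ.continuousOn.isOpen_inter_preimage hc.oU hS, hO', ?_, ?_, hGΛ, ?_, ?_⟩, hyU, hyS⟩
  · exact hc.dψ.comp hΛ (fun v hv => (hSP _ (hΛS hv)).2)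
  · exact fun v hv => hc.mX _ (hSP _ (hΛS hv)).2
  · intro w hw hwW
    have := hGS hwW.2
    simpa only [hc.ψφ w hw hwW.1] using this
  · intro w hw hwW
    have := hΛG _ hwW.2
    rw [hc.ψφ w hw hwW.1] at this
    show ψ (Λ (L w)) = w
    rw [this, hc.ψφ w hw hwW.1]

theorem unif_sec {M d : ℕ} {X : Set (Cn M)} (hX : ClosedComplexSubmanifold M d X)
    (L : Cn M →L[ℂ] (Fin (min d M) → ℂ)) {K : Set (Cn M)} (hK : IsCompact K) (hKX : ∀ y ∈ K, y ∈ X) (hb : ∀ y ∈ K, ¬ BadPt X L y) :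
    ∃ ε > 0, ∃ δ > 0, δ ≤ ε / 4 ∧ (∀ y ∈ K, ∀ w ∈ X, ∀ w' ∈ X, dist w y < ε → dist w' y < ε → L w = L w' → w = w') ∧
      ∀ y ∈ K, ∃ O' R, IsOpen O' ∧ DifferentiableOn ℂ R O' ∧ (∀ v ∈ O', R v ∈ X ∧ L (R v) = v) ∧
        ∀ y' ∈ ball y δ, L y' ∈ O' ∧ dist (R (L y')) y' < ε / 4 := by
  have hsec : ∀ y : K, ∃ W O' R, Sec X L W O' R ∧ (y : Cn M) ∈ W := fun y => local_sec hX L (hKX y y.2) (hb y y.2)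
  choose W O' R hR hyW using hsec
  obtain ⟨ε, hε, hεW⟩ := lebesgue_number_lemma_of_metric hK (fun y => (hR y).oW) (fun y hy => mem_iUnion.2 ⟨⟨y, hy⟩, hyW ⟨y, hy⟩⟩)
  let W' : K → Set (Cn M) := fun y => (L ⁻¹' O' y) ∩ (fun y' => dist (R y (L y')) y') ⁻¹' Iio (ε / 4)
  have hW' : ∀ y, IsOpen (W' y) := by
    intro y
    have h1 : IsOpen (L ⁻¹' O' y) := (hR y).oO.preimage L.continuous
    have h2 : ContinuousOn (fun y' => R y (L y')) (L ⁻¹' O' y) := (hR y).dR.continuousOn.comp L.continuous.continuousOn (fun y hy => hy)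
    have h3 : ContinuousOn (fun y' => dist (R y (L y')) y') (L ⁻¹' O' y) := continuous_dist.comp_continuousOn (h2.prodMk continuousOn_id)
    exact h3.isOpen_inter_preimage h1 isOpen_Iio
  obtain ⟨δ, hδ, hδW⟩ := lebesgue_number_lemma_of_metric hK hW' (fun y hy => mem_iUnion.2 ⟨⟨y, hy⟩, ⟨(hR ⟨y, hy⟩).mO y (hKX y hy) (hyW ⟨y, hy⟩), by
    show dist (R ⟨y, hy⟩ (L y)) y < ε / 4
    rw [(hR ⟨y, hy⟩).RL y (hKX y hy) (hyW ⟨y, hy⟩), dist_self]; positivity⟩⟩)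
  refine ⟨ε, hε, min δ (ε/4), by positivity, min_le_right _ _, ?_, ?_⟩
  · intro y hy w hw w' hw' h1 h2 h
    obtain ⟨i, hi⟩ := hεW y hy
    rw [← (hR i).RL w hw (hi h1), ← (hR i).RL w' hw' (hi h2), h]
  · intro y hy
    obtain ⟨i, hi⟩ := hδW y hy
    refine ⟨O' i, R i, (hR i).oO, (hR i).dR, fun v hv => ⟨(hR i).mX v hv, (hR i).LR v hv⟩, fun y' hy' => ?_⟩
    exact hi (ball_subset_ball (min_le_left _ _) hy')

end Approx

namespace Approx
open MeasureTheory Topology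
open scoped ContDiff Convolution Manifold NNReal

theorem glue {M d r : ℕ} {X : Set (Cn M)} (hX : ClosedComplexSubmanifold M d X)
    {D : Set ℂ} (hD : IsOpen D) (hDb : Bornology.IsBounded D) {f : ℂ → Cn M} (hf : ClassA r D f) (hfX : ∀ z ∈ closure D, f z ∈ X)
    (L : Cn M →L[ℂ] (Fin (min d M) → ℂ)) (B : Finset ℂ) {ρ : ℝ} (hρ : 0 < ρ)
    {U : ℕ → Set ℂ} {g : ℕ → ℂ → Cn M} (hg : Apx r D f U g) (Fb : ℂ → ℕ → ℂ → Cn M)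
    (hB : ∀ b ∈ B, ball b ρ ⊆ D) (hdisj : ∀ b ∈ B, ∀ b' ∈ B, ∀ z, z ∈ ball b ρ → z ∈ ball b' ρ → b = b')
    (hF : ∀ b ∈ B, ∀ᶠ ν in atTop, DifferentiableOn ℂ (Fb b ν) (ball b ρ) ∧ ∀ z ∈ ball b ρ, Fb b ν z ∈ X ∧ L (Fb b ν z) = L (g ν z))
    (hFt : ∀ b ∈ B, TendstoUniformlyOn (Fb b) f atTop (ball b ρ))
    (hbad : ∀ z ∈ closure D, BadPt X L (f z) → z ∈ B) :
    ∃ (U' : ℕ → Set ℂ) (fs : ℕ → ℂ → Cn M),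
      (∀ᶠ ν in atTop, IsOpen (U' ν) ∧ closure D ⊆ U' ν ∧ DifferentiableOn ℂ (fs ν) (U' ν) ∧ ∀ z ∈ U' ν, fs ν z ∈ X) ∧
      (∀ ν, ∀ b ∈ B, EqOn (fs ν) (Fb b ν) (ball b ρ)) ∧
      ∀ i ≤ r, ∃ F : ℂ → Cn M, ContinuousOn F (closure D) ∧ EqOn F (iteratedDeriv i f) D ∧
        TendstoUniformlyOn (fun ν => iteratedDeriv i (fs ν)) F atTop (closure D) := by
  have hcD : IsCompact (closure D) := hDb.isCompact_closure
  obtain ⟨hgU, hgc⟩ := hg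
  have hΓ0 : ∀ j, ∃ Fj : ℂ → Cn M, j ≤ r → ContinuousOn Fj (closure D) ∧ EqOn Fj (iteratedDeriv j f) D ∧ TendstoUniformlyOn (fun ν => iteratedDeriv j (g ν)) Fj atTop (closure D) := by
    intro j
    by_cases hj : j ≤ r
    · obtain ⟨Fj, h⟩ := hgc j hj
      exact ⟨Fj, fun _ => h⟩
    · exact ⟨0, fun h => absurd h hj⟩
  choose Γ hΓ using hΓ0
  have hΓf : EqOn (Γ 0) f (closure D) := by
    have h1 := hΓ 0 (Nat.zero_le r)
    refine EqOn.of_subset_closure ?_ h1.1 hf.1 subset_closure le_rfl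
    simpa using h1.2.1
  have hgt : TendstoUniformlyOn g f atTop (closure D) := by
    have h1 := (hΓ 0 (Nat.zero_le r)).2.2
    simp only [iteratedDeriv_zero] at h1
    exact h1.congr_right hΓf
  let K : Set ℂ := closure D \ ⋃ b ∈ B, ball b ρ
  have hK : IsCompact K := hcD.diff (isOpen_biUnion fun _ _ => isOpen_ball)
  have hKc : K ⊆ closure D := diff_subset
  have hKB : ∀ z ∈ K, z ∉ B := by
    intro z hz hzB
    exact hz.2 (mem_biUnion (x := z) hzB (mem_ball_self hρ))
  obtain ⟨ε, hε, δ, hδ, hδε, hinj, hsec⟩ := unif_sec hX L (hK.image_of_continuousOn (hf.1.mono hKc))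
    (by rintro _ ⟨z, hz, rfl⟩; exact hfX z (hKc hz)) (by rintro _ ⟨z, hz, rfl⟩ h; exact hKB z hz (hbad z (hKc hz) h))
  let P : ℕ → ℂ → Cn M → Prop := fun ν z w => w ∈ X ∧ L w = L (g ν z) ∧ dist w (g ν z) < ε / 2
  classical
  let fs : ℕ → ℂ → Cn M := fun ν z => if h : ∃ b ∈ B, z ∈ ball b ρ then Fb h.choose ν z else Classical.epsilon (P ν z)
  have hfsB : ∀ ν, ∀ b ∈ B, EqOn (fs ν) (Fb b ν) (ball b ρ) := by
    intro ν b hb z hz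
    have h : ∃ b ∈ B, z ∈ ball b ρ := ⟨b, hb, hz⟩
    have h1 : fs ν z = Fb h.choose ν z := dif_pos h
    rw [h1, hdisj _ h.choose_spec.1 b hb z h.choose_spec.2 hz]
  let Good : ℕ → Prop := fun ν => (∀ z ∈ closure D, dist (f z) (g ν z) < δ / 2) ∧ ∀ b ∈ B,
    (DifferentiableOn ℂ (Fb b ν) (ball b ρ) ∧ ∀ z ∈ ball b ρ, Fb b ν z ∈ X ∧ L (Fb b ν z) = L (g ν z)) ∧ ∀ z ∈ ball b ρ, dist (f z) (Fb b ν z) < ε / 4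
  have hGood : ∀ᶠ ν in atTop, Good ν := by
    refine (Metric.tendstoUniformlyOn_iff.1 hgt (δ/2) (by positivity)).and ?_
    rw [Filter.eventually_all_finset]
    intro b hb
    exact (hF b hb).and (Metric.tendstoUniformlyOn_iff.1 (hFt b hb) (ε/4) (by positivity))
  -- the local formula
  have huniq : ∀ ν, ∀ z0 ∈ K, ∀ z, g ν z ∈ ball (f z0) δ → ∀ w w', P ν z w → P ν z w' → w = w' := by
    intro ν z0 hz0 z hz w w' h1 h2
    rw [mem_ball] at hz
    refine hinj _ ⟨z0, hz0, rfl⟩ w h1.1 w' h2.1 ?_ ?_ (h1.2.1.trans h2.2.1.symm)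
    · linarith [dist_triangle w (g ν z) (f z0), h1.2.2]
    · linarith [dist_triangle w' (g ν z) (f z0), h2.2.2]
  have key : ∀ ν, Good ν → ∀ z0 ∈ K, ∀ z, g ν z ∈ ball (f z0) δ → ∀ w, P ν z w → fs ν z = w := by
    intro ν hν z0 hz0 z hz w hw
    refine huniq ν z0 hz0 z hz _ _ ?_ hw
    by_cases h : ∃ b ∈ B, z ∈ ball b ρ
    · obtain ⟨b, hb, hzb⟩ := h
      rw [hfsB ν b hb hzb]
      obtain ⟨⟨-, h1⟩, h2⟩ := hν.2 b hb
      refine ⟨(h1 z hzb).1, (h1 z hzb).2, ?_⟩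
      have h3 := h2 z hzb
      have h4 := hν.1 z (subset_closure (hB b hb hzb))
      rw [dist_comm] at h3
      linarith [dist_triangle (Fb b ν z) (f z) (g ν z)]
    · have h1 : fs ν z = Classical.epsilon (P ν z) := dif_neg h
      rw [h1]
      exact Classical.epsilon_spec (p := P ν z) ⟨w, hw⟩
  have hTo : ∀ ν, ∀ z0, IsOpen (U ν ∩ g ν ⁻¹' ball (f z0) δ) := fun ν z0 =>
    (hgU ν).2.2.continuousOn.isOpen_inter_preimage (hgU ν).1 isOpen_ball
  have key2 : ∀ z0 ∈ K, ∃ O' R, IsOpen O' ∧ DifferentiableOn ℂ R O' ∧ (∀ v ∈ O', R v ∈ X ∧ L (R v) = v) ∧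
      (∀ y' ∈ ball (f z0) δ, L y' ∈ O' ∧ dist (R (L y')) y' < ε / 4) ∧
      ∀ ν, Good ν → EqOn (fs ν) (fun z => R (L (g ν z))) (U ν ∩ g ν ⁻¹' ball (f z0) δ) := by
    intro z0 hz0
    obtain ⟨O', R, h1, h2, h3, h4⟩ := hsec _ ⟨z0, hz0, rfl⟩
    refine ⟨O', R, h1, h2, h3, h4, fun ν hν z hz => key ν hν z0 hz0 z hz.2 _ ?_⟩
    obtain ⟨a1, a2⟩ := h4 _ hz.2
    exact ⟨(h3 _ a1).1, (h3 _ a1).2, by linarith⟩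
  have hloc : ∀ ν, Good ν → ∀ z0 ∈ K, DifferentiableOn ℂ (fs ν) (U ν ∩ g ν ⁻¹' ball (f z0) δ) ∧ ∀ z ∈ U ν ∩ g ν ⁻¹' ball (f z0) δ, fs ν z ∈ X := by
    intro ν hν z0 hz0
    obtain ⟨O', R, h1, h2, h3, h4, h5⟩ := key2 z0 hz0
    have h5 := h5 ν hν
    constructor
    · refine DifferentiableOn.congr ?_ h5
      exact h2.comp (L.differentiable.comp_differentiableOn ((hgU ν).2.2.mono inter_subset_left)) (fun z hz => (h4 _ hz.2).1)
    · intro z hz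
      rw [h5 hz]
      exact (h3 _ (h4 _ hz.2).1).1
  refine ⟨fun ν => (⋃ b ∈ B, ball b ρ) ∪ ⋃ z0 ∈ K, (U ν ∩ g ν ⁻¹' ball (f z0) δ), fs, ?_, hfsB, ?_⟩
  · filter_upwards [hGood] with ν hν
    have hpt : ∀ z ∈ (⋃ b ∈ B, ball b ρ) ∪ ⋃ z0 ∈ K, (U ν ∩ g ν ⁻¹' ball (f z0) δ), DifferentiableAt ℂ (fs ν) z ∧ fs ν z ∈ X := by
      rintro z (hz | hz)
      · simp only [mem_iUnion] at hz
        obtain ⟨b, hb, hzb⟩ := hz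
        have h1 := (hν.2 b hb).1
        refine ⟨?_, ?_⟩
        · exact (h1.1.congr (hfsB ν b hb)).differentiableAt (isOpen_ball.mem_nhds hzb)
        · rw [hfsB ν b hb hzb]; exact (h1.2 z hzb).1
      · simp only [mem_iUnion] at hz
        obtain ⟨z0, hz0, hz⟩ := hz
        exact ⟨(hloc ν hν z0 hz0).1.differentiableAt ((hTo ν z0).mem_nhds hz), (hloc ν hν z0 hz0).2 z hz⟩
    refine ⟨(isOpen_biUnion fun _ _ => isOpen_ball).union (isOpen_biUnion fun z0 _ => hTo ν z0), ?_,
      fun z hz => (hpt z hz).1.differentiableWithinAt, fun z hz => (hpt z hz).2⟩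
    intro z hz
    by_cases hzB : z ∈ ⋃ b ∈ B, ball b ρ
    · exact Or.inl hzB
    · right
      refine mem_biUnion (x := z) ⟨hz, hzB⟩ ⟨(hgU ν).2.1 hz, ?_⟩
      have := hν.1 z hz
      rw [dist_comm] at this
      show dist (g ν z) (f z) < δ
      linarith
  · intro i hi
    obtain ⟨F, hFc, hFD⟩ := hf.2.2 i hi
    refine ⟨F, hFc, hFD, ?_⟩
    rw [← tendstoLocallyUniformlyOn_iff_tendstoUniformlyOn_of_compact hcD]
    have hpt : ∀ z0 ∈ closure D, ∃ t ∈ 𝓝[closure D] z0, TendstoUniformlyOn (fun ν => iteratedDeriv i (fs ν)) F atTop t := by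
      intro z0 hz0
      by_cases hzB : z0 ∈ ⋃ b ∈ B, ball b ρ
      · simp only [mem_iUnion] at hzB
        obtain ⟨b, hb, hzb⟩ := hzB
        have h1 := deriv_conv isOpen_ball (hFt b hb).tendstoLocallyUniformlyOn ((hF b hb).mono fun ν h => h.1) i
        obtain ⟨s, hs, hsb⟩ := Metric.nhds_basis_closedBall.mem_iff.1 (isOpen_ball.mem_nhds hzb)
        have h2 := (tendstoLocallyUniformlyOn_iff_forall_isCompact isOpen_ball).1 h1 _ hsb (isCompact_closedBall z0 s)
        refine ⟨closedBall z0 s, mem_nhdsWithin_of_mem_nhds (closedBall_mem_nhds z0 hs), ?_⟩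
        refine (h2.congr (Eventually.of_forall fun ν z hz => ?_)).congr_right ?_
        · exact (iteratedDeriv_congr_open isOpen_ball (hfsB ν b hb) i (hsb hz)).symm
        · intro z hz
          exact (hFD (hB b hb (hsb hz))).symm
      · have hz0K : z0 ∈ K := ⟨hz0, hzB⟩
        obtain ⟨O', R, h1, h2, h3, h4, h5⟩ := key2 z0 hz0K
        have hcont : ∀ᶠ z in 𝓝[closure D] z0, dist (f z) (f z0) < δ / 2 :=
          (hf.1 z0 hz0).eventually (ball_mem_nhds (f z0) (half_pos hδ))
        rw [eventually_nhdsWithin_iff] at hcont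
        obtain ⟨s, hs, hsb⟩ := Metric.nhds_basis_closedBall.mem_iff.1 hcont
        let S : Set ℂ := closure D ∩ closedBall z0 s
        have hS : IsCompact S := hcD.inter_right isClosed_closedBall
        have hSc : S ⊆ closure D := inter_subset_left
        have hSf : ∀ z ∈ S, dist (f z) (f z0) < δ / 2 := fun z hz => hsb hz.2 hz.1
        have hSb : ∀ z ∈ S, f z ∈ ball (f z0) δ := fun z hz => by
          have := hSf z hz
          rw [mem_ball]; linarith
        have hST : ∀ ν, Good ν → S ⊆ U ν ∩ g ν ⁻¹' ball (f z0) δ := by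
          intro ν hν z hz
          refine ⟨(hgU ν).2.1 hz.1, ?_⟩
          have a1 := hν.1 z hz.1
          have a2 := hSf z hz
          rw [dist_comm] at a1
          show dist (g ν z) (f z0) < δ
          linarith [dist_triangle (g ν z) (f z) (f z0)]
        have hLO : IsOpen (L ⁻¹' O') := h1.preimage L.continuous
        have hRL : DifferentiableOn ℂ (fun y => R (L y)) (L ⁻¹' O') := h2.comp L.differentiable.differentiableOn (fun y hy => hy)
        have hRf : ∀ z ∈ S, R (L (f z)) = f z := by
          intro z hz
          obtain ⟨a1, a2⟩ := h4 _ (hSb z hz)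
          have a3 := hSf z hz
          refine hinj _ ⟨z0, hz0K, rfl⟩ _ (h3 _ a1).1 _ (hfX z hz.1) ?_ (by linarith) (h3 _ a1).2
          linarith [dist_triangle (R (L (f z))) (f z) (f z0)]
        obtain ⟨G, hGc, hGt⟩ := comp_conv i hLO hRL hS (U := U) (γ := g) (Γ := Γ)
          (fun ν => ⟨(hgU ν).1, hSc.trans (hgU ν).2.1, (hgU ν).2.2⟩)
          (fun j hj => ⟨(hΓ j (hj.trans hi)).1.mono hSc, (hΓ j (hj.trans hi)).2.2.mono hSc⟩)
          (fun z hz => by rw [hΓf hz.1]; exact (h4 _ (hSb z hz)).1)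
        have hGt' : TendstoUniformlyOn (fun ν => iteratedDeriv i (fs ν)) G atTop S := by
          refine hGt.congr ?_
          filter_upwards [hGood] with ν hν z hz
          exact (iteratedDeriv_congr_open (hTo ν z0) (h5 ν hν) i (hST ν hν hz)).symm
        have hfst : TendstoUniformlyOn fs f atTop S := by
          have a1 := (unif_comp0 hLO hRL.continuousOn hS (hf.1.mono hSc) (fun z hz => (h4 _ (hSb z hz)).1) (hgt.mono hSc)).2
          refine (a1.congr ?_).congr_right hRf
          filter_upwards [hGood] with ν hν z hz
          exact (h5 ν hν (hST ν hν hz)).symm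
        have hΩ : IsOpen (ball z0 s ∩ D) := isOpen_ball.inter hD
        have hΩS : ball z0 s ∩ D ⊆ S := fun z hz => ⟨subset_closure hz.2, ball_subset_closedBall hz.1⟩
        have hder := deriv_conv hΩ (hfst.mono hΩS).tendstoLocallyUniformlyOn
          (by filter_upwards [hGood] with ν hν using (hloc ν hν z0 hz0K).1.mono (hΩS.trans (hST ν hν))) i
        have hGF : EqOn G F (ball z0 s ∩ D) := by
          intro z hz
          rw [hFD hz.2]
          exact tendsto_nhds_unique (hGt'.tendsto_at (hΩS hz)) (hder.tendsto_at hz)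
        have htS : ball z0 s ∩ closure D ⊆ S := fun z hz => ⟨hz.2, ball_subset_closedBall hz.1⟩
        have hGF' : EqOn G F (ball z0 s ∩ closure D) :=
          hGF.of_subset_closure (hGc.mono htS) (hFc.mono inter_subset_right) (inter_subset_inter_right _ subset_closure) isOpen_ball.inter_closure
        exact ⟨ball z0 s ∩ closure D, inter_mem (mem_nhdsWithin_of_mem_nhds (ball_mem_nhds z0 hs)) self_mem_nhdsWithin, (hGt'.mono htS).congr_right hGF'⟩
    intro u hu z0 hz0
    obtain ⟨t, ht, h⟩ := hpt z0 hz0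
    exact ⟨t, ht, h u hu⟩

end Approx

namespace Approx
open MeasureTheory Topology
open scoped ContDiff Convolution Manifold NNReal

theorem main_aux
    (M d : ℕ) (r : ℕ) (hr : 2 ≤ r)
    (D : Set ℂ) (hDopen : IsOpen D) (hDbdd : Bornology.IsBounded D)
    (hDconn : IsConnected D) (hDsb : SmoothlyBounded D)
    (X : Set (Cn M)) (hX : ClosedComplexSubmanifold M d X)
    (f : ℂ → Cn M) (hf : ClassA r D f) (hfX : ∀ z ∈ closure D, f z ∈ X)
    (l : ℕ) (zs : Fin l → ℂ) (hzs : ∀ j, zs j ∈ D) (k : ℕ) :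
    ∃ (U : ℕ → Set ℂ) (fs : ℕ → ℂ → Cn M),
      (∀ ν, IsOpen (U ν) ∧ closure D ⊆ U ν) ∧
      (∀ ν, DifferentiableOn ℂ (fs ν) (U ν)) ∧
      (∀ ν, ∀ z ∈ U ν, fs ν z ∈ X) ∧
      (∀ ν, ∀ j : Fin l, ∀ i ≤ k, iteratedDeriv i (fs ν) (zs j) = iteratedDeriv i f (zs j)) ∧
      ∀ i ≤ r, ∃ F : ℂ → Cn M,
        ContinuousOn F (closure D) ∧ EqOn F (iteratedDeriv i f) D ∧
        TendstoUniformlyOn (fun ν => iteratedDeriv i (fs ν)) F atTop (closure D) := by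
  classical
  obtain ⟨L, B0, hB0, hbad⟩ := exists_proj (by omega : 1 ≤ r) hDopen hDbdd hDconn hDsb hX hf hfX
  let B : Finset ℂ := B0 ∪ Finset.image zs Finset.univ
  have hB : ∀ b ∈ B, b ∈ D := by
    intro b hb
    rcases Finset.mem_union.1 hb with h | h
    · exact hB0 b h
    · obtain ⟨j, -, rfl⟩ := Finset.mem_image.1 h
      exact hzs j
  have hne : ∀ b ∈ B, ∀ᶠ z in 𝓝[≠] b, ¬ BadPt X L (f z) := by
    intro b hb
    have h1 : ∀ᶠ z in 𝓝 b, z ∉ (B0.erase b : Set ℂ) :=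
      (B0.erase b).finite_toSet.isClosed.isOpen_compl.mem_nhds (by simp)
    filter_upwards [eventually_nhdsWithin_of_eventually_nhds h1, self_mem_nhdsWithin,
      eventually_nhdsWithin_of_eventually_nhds (hDopen.mem_nhds (hB b hb))] with z a1 a2 a3 a4
    exact a1 (Finset.mem_coe.2 (Finset.mem_erase.2 ⟨a2, hbad z (subset_closure a3) a4⟩))
  have hds : ∀ b : B, _ := fun b => disc_solve hX hDopen hf.2.1 (fun z hz => hfX z (subset_closure hz)) (hB b b.2) L (hne b b.2) k
  choose N0 hN0 using hds
  let N := Finset.univ.sup N0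
  have hN : ∀ b : B, N ≥ N0 b := fun b => Finset.le_sup (f := N0) (Finset.mem_univ b)
  have hds2 : ∀ b : B, _ := fun b => hN0 b N (hN b)
  choose ρ hρ hρD hsol using hds2
  obtain ⟨U, g, hg, hh⟩ := exists_interp (by omega : 1 ≤ r) hDopen hDbdd hDsb hf B hB N
  have hh2 : ∀ b : B, _ := fun b => hh b b.2
  choose h hhd hgh hht using hh2
  have hsol2 : ∀ b : B, _ := fun b => hsol b (h b) (hhd b) (hht b)
  choose Fb hFb hFbt using hsol2
  -- a common radius
  have hrad : ∀ᶠ s in 𝓝[>] (0:ℝ), (∀ b : B, s < ρ b) ∧ ∀ b b' : B, b ≠ b' → 2 * s < dist (b:ℂ) b' := by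
    refine (eventually_all.2 fun b => ?_).and (eventually_all.2 fun b => eventually_all.2 fun b' => ?_)
    · exact eventually_nhdsWithin_of_eventually_nhds (Iio_mem_nhds (hρ b))
    · by_cases hbb : b = b'
      · exact Eventually.of_forall fun s hs => absurd hbb hs
      · have hpos : 0 < dist (b:ℂ) b' := dist_pos.2 (fun e => hbb (Subtype.ext e))
        filter_upwards [eventually_nhdsWithin_of_eventually_nhds (Iio_mem_nhds (half_pos hpos))] with s hs _
        have : s < dist (b:ℂ) b' / 2 := hs
        linarith
  obtain ⟨s, ⟨hs1, hs2⟩, hs0⟩ := (hrad.and self_mem_nhdsWithin).exists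
  have hs0 : 0 < s := hs0
  have hsb : ∀ b : B, ball (b:ℂ) s ⊆ ball (b:ℂ) (ρ b) := fun b => ball_subset_ball (hs1 b).le
  let Fb' : ℂ → ℕ → ℂ → Cn M := fun b => if hb : b ∈ B then Fb ⟨b, hb⟩ else fun _ _ => 0
  have hFb' : ∀ b (hb : b ∈ B), Fb' b = Fb ⟨b, hb⟩ := fun b hb => dif_pos hb
  obtain ⟨U', fs, hU', hfsB, hconv⟩ := glue hX hDopen hDbdd hf hfX L B hs0 hg Fb'
    (fun b hb => (hsb ⟨b, hb⟩).trans (hρD ⟨b, hb⟩))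
    (by
      intro b hb b' hb' z hz hz'
      by_contra hbb
      have h1 := hs2 ⟨b, hb⟩ ⟨b', hb'⟩ (fun e => hbb (congrArg Subtype.val e))
      rw [mem_ball] at hz hz'
      have h2 := dist_triangle_left b b' z
      simp only at h1
      linarith)
    (by
      intro b hb
      rw [hFb' b hb]
      filter_upwards [hFb ⟨b, hb⟩] with ν hν
      refine ⟨hν.1.mono (hsb ⟨b, hb⟩), fun z hz => ⟨(hν.2.1 z (hsb ⟨b, hb⟩ hz)).1, ?_⟩⟩
      rw [(hν.2.1 z (hsb ⟨b, hb⟩ hz)).2]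
      have h1 := hgh ⟨b, hb⟩ ν z (hρD ⟨b, hb⟩ (hsb ⟨b, hb⟩ hz))
      rw [sub_eq_iff_eq_add'] at h1
      rw [h1, map_add, map_smul])
    (by
      intro b hb
      rw [hFb' b hb]
      exact (hFbt ⟨b, hb⟩).mono (hsb ⟨b, hb⟩))
    (fun z hz hzb => Finset.mem_union_left _ (hbad z hz hzb))
  have hjet : ∀ᶠ ν in atTop, ∀ j : Fin l, ∀ i ≤ k, iteratedDeriv i (fs ν) (zs j) = iteratedDeriv i f (zs j) := by
    refine eventually_all.2 fun j => ?_
    have hb : zs j ∈ B := Finset.mem_union_right _ (Finset.mem_image_of_mem _ (Finset.mem_univ j))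
    filter_upwards [hFb ⟨zs j, hb⟩] with ν hν i hi
    rw [← hν.2.2 i hi, ← hFb' _ hb]
    exact iteratedDeriv_congr_open isOpen_ball (hfsB ν _ hb) i (mem_ball_self hs0)
  obtain ⟨n, hn⟩ := eventually_atTop.1 (hU'.and hjet)
  refine ⟨fun ν => U' (ν + n), fun ν => fs (ν + n), ?_, ?_, ?_, ?_, ?_⟩
  · exact fun ν => ⟨(hn (ν+n) (by omega)).1.1, (hn (ν+n) (by omega)).1.2.1⟩
  · exact fun ν => (hn (ν+n) (by omega)).1.2.2.1
  · exact fun ν => (hn (ν+n) (by omega)).1.2.2.2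
  · exact fun ν => (hn (ν+n) (by omega)).2
  · intro i hi
    obtain ⟨F, h1, h2, h3⟩ := hconv i hi
    refine ⟨F, h1, h2, fun u hu => ?_⟩
    exact (tendsto_add_atTop_nat n).eventually (h3 u hu)

end Approx

/-- Approximation of maps from a planar domain into a closed complex submanifold
by maps holomorphic in neighborhoods of `D̄`, with `C^r(D̄)` convergence and jet
interpolation at finitely many points. -/
theorem approximation_planar_into_submanifold
    (M d : ℕ) (r : ℕ) (hr : 2 ≤ r)
    (D : Set ℂ) (hDopen : IsOpen D) (hDbdd : Bornology.IsBounded D)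
    (hDconn : IsConnected D) (hDsb : SmoothlyBounded D)
    (X : Set (Cn M)) (hX : ClosedComplexSubmanifold M d X)
    (f : ℂ → Cn M) (hf : ClassA r D f) (hfX : ∀ z ∈ closure D, f z ∈ X)
    (l : ℕ) (zs : Fin l → ℂ) (hzs : ∀ j, zs j ∈ D) (k : ℕ) :
    ∃ (U : ℕ → Set ℂ) (fs : ℕ → ℂ → Cn M),
      (∀ ν, IsOpen (U ν) ∧ closure D ⊆ U ν) ∧
      (∀ ν, DifferentiableOn ℂ (fs ν) (U ν)) ∧
      (∀ ν, ∀ z ∈ U ν, fs ν z ∈ X) ∧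
      (∀ ν, ∀ j : Fin l, ∀ i ≤ k, iteratedDeriv i (fs ν) (zs j) = iteratedDeriv i f (zs j)) ∧
      ∀ i ≤ r, ∃ F : ℂ → Cn M,
        ContinuousOn F (closure D) ∧ EqOn F (iteratedDeriv i f) D ∧
        TendstoUniformlyOn (fun ν => iteratedDeriv i (fs ν)) F atTop (closure D) := by
  exact Approx.main_aux M d r hr D hDopen hDbdd hDconn hDsb X hX f hf hfX l zs hzs k
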